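/- Let G be a planar triangle-free graph and let u, v be two non-adjacent vertices of G. Then any assignment of colors from {1,2,3} to u and v extends to a proper 3-coloring of G. -/

import Mathlib

universe u
variable {V : Type u}



/-- A topological embedding (drawing) of a simple graph in a topological space `X`:
vertices map to distinct points, edges map to arcs meeting only at common endpoints. -/
structure GraphEmbeddingIn (X : Type*) [TopologicalSpace X] (G : SimpleGraph V) where
  vertexPos : V → X
  vertexInj : Function.Injective vertexPos
  edgeArc : ∀ u v : V, G.Adj u v → ℝ → X
  arc_cont : ∀ u v h, ContinuousOn (edgeArc u v h) (Set.Icc 0 1)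
  arc_injOn : ∀ u v h, Set.InjOn (edgeArc u v h) (Set.Icc 0 1)
  arc_start : ∀ u v h, edgeArc u v h 0 = vertexPos u
  arc_end : ∀ u v h, edgeArc u v h 1 = vertexPos v
  arc_avoid : ∀ u v h (w : V), vertexPos w ∉ edgeArc u v h '' Set.Ioo 0 1
  arc_disjoint : ∀ u v h u' v' h', s(u, v) ≠ s(u', v') →
    edgeArc u v h '' Set.Ioo 0 1 ∩ edgeArc u' v' h' '' Set.Icc 0 1 = ∅

/-- A graph is planar if it has a drawing in the plane. -/
def SimpleGraph.IsPlanar (G : SimpleGraph V) : Prop :=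
  Nonempty (GraphEmbeddingIn (ℝ × ℝ) G)

namespace KostochkaYancey

open Finset Classical

variable {W : Type u}

/-- The number of ordered pairs in `A × B` that are adjacent in `G`. -/
noncomputable def crossing (G : SimpleGraph W) (A B : Finset W) : ℤ :=
  ∑ a ∈ A, ∑ b ∈ B, if G.Adj a b then 1 else 0

/-- The number of edges of `G` with both ends in `R`. -/
noncomputable def edgesIn (G : SimpleGraph W) (R : Finset W) : ℤ := crossing G R R / 2

/-- The Kostochka–Yancey potential. -/
noncomputable def potential (G : SimpleGraph W) (R : Finset W) : ℤ :=
  5 * (#R : ℤ) - 3 * edgesIn G R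

/-- `G` restricted to `R` is properly 3-colourable. -/
def ThreeColorableOn (G : SimpleGraph W) (R : Finset W) : Prop :=
  ∃ c : W → Fin 3, ∀ x ∈ R, ∀ y ∈ R, G.Adj x y → c x ≠ c y

theorem crossing_nonneg (G : SimpleGraph W) (A B : Finset W) : 0 ≤ crossing G A B :=
  Finset.sum_nonneg fun _ _ => Finset.sum_nonneg fun _ _ => by split_ifs <;> norm_num

theorem crossing_comm (G : SimpleGraph W) (A B : Finset W) : crossing G A B = crossing G B A := by
  unfold crossing
  rw [Finset.sum_comm]
  simp only [G.adj_comm]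

theorem crossing_union_left (G : SimpleGraph W) {A B : Finset W} (C : Finset W)
    (h : Disjoint A B) : crossing G (A ∪ B) C = crossing G A C + crossing G B C :=
  Finset.sum_union h

theorem crossing_union_right (G : SimpleGraph W) (A : Finset W) {B C : Finset W}
    (h : Disjoint B C) : crossing G A (B ∪ C) = crossing G A B + crossing G A C := by
  rw [crossing_comm, crossing_union_left G A h, crossing_comm G B, crossing_comm G C]

theorem crossing_mono (G : SimpleGraph W) {A B C D : Finset W} (h : A ⊆ C) (h' : B ⊆ D) :
    crossing G A B ≤ crossing G C D := by
  unfold crossing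
  calc _ ≤ ∑ a ∈ A, ∑ b ∈ D, (if G.Adj a b then (1 : ℤ) else 0) := by
        refine Finset.sum_le_sum fun a _ => Finset.sum_le_sum_of_subset_of_nonneg h' ?_
        intros; split_ifs <;> norm_num
    _ ≤ _ := by
        refine Finset.sum_le_sum_of_subset_of_nonneg h ?_
        intros; refine Finset.sum_nonneg fun _ _ => ?_
        split_ifs <;> norm_num

theorem crossing_eq_sum_card (G : SimpleGraph W) (A B : Finset W) :
    crossing G A B = ∑ a ∈ A, (#(B.filter (G.Adj a)) : ℤ) := by
  simp [crossing]

theorem crossing_self_singleton (G : SimpleGraph W) (x : W) : crossing G {x} {x} = 0 := by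
  simp [crossing]

theorem two_mul_edgesIn (G : SimpleGraph W) (R : Finset W) :
    2 * edgesIn G R = crossing G R R := by
  have : (2 : ℤ) ∣ crossing G R R := by
    induction R using Finset.induction_on with
    | empty => simp [crossing]
    | insert x R hx ih =>
      have hd : Disjoint {x} R := by simpa using hx
      rw [Finset.insert_eq, crossing_union_left _ _ hd, crossing_union_right _ _ hd,
        crossing_union_right _ _ hd, crossing_self_singleton, crossing_comm G R {x}]
      omega
  unfold edgesIn
  omega

theorem two_mul_potential (G : SimpleGraph W) (R : Finset W) :
    2 * potential G R = 10 * (#R : ℤ) - 3 * crossing G R R := by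
  have := two_mul_edgesIn G R
  unfold potential
  linarith

theorem crossing_self_le (G : SimpleGraph W) (R : Finset W) :
    crossing G R R ≤ #R * (#R - 1) := by
  rw [crossing_eq_sum_card]
  calc _ ≤ ∑ a ∈ R, ((#R : ℤ) - 1) := by
        refine Finset.sum_le_sum fun a ha => ?_
        have : #(R.filter (G.Adj a)) ≤ #(R.erase a) := by
          refine card_le_card fun y hy => ?_
          rw [mem_filter] at hy
          exact mem_erase.2 ⟨hy.2.ne', hy.1⟩
        rw [card_erase_of_mem ha] at this
        have h1 : 1 ≤ #R := card_pos.2 ⟨a, ha⟩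
        omega
    _ = _ := by rw [sum_const, nsmul_eq_mul]

theorem ThreeColorableOn.mono {G : SimpleGraph W} {R S : Finset W} (h : R ⊆ S)
    (hS : ThreeColorableOn G S) : ThreeColorableOn G R := by
  obtain ⟨c, hc⟩ := hS
  exact ⟨c, fun x hx y hy => hc x (h hx) y (h hy)⟩

theorem ThreeColorableOn.congr {G G' : SimpleGraph W} {R : Finset W}
    (h : ∀ x ∈ R, ∀ y ∈ R, G'.Adj x y → G.Adj x y)
    (hS : ThreeColorableOn G R) : ThreeColorableOn G' R := by
  obtain ⟨c, hc⟩ := hS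
  exact ⟨c, fun x hx y hy ha => hc x hx y hy (h x hx y hy ha)⟩

/-- Contract each colour class of `R` to one of three representatives in `R`, which are made
pairwise adjacent. -/
def contraction (G : SimpleGraph W) (S : Finset W) (X : Finset W) (π : W → W) :
    SimpleGraph W where
  Adj a b := a ≠ b ∧ ((a ∈ X ∧ b ∈ X) ∨ ∃ p ∈ S, ∃ q ∈ S, G.Adj p q ∧ π p = a ∧ π q = b)
  symm := ⟨by
    rintro a b ⟨h, h'⟩
    refine ⟨h.symm, ?_⟩
    rcases h' with h' | ⟨p, hp, q, hq, h1, h2, h3⟩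
    · exact Or.inl h'.symm
    · exact Or.inr ⟨q, hq, p, hp, h1.symm, h3, h2⟩⟩
  loopless := ⟨fun a h => h.1 rfl⟩

theorem exists_extension_of_proper_subset (G : SimpleGraph W) {S R : Finset W}
    (ih : ∀ (G : SimpleGraph W) (T : Finset W), #T < #S → ¬ ThreeColorableOn G T →
      ∃ Q ⊆ T, ¬ ThreeColorableOn G Q ∧ potential G Q ≤ 2)
    (hS : ¬ ThreeColorableOn G S) (hcrit : ∀ T ⊂ S, ThreeColorableOn G T)
    (hRS : R ⊂ S) (hR : 4 ≤ #R) (φ : W → Fin 3)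
    (hφ : ∀ x ∈ R, ∀ y ∈ R, G.Adj x y → φ x ≠ φ y) :
    ∃ (R' : Finset W) (C : Finset (Fin 3)), R ⊂ R' ∧ R' ⊆ S ∧ C.Nonempty ∧
      potential G R' + 3 * crossing G (R.filter (φ · ∉ C)) (R' \ R) +
        (if #C = 1 then 5 else 6) ≤ 2 + potential G R := by
  obtain ⟨Y, hYR, hYc⟩ := exists_subset_card_eq (show 3 ≤ #R by omega)
  let rep : Fin 3 ≃ Y := (Y.equivFinOfCardEq hYc).symm
  let x : Fin 3 → W := fun i => rep i
  have hxinj : Function.Injective x := Subtype.val_injective.comp rep.injective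
  have hxR : ∀ i, x i ∈ R := fun i => hYR (rep i).2
  have hxY : ∀ y ∈ Y, ∃ i, x i = y := fun y hy => ⟨rep.symm ⟨y, hy⟩, by simp [x]⟩
  have hxY' : ∀ i, x i ∈ Y := fun i => (rep i).2
  let π : W → W := fun w => if w ∈ R then x (φ w) else w
  have hπR : ∀ w ∈ R, π w = x (φ w) := fun w hw => if_pos hw
  have hπN : ∀ w, w ∉ R → π w = w := fun w hw => if_neg hw
  let G' := contraction G S Y π
  let S' := (S \ R) ∪ Y
  have hS'c : #S' < #S := by
    have h1 : #S' ≤ #(S \ R) + #Y := card_union_le _ _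
    have h2 := card_sdiff_of_subset hRS.1
    have h3 := card_le_card hRS.1
    omega
  have hS'n : ¬ ThreeColorableOn G' S' := by
    rintro ⟨c, hc⟩
    refine hS ⟨fun w => c (π w), fun p hp q hq hpq => ?_⟩
    have hmem : ∀ p ∈ S, π p ∈ S' := by
      intro p hp
      by_cases h : p ∈ R
      · rw [hπR p h]; exact mem_union_right _ (hxY' _)
      · rw [hπN p h]; exact mem_union_left _ (mem_sdiff.2 ⟨hp, h⟩)
    refine hc _ (hmem p hp) _ (hmem q hq) ⟨fun heq => ?_, Or.inr ⟨p, hp, q, hq, hpq, rfl, rfl⟩⟩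
    by_cases h1 : p ∈ R <;> by_cases h2 : q ∈ R
    · rw [hπR p h1, hπR q h2] at heq
      exact hφ p h1 q h2 hpq (hxinj heq)
    · rw [hπR p h1, hπN q h2] at heq
      exact h2 (heq ▸ hxR _)
    · rw [hπN p h1, hπR q h2] at heq
      exact h1 (heq ▸ hxR _)
    · rw [hπN p h1, hπN q h2] at heq
      exact hpq.ne heq
  obtain ⟨Q, hQS, hQn, hQp⟩ := ih G' S' hS'c hS'n
  let T := Q \ Y
  let X := Q ∩ Y
  have hTS : ∀ w ∈ T, w ∈ S ∧ w ∉ R := by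
    intro w hw
    have h1 := mem_sdiff.1 hw
    have := hQS h1.1
    simp only [S', mem_union, mem_sdiff] at this
    rcases this with h | h
    · exact h
    · exact absurd h h1.2
  have hTadj : ∀ a ∈ T, ∀ b ∈ T, G'.Adj a b ↔ G.Adj a b := by
    intro a ha b hb
    have hback : ∀ p, π p ∉ R → π p = p := by
      intro p hp
      by_cases h : p ∈ R
      · rw [hπR p h] at hp; exact absurd (hxR _) hp
      · exact hπN p h
    constructor
    · rintro ⟨_, h | ⟨p, _, q, _, hpq, rfl, rfl⟩⟩
      · exact absurd h.1 (mem_sdiff.1 ha).2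
      · rw [hback p (hTS _ ha).2, hback q (hTS _ hb).2]; exact hpq
    · intro h
      exact ⟨h.ne, Or.inr ⟨a, (hTS a ha).1, b, (hTS b hb).1, h, hπN a (hTS a ha).2,
        hπN b (hTS b hb).2⟩⟩
  have hTR : Disjoint R T := by
    rw [disjoint_right]; exact fun w hw => (hTS w hw).2
  have hTne : T.Nonempty := by
    by_contra hT
    rw [not_nonempty_iff_eq_empty] at hT
    have hQY : Q ⊆ Y := by simpa [T] using hT
    refine hQn ⟨fun w => if h : w ∈ Y then rep.symm ⟨w, h⟩ else 0, fun p hp q hq hpq => ?_⟩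
    simp only [hQY hp, hQY hq, dite_true]
    intro h
    have := rep.symm.injective h
    simp at this
    exact hpq.ne this
  have hXne : X.Nonempty := by
    by_contra hX
    rw [not_nonempty_iff_eq_empty] at hX
    have hQT : Q = T := by
      ext w
      simp only [T, mem_sdiff]
      refine ⟨fun h => ⟨h, fun h' => ?_⟩, fun h => h.1⟩
      have : w ∈ X := mem_inter.2 ⟨h, h'⟩
      simp [hX] at this
    rw [hQT] at hQn
    have hRne : R.Nonempty := card_pos.1 (by omega)
    refine hQn ((hcrit T ?_).congr fun a ha b hb => (hTadj a ha b hb).1)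
    refine ⟨fun w hw => (hTS w hw).1, fun h => ?_⟩
    obtain ⟨r, hr⟩ := hRne
    exact (hTS r (h (hRS.1 hr))).2 hr
  let C : Finset (Fin 3) := univ.filter fun i => x i ∈ Q
  have hXC : X = C.image x := by
    ext w
    simp only [X, C, mem_inter, mem_image, mem_filter, mem_univ, true_and]
    constructor
    · rintro ⟨h1, h2⟩
      obtain ⟨i, rfl⟩ := hxY w h2
      exact ⟨i, h1, rfl⟩
    · rintro ⟨i, h1, rfl⟩
      exact ⟨h1, hxY' i⟩
  have hXcard : #X = #C := by rw [hXC, card_image_of_injective _ hxinj]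
  have hcross : crossing G' T X + crossing G T (R.filter (φ · ∉ C)) ≤ crossing G T R := by
    have hsplit : crossing G T R
        = crossing G T (R.filter (φ · ∈ C)) + crossing G T (R.filter (φ · ∉ C)) := by
      rw [← crossing_union_right _ _ (disjoint_filter_filter_not _ _ _), filter_union_filter_not_eq]
    rw [hsplit]
    refine add_le_add_left ?_ _
    rw [crossing_eq_sum_card, crossing_eq_sum_card]
    refine sum_le_sum fun w hw => ?_
    rw [Nat.cast_le]
    refine (card_le_card ?_).trans (card_image_le (s := (R.filter (φ · ∈ C)).filter (G.Adj w))
      (f := fun p => x (φ p)))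
    intro y hy
    rw [mem_filter] at hy
    obtain ⟨hyX, _, h | ⟨p, hp, q, hq, hpq, h1, h2⟩⟩ := hy
    · exact absurd h.1 (mem_sdiff.1 hw).2
    · have hyR : y ∈ R := hYR (mem_inter.1 hyX).2
      have hqR : q ∈ R := by
        by_contra hqR
        rw [hπN q hqR] at h2
        exact hqR (h2 ▸ hyR)
      have hpw : p = w := by
        by_cases hpR : p ∈ R
        · rw [hπR p hpR] at h1
          exact absurd (h1 ▸ hxR _) (hTS w hw).2
        · rw [hπN p hpR] at h1; exact h1
      subst hpw
      rw [hπR q hqR] at h2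
      refine mem_image.2 ⟨q, mem_filter.2 ⟨mem_filter.2 ⟨hqR, ?_⟩, hpq⟩, h2⟩
      simp only [C, mem_filter, mem_univ, true_and, h2]
      exact (mem_inter.1 hyX).1
  have hXself := crossing_self_le G' X
  have hQsplit : Q = T ∪ X := by simp [T, X, sdiff_union_inter]
  have hTX : Disjoint T X := disjoint_sdiff_inter _ _
  have hpQ := two_mul_potential G' Q
  have hcQ : crossing G' Q Q = crossing G' T T + 2 * crossing G' T X + crossing G' X X := by
    rw [hQsplit, crossing_union_left _ _ hTX, crossing_union_right _ _ hTX,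
      crossing_union_right _ _ hTX, crossing_comm G' X T]
    ring
  have hcardQ : #Q = #T + #X := by rw [hQsplit, card_union_of_disjoint hTX]
  have hTT : crossing G' T T = crossing G T T := by
    unfold crossing
    refine sum_congr rfl fun a ha => sum_congr rfl fun b hb => ?_
    simp only [hTadj a ha b hb]
  have hR' : (R ∪ T) \ R = T := by rw [union_sdiff_cancel_left hTR]
  have hpR' := two_mul_potential G (R ∪ T)
  have hpR := two_mul_potential G R
  have hcR' : crossing G (R ∪ T) (R ∪ T)
      = crossing G R R + 2 * crossing G T R + crossing G T T := by
    rw [crossing_union_left _ _ hTR, crossing_union_right _ _ hTR,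
      crossing_union_right _ _ hTR, crossing_comm G R T]
    ring
  have hcardR' : #(R ∪ T) = #R + #T := card_union_of_disjoint hTR
  refine ⟨R ∪ T, C, ?_, ?_, ?_, ?_⟩
  · obtain ⟨t, ht⟩ := hTne
    exact ⟨subset_union_left, fun h => (hTS t ht).2 (h (mem_union_right _ ht))⟩
  · exact union_subset hRS.1 fun w hw => (hTS w hw).1
  · rw [← card_pos, ← hXcard]; exact card_pos.2 hXne
  · rw [hR', crossing_comm]
    have hCpos : 1 ≤ #C := by rw [← hXcard]; exact card_pos.2 hXne
    have hC3 : #C ≤ 3 := by simpa using card_le_univ C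
    rw [hXcard] at hXself hcardQ
    push_cast [hcardQ, hcardR'] at hpQ hpR'
    have : #C = 1 ∨ #C = 2 ∨ #C = 3 := by omega
    rcases this with h | h | h <;> simp only [h] at * <;> norm_num at * <;> linarith

/-- A set of vertices that is critical for 3-colourability, of potential at least 3, such that the
Kostochka–Yancey bound holds for all smaller sets of vertices. -/
structure IsMinimalCounterexample (G : SimpleGraph W) (S : Finset W) : Prop where
  ih : ∀ (G : SimpleGraph W) (T : Finset W), #T < #S → ¬ ThreeColorableOn G T →
      ∃ Q ⊆ T, ¬ ThreeColorableOn G Q ∧ potential G Q ≤ 2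
  not_colorable : ¬ ThreeColorableOn G S
  critical : ∀ T ⊂ S, ThreeColorableOn G T
  three_le : 3 ≤ potential G S

namespace IsMinimalCounterexample

variable {G : SimpleGraph W} {S : Finset W}

theorem six_le_potential (h : IsMinimalCounterexample G S) {R : Finset W} (hRS : R ⊂ S)
    (hR : 2 ≤ #R) : 6 ≤ potential G R := by
  by_contra! hlt
  let 𝒜 := S.powerset.filter fun T => T ≠ S ∧ 2 ≤ #T
  have hmem : R ∈ 𝒜 := mem_filter.2 ⟨mem_powerset.2 hRS.1, hRS.ne, hR⟩
  obtain ⟨T, hT, hmin⟩ := exists_min_image 𝒜 (potential G) ⟨R, hmem⟩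
  have hTp : potential G T < 6 := (hmin R hmem).trans_lt hlt
  obtain ⟨hTS, hTne, hT2⟩ := mem_filter.1 hT
  have hTS' : T ⊂ S := (mem_powerset.1 hTS).ssubset_of_ne hTne
  have hT4 : 4 ≤ #T := by
    by_contra! h4
    have h1 := crossing_self_le G T
    have h2 := two_mul_potential G T
    have : #T = 2 ∨ #T = 3 := by omega
    rcases this with h | h <;> simp only [h] at * <;> norm_num at * <;> linarith
  obtain ⟨φ, hφ⟩ := h.critical T hTS'
  obtain ⟨T', C, hTT', hT'S, hC, hpot⟩ :=
    exists_extension_of_proper_subset G h.ih h.not_colorable h.critical hTS' hT4 φ hφ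
  have hnn := crossing_nonneg G (T.filter (φ · ∉ C)) (T' \ T)
  have hlt' : potential G T' + 5 ≤ 2 + potential G T := by
    split_ifs at hpot <;> linarith
  by_cases hE : T' = S
  · subst hE; linarith [h.three_le]
  · have : potential G T ≤ potential G T' :=
      hmin T' (mem_filter.2 ⟨mem_powerset.2 hT'S, hE, hT2.trans (card_le_card hTT'.1)⟩)
    linarith

theorem exists_boundary (h : IsMinimalCounterexample G S) {R : Finset W} (hRS : R ⊂ S)
    (hR : 2 ≤ #R) : ∃ u ∈ R, ∃ v ∈ R, u ≠ v ∧ (∃ w ∈ S \ R, G.Adj u w) ∧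
      ∃ w ∈ S \ R, G.Adj v w := by
  by_contra! hcon
  have : ∃ u ∈ R, ∀ p ∈ R, p ≠ u → ∀ w ∈ S \ R, ¬ G.Adj p w := by
    by_cases hu : ∃ u ∈ R, ∃ w ∈ S \ R, G.Adj u w
    · obtain ⟨u, huR, w, hw, huw⟩ := hu
      exact ⟨u, huR, fun p hp hpu => hcon u huR p hp hpu.symm ⟨w, hw, huw⟩⟩
    · push Not at hu
      obtain ⟨u, huR⟩ := card_pos.1 (by omega : 0 < #R)
      exact ⟨u, huR, fun p hp _ => hu p hp⟩
  obtain ⟨u, huR, hu⟩ := this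
  obtain ⟨c₁, hc₁⟩ := h.critical R hRS
  have hsub : insert u (S \ R) ⊂ S := by
    refine ⟨insert_subset (hRS.1 huR) sdiff_subset, fun hs => ?_⟩
    obtain ⟨v, hvR, hvu⟩ := exists_mem_ne (by omega : 1 < #R) u
    have := hs (hRS.1 hvR)
    simp [hvu, hvR] at this
  obtain ⟨c₂, hc₂⟩ := h.critical _ hsub
  let σ := Equiv.swap (c₂ u) (c₁ u)
  have hσ : σ (c₂ u) = c₁ u := Equiv.swap_apply_left _ _
  have hcross : ∀ p ∈ R, ∀ q ∈ S, q ∉ R → G.Adj p q → c₁ p ≠ σ (c₂ q) := by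
    intro p hp q hq hqR hpq
    have hpu : p = u := by
      by_contra hpu
      exact hu p hp hpu q (mem_sdiff.2 ⟨hq, hqR⟩) hpq
    subst hpu
    rw [← hσ]
    exact fun he => hc₂ p (mem_insert_self _ _) q
      (mem_insert_of_mem (mem_sdiff.2 ⟨hq, hqR⟩)) hpq (σ.injective he)
  refine h.not_colorable ⟨fun w => if w ∈ R then c₁ w else σ (c₂ w), fun p hp q hq hpq => ?_⟩
  by_cases h1 : p ∈ R <;> by_cases h2 : q ∈ R <;> simp only [h1, h2, if_true, if_false]
  · exact hc₁ p h1 q h2 hpq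
  · exact hcross p h1 q hq h2 hpq
  · exact (hcross q h2 p hp h1 hpq.symm).symm
  · exact fun he => hc₂ p (mem_insert_of_mem (mem_sdiff.2 ⟨hp, h1⟩)) q
      (mem_insert_of_mem (mem_sdiff.2 ⟨hq, h2⟩)) hpq (σ.injective he)

theorem crossing_sup_edge_le (G : SimpleGraph W) (u v : W) (Q : Finset W) :
    crossing (G ⊔ SimpleGraph.edge u v) Q Q ≤ crossing G Q Q + 2 := by
  have : crossing (G ⊔ SimpleGraph.edge u v) Q Q ≤ ∑ a ∈ Q, ∑ b ∈ Q,
      ((if G.Adj a b then (1 : ℤ) else 0) + ((if a = u ∧ b = v then 1 else 0)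
        + (if a = v ∧ b = u then 1 else 0))) := by
    refine sum_le_sum fun a _ => sum_le_sum fun b _ => ?_
    simp only [SimpleGraph.sup_adj, SimpleGraph.edge_adj]
    split_ifs <;> first | omega | (exfalso; tauto)
  refine this.trans ?_
  simp only [sum_add_distrib]
  have key : ∀ u v : W, ∑ a ∈ Q, ∑ b ∈ Q, (if a = u ∧ b = v then (1 : ℤ) else 0) ≤ 1 := by
    intro u v
    simp only [ite_and, sum_ite_irrel, sum_const_zero, sum_ite_eq']
    split_ifs <;> norm_num
  have := key u v
  have := key v u
  unfold crossing
  linarith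

/-- If colouring `R` so that `u` and `v` differ is impossible, then some proper subset
has small potential. -/
theorem exists_coloring_ne (h : IsMinimalCounterexample G S) {R : Finset W} (hRS : R ⊂ S)
    {u v : W} (hu : u ∈ R) (hv : v ∈ R) (huv : u ≠ v) :
    ∃ φ : W → Fin 3, (∀ x ∈ R, ∀ y ∈ R, G.Adj x y → φ x ≠ φ y) ∧ φ u ≠ φ v := by
  by_cases hc : ThreeColorableOn (G ⊔ SimpleGraph.edge u v) R
  · obtain ⟨c, hc⟩ := hc
    refine ⟨c, fun x hx y hy hxy => hc x hx y hy (Or.inl hxy), hc u hu v hv (Or.inr ?_)⟩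
    simp [SimpleGraph.edge_adj, huv]
  · obtain ⟨Q, hQR, hQn, hQp⟩ := h.ih _ R (card_lt_card hRS) hc
    have hQS : Q ⊂ S := hQR.trans_ssubset hRS
    have hmem : u ∈ Q ∧ v ∈ Q := by
      by_contra hmem
      refine hQn ((h.critical Q hQS).congr fun x hx y hy hxy => ?_)
      rcases hxy with hxy | hxy
      · exact hxy
      · rw [SimpleGraph.edge_adj] at hxy
        rcases hxy.1 with ⟨rfl, rfl⟩ | ⟨rfl, rfl⟩
        · exact absurd ⟨hx, hy⟩ hmem
        · exact absurd ⟨hy, hx⟩ hmem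
    have h2 : 2 ≤ #Q := one_lt_card.2 ⟨u, hmem.1, v, hmem.2, huv⟩
    have h6 := h.six_le_potential hQS h2
    have h3 := two_mul_potential G Q
    have h4 := two_mul_potential (G ⊔ SimpleGraph.edge u v) Q
    have h5 := crossing_sup_edge_le G u v Q
    linarith

theorem seven_le_potential (h : IsMinimalCounterexample G S) {R : Finset W} (hRS : R ⊂ S)
    (hR : 4 ≤ #R) : 7 ≤ potential G R := by
  by_contra! hlt
  obtain ⟨u, hu, v, hv, huv, ⟨w₁, hw₁, huw⟩, w₂, hw₂, hvw⟩ := h.exists_boundary hRS (by omega)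
  obtain ⟨φ, hφ, hφuv⟩ := h.exists_coloring_ne hRS hu hv huv
  obtain ⟨R', C, hRR', hR'S, hC, hpot⟩ :=
    exists_extension_of_proper_subset G h.ih h.not_colorable h.critical hRS hR φ hφ
  have hnn := crossing_nonneg G (R.filter (φ · ∉ C)) (R' \ R)
  have hR'eq : R' = S := by
    by_contra hne
    have := h.six_le_potential (hR'S.ssubset_of_ne hne)
      ((by omega : 2 ≤ #R).trans (card_le_card hRR'.1))
    split_ifs at hpot <;> linarith
  subst hR'eq
  have h3 := h.three_le
  split_ifs at hpot with hC1
  · obtain ⟨i, rfl⟩ := card_eq_one.1 hC1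
    have hpos : ∀ p ∈ R, φ p ≠ i → ∀ w ∈ R' \ R, G.Adj p w →
        1 ≤ crossing G (R.filter (φ · ∉ ({i} : Finset (Fin 3)))) (R' \ R) := by
      intro p hp hpi w hw hpw
      have hp' : {p} ⊆ R.filter (φ · ∉ ({i} : Finset (Fin 3))) := by
        simp [hp, hpi]
      have := crossing_mono G hp' (singleton_subset_iff.2 hw)
      have h1 : crossing G {p} {w} = 1 := by
        simp only [crossing, sum_singleton, hpw, if_true]
      rwa [h1] at this
    have : 1 ≤ crossing G (R.filter (φ · ∉ ({i} : Finset (Fin 3)))) (R' \ R) := by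
      by_cases hi : φ u = i
      · exact hpos v hv (fun hvi => hφuv (hi.trans hvi.symm)) w₂ hw₂ hvw
      · exact hpos u hu hi w₁ hw₁ huw
    linarith
  · linarith

/-- The neighbours of `x` within `S`. -/
noncomputable def _root_.KostochkaYancey.nbhd (G : SimpleGraph W) (S : Finset W) (x : W) :
    Finset W := S.filter (G.Adj x)

theorem _root_.KostochkaYancey.mem_nbhd {G : SimpleGraph W} {S : Finset W} {x y : W} :
    y ∈ nbhd G S x ↔ y ∈ S ∧ G.Adj x y := mem_filter

theorem exists_color_avoiding (A : Finset (Fin 3)) (hA : #A < 3) : ∃ i, i ∉ A := by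
  by_contra! hcon
  have : #A = 3 := by rw [(eq_univ_iff_forall.2 hcon)]; simp
  omega

theorem three_le_degree (h : IsMinimalCounterexample G S) {x : W} (hx : x ∈ S) :
    3 ≤ #(nbhd G S x) := by
  by_contra! hlt
  obtain ⟨c, hc⟩ := h.critical (S.erase x) (erase_ssubset hx)
  obtain ⟨i, hi⟩ := exists_color_avoiding ((nbhd G S x).image c) (card_image_le.trans_lt hlt)
  have hi' : ∀ y ∈ S, G.Adj x y → c y ≠ i := fun y hy hxy he =>
    hi (mem_image.2 ⟨y, mem_nbhd.2 ⟨hy, hxy⟩, he⟩)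
  refine h.not_colorable ⟨Function.update c x i, fun p hp q hq hpq => ?_⟩
  by_cases h1 : p = x
  · subst h1
    rw [Function.update_self, Function.update_of_ne hpq.ne']
    exact (hi' q hq hpq).symm
  · by_cases h2 : q = x
    · subst h2
      rw [Function.update_self, Function.update_of_ne h1]
      exact hi' p hp hpq.symm
    · rw [Function.update_of_ne h1, Function.update_of_ne h2]
      exact hc p (mem_erase.2 ⟨h1, hp⟩) q (mem_erase.2 ⟨h2, hq⟩) hpq

/-- A colouring of `S` minus two adjacent vertices extends if both can be coloured. -/
theorem extend_two (h : IsMinimalCounterexample G S) {x y : W}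
    (c : W → Fin 3) (hc : ∀ p ∈ (S.erase x).erase y, ∀ q ∈ (S.erase x).erase y,
      G.Adj p q → c p ≠ c q) (i j : Fin 3) (hij : i ≠ j)
    (hi : ∀ p ∈ S, p ≠ y → G.Adj x p → c p ≠ i) (hj : ∀ p ∈ S, p ≠ x → G.Adj y p → c p ≠ j) :
    False := by
  refine h.not_colorable ⟨fun w => if w = x then i else if w = y then j else c w,
    fun p hp q hq hpq => ?_⟩
  have hne := hpq.ne
  by_cases hpx : p = x
  · subst hpx
    by_cases hqy : q = y
    · subst hqy
      simp only [if_true, hne.symm, if_false]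
      exact hij
    · simp only [if_true, hne.symm, if_false, hqy]
      exact (hi q hq hqy hpq).symm
  · by_cases hqx : q = x
    · subst hqx
      by_cases hpy : p = y
      · subst hpy
        simp [hne, hij.symm]
      · simp only [hne, if_true, if_false, hpy]
        exact hi p hp hpy hpq.symm
    · simp only [hpx, hqx, if_false]
      by_cases hpy : p = y
      · subst hpy
        simp only [if_true, hne.symm, if_false]
        exact (hj q hq hqx hpq).symm
      · by_cases hqy : q = y
        · subst hqy
          simp only [if_true, hne, if_false]
          exact hj p hp hpx hpq.symm
        · simp only [hpy, hqy, if_false]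
          exact hc p (by simp [*]) q (by simp [*]) hpq

theorem erase_erase_ssubset {x y : W} (hx : x ∈ S) : (S.erase x).erase y ⊂ S :=
  (erase_subset _ _).trans_ssubset (erase_ssubset hx)

theorem not_triangle_of_degree_three (h : IsMinimalCounterexample G S) {x y z : W}
    (hx : x ∈ S) (hy : y ∈ S) (hz : z ∈ S) (hxy : G.Adj x y) (hxz : G.Adj x z) (hyz : G.Adj y z)
    (hdx : #(nbhd G S x) = 3) (hdy : #(nbhd G S y) = 3) : False := by
  have third : ∀ x y z : W, y ∈ S → z ∈ S → G.Adj x y → G.Adj x z → y ≠ z →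
      #(nbhd G S x) = 3 → ∃ a ∈ S, G.Adj x a ∧ a ≠ y ∧ a ≠ z ∧
        ∀ p ∈ S, G.Adj x p → p = y ∨ p = z ∨ p = a := by
    intro x y z hy hz hxy hxz hyz hd
    have hsub : {y, z} ⊆ nbhd G S x := by
      intro p hp
      simp only [mem_insert, mem_singleton] at hp
      rcases hp with rfl | rfl <;> simp [mem_nbhd, *]
    have h1 := card_sdiff_of_subset hsub
    rw [hd, card_pair hyz] at h1
    obtain ⟨a, ha⟩ := card_eq_one.1 h1
    have ha' : a ∈ nbhd G S x \ {y, z} := by simp [ha]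
    simp only [mem_sdiff, mem_nbhd, mem_insert, mem_singleton, not_or] at ha'
    refine ⟨a, ha'.1.1, ha'.1.2, ha'.2.1, ha'.2.2, fun p hp hxp => ?_⟩
    by_cases hpy : p = y
    · exact Or.inl hpy
    by_cases hpz : p = z
    · exact Or.inr (Or.inl hpz)
    have : p ∈ nbhd G S x \ {y, z} := 
      mem_sdiff.2 ⟨mem_nbhd.2 ⟨hp, hxp⟩, by simp [hpy, hpz]⟩
    rw [ha, mem_singleton] at this
    exact Or.inr (Or.inr this)
  obtain ⟨a, haS, hxa, hay, haz, ha⟩ := third x y z hy hz hxy hxz hyz.ne hdx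
  obtain ⟨b, hbS, hyb, hbx, hbz, hb⟩ := third y x z hx hz hxy.symm hyz hxz.ne hdy
  have hzT : z ∈ (S.erase x).erase y := by simp [hz, hxz.ne', hyz.ne']
  have haT : a ∈ (S.erase x).erase y := by simp [haS, hxa.ne', hay]
  have hbT : b ∈ (S.erase x).erase y := by simp [hbS, hbx, hyb.ne']
  by_cases hab : a = b
  · subst hab
    have hcard : #({x, y, z, a} : Finset W) = 4 := by
      rw [card_insert_of_notMem, card_insert_of_notMem, card_pair haz.symm] <;>
        simp [hxy.ne, hxz.ne, hxa.ne, hyz.ne, hyb.ne]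
    have hsub : ({x, y, z, a} : Finset W) ⊆ S := by
      intro p hp
      simp only [mem_insert, mem_singleton] at hp
      rcases hp with rfl | rfl | rfl | rfl <;> assumption
    have hcr : 10 ≤ crossing G ({x, y, z, a} : Finset W) {x, y, z, a} := by
      have hd1 : x ∉ ({y, z, a} : Finset W) := by simp [hxy.ne, hxz.ne, hxa.ne]
      have hd2 : y ∉ ({z, a} : Finset W) := by simp [hyz.ne, hyb.ne]
      have hd3 : z ∉ ({a} : Finset W) := by simp [haz.symm]
      unfold crossing
      simp only [sum_insert hd1, sum_insert hd2, sum_insert hd3, sum_singleton, hxy, hxz, hxa,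
        hyz, hyb, hxy.symm, hxz.symm, hxa.symm, hyz.symm, hyb.symm, if_true, SimpleGraph.irrefl,
        if_false]
      split_ifs <;> norm_num
    have hpot := two_mul_potential G ({x, y, z, a} : Finset W)
    rw [hcard] at hpot
    push_cast at hpot
    by_cases hE : ({x, y, z, a} : Finset W) = S
    · by_cases hza : G.Adj z a
      · have hcr : 12 ≤ crossing G ({x, y, z, a} : Finset W) {x, y, z, a} := by
          have hd1 : x ∉ ({y, z, a} : Finset W) := by simp [hxy.ne, hxz.ne, hxa.ne]
          have hd2 : y ∉ ({z, a} : Finset W) := by simp [hyz.ne, hyb.ne]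
          have hd3 : z ∉ ({a} : Finset W) := by simp [haz.symm]
          unfold crossing
          simp only [sum_insert hd1, sum_insert hd2, sum_insert hd3, sum_singleton, hxy, hxz,
            hxa, hyz, hyb, hxy.symm, hxz.symm, hxa.symm, hyz.symm, hyb.symm, if_true,
            SimpleGraph.irrefl, if_false, hza, hza.symm]
          norm_num
        have := h.three_le
        rw [← hE] at this
        linarith
      · have hdz := h.three_le_degree hz
        have : nbhd G S z ⊆ {x, y} := by
          intro p hp
          rw [mem_nbhd, ← hE] at hp
          simp only [mem_insert, mem_singleton] at hp ⊢
          rcases hp with ⟨rfl | rfl | rfl | rfl, h2⟩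
          · simp
          · simp
          · exact absurd rfl h2.ne
          · exact absurd h2 hza
        have := card_le_card this
        rw [card_pair hxy.ne] at this
        omega
    · have := h.seven_le_potential (hsub.ssubset_of_ne hE) (by omega)
      linarith
  · obtain ⟨c, hc, hcab⟩ := h.exists_coloring_ne (erase_erase_ssubset (y := y) hx) haT hbT hab
    have hza : ∀ i, (∀ p ∈ S, p ≠ y → G.Adj x p → c p ≠ i) ↔ c z ≠ i ∧ c a ≠ i := by
      intro i
      constructor
      · exact fun h => ⟨h z hz hyz.ne' hxz, h a haS hay hxa⟩
      · rintro ⟨h1, h2⟩ p hp hpy hxp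
        rcases ha p hp hxp with rfl | rfl | rfl
        · exact absurd rfl hpy
        · exact h1
        · exact h2
    have hzb : ∀ i, (∀ p ∈ S, p ≠ x → G.Adj y p → c p ≠ i) ↔ c z ≠ i ∧ c b ≠ i := by
      intro i
      constructor
      · exact fun h => ⟨h z hz hxz.ne' hyz, h b hbS hbx hyb⟩
      · rintro ⟨h1, h2⟩ p hp hpx hyp
        rcases hb p hp hyp with rfl | rfl | rfl
        · exact absurd rfl hpx
        · exact h1
        · exact h2
    have : ∀ k l m : Fin 3, l ≠ m → ∃ i j, i ≠ j ∧ (k ≠ i ∧ l ≠ i) ∧ (k ≠ j ∧ m ≠ j) := by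
      decide
    obtain ⟨i, j, hij, h1, h2⟩ := this (c z) (c a) (c b) hcab
    exact h.extend_two c hc i j hij ((hza i).2 h1) ((hzb j).2 h2)

end IsMinimalCounterexample

/-- Identify `v` with `u`. -/
def mergeGraph (G : SimpleGraph W) (u v : W) : SimpleGraph W where
  Adj a b := a ≠ b ∧ (G.Adj a b ∨ (a = u ∧ G.Adj v b) ∨ (b = u ∧ G.Adj v a))
  symm := ⟨by
    rintro a b ⟨h, h'⟩
    refine ⟨h.symm, ?_⟩
    rcases h' with h' | h' | h'
    · exact Or.inl h'.symm
    · exact Or.inr (Or.inr h')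
    · exact Or.inr (Or.inl h')⟩
  loopless := ⟨fun a h => h.1 rfl⟩

theorem crossing_mergeGraph_le (G : SimpleGraph W) (u v : W) (Q : Finset W) :
    crossing (mergeGraph G u v) Q Q ≤ crossing G Q Q + 2 * crossing G {v} Q := by
  have : crossing (mergeGraph G u v) Q Q ≤ ∑ a ∈ Q, ∑ b ∈ Q,
      ((if G.Adj a b then (1 : ℤ) else 0) + ((if a = u then if G.Adj v b then 1 else 0 else 0)
        + (if b = u then if G.Adj v a then 1 else 0 else 0))) := by
    refine sum_le_sum fun a _ => sum_le_sum fun b _ => ?_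
    by_cases hab : (mergeGraph G u v).Adj a b
    · rw [if_pos hab]
      rcases hab.2 with h | ⟨rfl, h⟩ | ⟨rfl, h⟩
      · rw [if_pos h]
        split_ifs <;> norm_num
      · rw [if_pos rfl, if_pos h]
        split_ifs <;> norm_num
      · rw [if_pos rfl, if_pos h]
        split_ifs <;> norm_num
    · rw [if_neg hab]
      split_ifs <;> norm_num
  refine this.trans ?_
  simp only [sum_add_distrib]
  have hnn : 0 ≤ crossing G {v} Q := crossing_nonneg _ _ _
  have h0 : crossing G {v} Q = ∑ b ∈ Q, if G.Adj v b then (1 : ℤ) else 0 := by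
    simp only [crossing, sum_singleton]
  have h1 : ∑ a ∈ Q, ∑ b ∈ Q, (if a = u then if G.Adj v b then (1 : ℤ) else 0 else 0)
      ≤ crossing G {v} Q := by
    rw [h0] at hnn ⊢
    simp only [sum_ite_irrel, sum_const_zero, sum_ite_eq']
    split_ifs
    · exact le_rfl
    · exact hnn
  have h2 : ∑ a ∈ Q, ∑ b ∈ Q, (if b = u then if G.Adj v a then (1 : ℤ) else 0 else 0)
      ≤ crossing G {v} Q := by
    rw [sum_comm]; exact h1
  have h3 : crossing G Q Q = ∑ a ∈ Q, ∑ b ∈ Q, if G.Adj a b then (1 : ℤ) else 0 := rfl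
  linarith

namespace IsMinimalCounterexample

variable {G : SimpleGraph W} {S : Finset W}

theorem adj_of_adjacent_degree_three (h : IsMinimalCounterexample G S) {x y u v : W}
    (hx : x ∈ S) (hy : y ∈ S) (hu : u ∈ S) (hv : v ∈ S) (hxy : G.Adj x y) (hxu : G.Adj x u)
    (hxv : G.Adj x v) (huv : u ≠ v) (huy : u ≠ y) (hvy : v ≠ y)
    (hN : ∀ p ∈ S, G.Adj x p → p = y ∨ p = u ∨ p = v) (hdy : #(nbhd G S y) = 3) :
    G.Adj u v := by
  by_contra hnadj
  set T := (S.erase x).erase y with hT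
  have hTS : T ⊂ S := erase_erase_ssubset hx
  have huT : u ∈ T := by simp [hT, hu, hxu.ne', huy]
  have hvT : v ∈ T := by simp [hT, hv, hxv.ne', hvy]
  have hcard : #(T.erase v) < #S := card_lt_card ((erase_subset _ _).trans_ssubset hTS)
  by_cases hcol : ThreeColorableOn (mergeGraph G u v) (T.erase v)
  · obtain ⟨c, hc⟩ := hcol
    have hcv : ∀ q ∈ T, G.Adj v q → c u ≠ c q := by
      intro q hq hvq
      have hqu : u ≠ q := by rintro rfl; exact hnadj hvq.symm
      exact hc u (by simp [huT, huv]) q (by simp [hq, hvq.ne']) ⟨hqu, Or.inr (Or.inl ⟨rfl, hvq⟩)⟩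
    have hc' : ∀ p ∈ T, ∀ q ∈ T, G.Adj p q →
        Function.update c v (c u) p ≠ Function.update c v (c u) q := by
      intro p hp q hq hpq
      by_cases h1 : p = v
      · subst h1
        rw [Function.update_self, Function.update_of_ne hpq.ne']
        exact hcv q hq hpq
      · by_cases h2 : q = v
        · subst h2
          rw [Function.update_self, Function.update_of_ne h1]
          exact (hcv p hp hpq.symm).symm
        · rw [Function.update_of_ne h1, Function.update_of_ne h2]
          exact hc p (by simp [hp, h1]) q (by simp [hq, h2]) ⟨hpq.ne, Or.inl hpq⟩
    have hxN : x ∈ nbhd G S y := mem_nbhd.2 ⟨hx, hxy.symm⟩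
    obtain ⟨j, hj⟩ := exists_color_avoiding
      (((nbhd G S y).erase x).image (Function.update c v (c u)))
      (card_image_le.trans_lt (by rw [card_erase_of_mem hxN]; omega))
    obtain ⟨i, hi⟩ := exists_color_avoiding ({c u, j} : Finset (Fin 3))
      (card_le_two.trans_lt (by norm_num))
    simp only [mem_insert, mem_singleton, not_or] at hi
    refine h.extend_two _ hc' i j hi.2 (fun p hp hpy hxp => ?_) fun p hp hpx hyp he =>
      hj (mem_image.2 ⟨p, mem_erase.2 ⟨hpx, mem_nbhd.2 ⟨hp, hyp⟩⟩, he⟩)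
    rcases hN p hp hxp with rfl | rfl | rfl
    · exact absurd rfl hpy
    · rw [Function.update_of_ne huv]; exact Ne.symm hi.1
    · rw [Function.update_self]; exact Ne.symm hi.1
  · obtain ⟨Q, hQT, hQn, hQp⟩ := h.ih _ _ hcard hcol
    have hQS : Q ⊂ S := (hQT.trans (erase_subset _ _)).trans_ssubset hTS
    have huQ : u ∈ Q := by
      by_contra huQ
      refine hQn ((h.critical Q hQS).congr fun p hp q hq hpq => ?_)
      rcases hpq.2 with hpq | ⟨rfl, -⟩ | ⟨rfl, -⟩
      · exact hpq
      · exact absurd hp huQ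
      · exact absurd hq huQ
    have hQ2 : 2 ≤ #Q := by
      by_contra! hlt
      have h1 := card_le_one.1 (by omega : #Q ≤ 1)
      exact hQn ⟨fun _ => 0, fun p hp q hq hpq => absurd (h1 p hp q hq) hpq.1⟩
    have hmemQ : ∀ p ∈ Q, p ≠ v ∧ p ≠ x ∧ p ≠ y := by
      intro p hp
      have := hQT hp
      simp only [hT, mem_erase] at this
      exact ⟨this.1, this.2.2.1, this.2.1⟩
    have hvQ : v ∉ Q := fun hp => (hmemQ v hp).1 rfl
    have hxQ : x ∉ Q := fun hp => (hmemQ x hp).2.1 rfl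
    have hxQ' : x ∉ insert v Q := by simp [hxQ, hxv.ne]
    have hsub : insert x (insert v Q) ⊂ S := by
      refine ⟨insert_subset hx (insert_subset hv hQS.1), fun hs => ?_⟩
      have := hs hy
      simp only [mem_insert, hxy.ne', hvy.symm, false_or] at this
      exact (hmemQ y this).2.2 rfl
    have hc3 : #(insert x (insert v Q)) = #Q + 2 := by
      rw [card_insert_of_notMem hxQ', card_insert_of_notMem hvQ]
    have h7 := h.seven_le_potential hsub (by omega)
    have hcr : crossing G (insert x (insert v Q)) (insert x (insert v Q)) =
        crossing G Q Q + 2 * crossing G {v} Q + 2 * crossing G {x} Q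
          + 2 * crossing G {x} {v} := by
      have hd1 : Disjoint {x} (insert v Q) := by simpa using hxQ'
      have hd2 : Disjoint {v} Q := by simpa using hvQ
      rw [insert_eq x, crossing_union_left _ _ hd1, crossing_union_right _ _ hd1,
        crossing_union_right _ _ hd1, crossing_comm G (insert v Q) {x}, insert_eq v,
        crossing_union_left _ _ hd2, crossing_union_right _ _ hd2, crossing_union_right _ _ hd2,
        crossing_union_right _ _ hd2, crossing_self_singleton, crossing_self_singleton,
        crossing_comm G Q {v}]
      ring
    have h1 : crossing G {x} {v} = 1 := by
      simp only [crossing, sum_singleton, hxv, if_true]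
    have h2 : 1 ≤ crossing G {x} Q := by
      have := crossing_mono G (subset_refl {x}) (singleton_subset_iff.2 huQ)
      rwa [show crossing G {x} {u} = 1 by
        simp only [crossing, sum_singleton, hxu, if_true]] at this
    have h3 := crossing_mergeGraph_le G u v Q
    have h4 := two_mul_potential G (insert x (insert v Q))
    have h5 := two_mul_potential (mergeGraph G u v) Q
    rw [hc3] at h4
    push_cast at h4
    linarith

theorem card_degree_three_nbrs_le (h : IsMinimalCounterexample G S) {x : W} (hx : x ∈ S)
    (hdx : #(nbhd G S x) = 3) : 2 ≤ #((nbhd G S x).filter fun y => 4 ≤ #(nbhd G S y)) := by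
  by_cases hall : ∀ y ∈ nbhd G S x, 4 ≤ #(nbhd G S y)
  · rw [filter_true_of_mem hall]; omega
  push Not at hall
  obtain ⟨y, hy, hy4⟩ := hall
  have hyS := (mem_nbhd.1 hy).1
  have hxy := (mem_nbhd.1 hy).2
  have hdy : #(nbhd G S y) = 3 := by
    have := h.three_le_degree hyS
    omega
  obtain ⟨u, v, huv, he⟩ := card_eq_two.1
    (show #((nbhd G S x).erase y) = 2 by rw [card_erase_of_mem hy]; omega)
  have hu : u ∈ (nbhd G S x).erase y := by simp [he]
  have hv : v ∈ (nbhd G S x).erase y := by simp [he]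
  rw [mem_erase, mem_nbhd] at hu hv
  have hN : ∀ p ∈ S, G.Adj x p → p = y ∨ p = u ∨ p = v := by
    intro p hp hxp
    by_cases hpy : p = y
    · exact Or.inl hpy
    have : p ∈ (nbhd G S x).erase y := mem_erase.2 ⟨hpy, mem_nbhd.2 ⟨hp, hxp⟩⟩
    rw [he] at this
    simpa using Or.inr this
  have hadj := h.adj_of_adjacent_degree_three hx hyS hu.2.1 hv.2.1 hxy hu.2.2 hv.2.2 huv hu.1
    hv.1 hN hdy
  have h4 : ∀ u v, u ∈ S → v ∈ S → G.Adj x u → G.Adj x v → G.Adj u v →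
      4 ≤ #(nbhd G S u) := by
    intro u v hu hv hxu hxv huv
    by_contra! hlt
    have := h.three_le_degree hu
    exact h.not_triangle_of_degree_three hx hu hv hxu hxv huv hdx (by omega)
  have hsub : {u, v} ⊆ (nbhd G S x).filter fun y => 4 ≤ #(nbhd G S y) := by
    intro p hp
    rw [mem_insert, mem_singleton] at hp
    rcases hp with rfl | rfl
    · exact mem_filter.2 ⟨mem_nbhd.2 hu.2, h4 p v hu.2.1 hv.2.1 hu.2.2 hv.2.2 hadj⟩
    · exact mem_filter.2 ⟨mem_nbhd.2 hv.2, h4 p u hv.2.1 hu.2.1 hv.2.2 hu.2.2 hadj.symm⟩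
  have := card_le_card hsub
  rwa [card_pair huv] at this

theorem false (h : IsMinimalCounterexample G S) : False := by
  set A := S.filter fun x => #(nbhd G S x) = 3 with hA
  set B := S.filter fun x => ¬ #(nbhd G S x) = 3 with hB
  have hAB : #A + #B = #S := card_filter_add_card_filter_not _
  have hdisj : Disjoint A B := disjoint_filter_filter_not _ _ _
  have hun : A ∪ B = S := filter_union_filter_not_eq _ _
  have hB4 : ∀ x ∈ B, 4 ≤ #(nbhd G S x) := by
    intro x hx
    have h1 := mem_filter.1 hx
    have h2 := h.three_le_degree h1.1
    have h3 : #(nbhd G S x) ≠ 3 := h1.2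
    omega
  have hm1 : 2 * (#A : ℤ) ≤ crossing G A B := by
    rw [crossing_eq_sum_card, mul_comm, ← nsmul_eq_mul, ← sum_const]
    refine sum_le_sum fun x hx => ?_
    have h1 := mem_filter.1 hx
    have h2 := h.card_degree_three_nbrs_le h1.1 h1.2
    have h3 : (nbhd G S x).filter (fun y => 4 ≤ #(nbhd G S y)) ⊆ B.filter (G.Adj x) := by
      intro y hy
      have h4 := mem_filter.1 hy
      have h5 := mem_nbhd.1 h4.1
      have h6 := h4.2
      exact mem_filter.2 ⟨mem_filter.2 ⟨h5.1, by omega⟩, h5.2⟩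
    exact_mod_cast h2.trans (card_le_card h3)
  have hm2 : crossing G A B ≤ crossing G B S := by
    rw [crossing_comm]
    exact crossing_mono G (subset_refl _) (filter_subset _ _)
  have hm3 : 4 * (#B : ℤ) ≤ crossing G B S := by
    rw [crossing_eq_sum_card, mul_comm, ← nsmul_eq_mul, ← sum_const]
    exact sum_le_sum fun x hx => by exact_mod_cast hB4 x hx
  have hm4 : crossing G A S = 3 * (#A : ℤ) := by
    rw [crossing_eq_sum_card, mul_comm, ← nsmul_eq_mul, ← sum_const]
    exact sum_congr rfl fun x hx => by exact_mod_cast (mem_filter.1 hx).2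
  have hm5 : crossing G S S = crossing G A S + crossing G B S := by
    conv_lhs => rw [← hun]
    rw [crossing_union_left _ _ hdisj, hun]
  have h1 := two_mul_potential G S
  have h2 := h.three_le
  have h3 : (#A : ℤ) + #B = #S := by exact_mod_cast hAB
  linarith

end IsMinimalCounterexample

/-- The Kostochka–Yancey theorem for 4-critical graphs: a graph which is not 3-colourable contains
a subset of vertices spanning a graph with potential at most 2 that is not 3-colourable. -/
theorem exists_potential_le_two (G : SimpleGraph W) (S : Finset W)
    (hS : ¬ ThreeColorableOn G S) :
    ∃ Q ⊆ S, ¬ ThreeColorableOn G Q ∧ potential G Q ≤ 2 := by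
  induction hn : #S using Nat.strong_induction_on generalizing G S with
  | _ n ih =>
    subst hn
    by_cases hcrit : ∀ T ⊂ S, ThreeColorableOn G T
    · by_contra! hcon
      have h3 := hcon S (subset_refl _) hS
      exact IsMinimalCounterexample.false
        ⟨fun G T hT hcol => ih _ hT G T hcol rfl, hS, hcrit, by omega⟩
    · push Not at hcrit
      obtain ⟨T, hTS, hT⟩ := hcrit
      obtain ⟨Q, hQT, hQ⟩ := ih _ (card_lt_card hTS) G T hT rfl
      exact ⟨Q, hQT.trans hTS.1, hQ⟩

end KostochkaYancey

namespace GraphDual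

open Finset Classical

/-- The sum modulo 2 of the values of `z` on the edges incident with `v`. -/
noncomputable def parity {V : Type*} {E : Type*} [Fintype E] (ends : E → Sym2 V) (z : E → ZMod 2)
    (v : V) : ZMod 2 :=
  ∑ e, if v ∈ ends e then z e else 0

/-- `L` and `R` assign two faces to each edge of a multigraph in such a way that the even edge
sets are exactly the boundaries of sets of faces. -/
def IsDual {V : Type*} {E : Type*} {F : Type*} [Fintype E] (ends : E → Sym2 V) (L R : E → F) :
    Prop :=
  ∀ z : E → ZMod 2, (∀ v, parity ends z v = 0) ↔ ∃ s : F → ZMod 2, ∀ e, z e = s (L e) + s (R e)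

theorem parity_add {V E : Type*} [Fintype E] (ends : E → Sym2 V) (z z' : E → ZMod 2) (v : V) :
    parity ends (fun e => z e + z' e) v = parity ends z v + parity ends z' v := by
  unfold parity
  rw [← sum_add_distrib]
  exact sum_congr rfl fun e _ => by split_ifs <;> simp

/-- Deleting edges merges faces. -/
theorem IsDual.restrict {V : Type*} {E E' F : Type*} [Fintype E] [Fintype E'] [Finite F]
    {ends : E → Sym2 V} {L R : E → F} (h : IsDual ends L R) {ι : E' → E}
    (hι : Function.Injective ι) :
    ∃ r : F → F → Prop, IsDual (ends ∘ ι) (fun e => Quot.mk r (L (ι e)))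
      (fun e => Quot.mk r (R (ι e))) := by
  refine ⟨fun f g => ∃ e ∉ Set.range ι, f = L e ∧ g = R e, fun z => ?_⟩
  have hext : ∀ v, parity ends (Function.extend ι z 0) v = parity (ends ∘ ι) z v := by
    intro v
    unfold parity
    symm
    refine sum_of_injOn ι hι.injOn (fun _ _ => by simp) (fun e _ he => ?_) fun e _ => ?_
    · rw [Function.extend_apply' _ _ _ (by simpa using he)]
      simp
    · rw [hι.extend_apply]
      rfl
  simp only [← hext]
  rw [h]
  constructor
  · rintro ⟨s, hs⟩
    refine ⟨Quot.lift s ?_, fun e => ?_⟩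
    · rintro _ _ ⟨e, he, rfl, rfl⟩
      have := hs e
      rw [Function.extend_apply' _ _ _ (by simpa using he)] at this
      exact (CharTwo.add_eq_zero.1 this.symm)
    · rw [← hs, hι.extend_apply]
  · rintro ⟨s, hs⟩
    refine ⟨fun f => s (Quot.mk _ f), fun e => ?_⟩
    by_cases he : e ∈ Set.range ι
    · obtain ⟨e, rfl⟩ := he
      rw [hι.extend_apply, hs]
    · rw [Function.extend_apply' _ _ _ (by simpa using he)]
      have : s (Quot.mk _ (L e)) = s (Quot.mk _ (R e)) :=
        congrArg s (Quot.sound ⟨e, he, rfl, rfl⟩)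
      simp only [this, CharTwo.add_self_eq_zero, Pi.zero_apply]

/-- The function merging `c` into `a`. -/
noncomputable def merge {V : Type*} (a c : V) : V → V := Function.update id c a

theorem merge_of_ne {V : Type*} {a c v : V} (h : v ≠ c) : merge a c v = v := by
  simp [merge, h]

theorem merge_self {V : Type*} (a c : V) : merge a c c = a := by simp [merge]

theorem mem_map_merge_of_ne {V : Type*} {a c v : V} (hva : v ≠ a) (hvc : v ≠ c) (e : Sym2 V) :
    v ∈ e.map (merge a c) ↔ v ∈ e := by
  rw [Sym2.mem_map]
  constructor
  · rintro ⟨w, hw, rfl⟩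
    by_cases hwc : w = c
    · subst hwc
      exact absurd (merge_self a w) hva
    · rwa [merge_of_ne hwc]
  · exact fun h => ⟨v, h, merge_of_ne hvc⟩

theorem mem_map_merge_left {V : Type*} {a c : V} (hac : a ≠ c) (e : Sym2 V) :
    a ∈ e.map (merge a c) ↔ a ∈ e ∨ c ∈ e := by
  rw [Sym2.mem_map]
  constructor
  · rintro ⟨w, hw, h⟩
    by_cases hwc : w = c
    · exact Or.inr (hwc ▸ hw)
    · rw [merge_of_ne hwc] at h
      exact Or.inl (h ▸ hw)
  · rintro (h | h)
    · exact ⟨a, h, merge_of_ne hac⟩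
    · exact ⟨c, h, merge_self a c⟩

theorem right_notMem_map_merge {V : Type*} {a c : V} (hac : a ≠ c) (e : Sym2 V) :
    c ∉ e.map (merge a c) := by
  rw [Sym2.mem_map]
  rintro ⟨w, hw, h⟩
  by_cases hwc : w = c
  · rw [hwc, merge_self] at h
    exact hac h
  · rw [merge_of_ne hwc] at h
    exact hwc h

/-- Identifying two vertices at distance 2 along a face splits off a new face from it. -/
theorem IsDual.identify {V : Type*} {E F : Type*} [Fintype E]
    {ends : E → Sym2 V} {L R : E → F} (h : IsDual ends L R) {a b c : V} (hac : a ≠ c)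
    (hab : a ≠ b) (hbc : b ≠ c) (hnadj : ∀ e, ends e ≠ s(a, c)) {e₀ e₁ : E}
    (h₀ : ends e₀ = s(a, b)) (h₁ : ends e₁ = s(b, c)) {f : F}
    (hf₀ : Xor (L e₀ = f) (R e₀ = f)) (hf₁ : Xor (L e₁ = f) (R e₁ = f)) :
    ∃ L' R' : E → Option F, IsDual (fun e => (ends e).map (merge a c)) L' R' := by
  have he : e₀ ≠ e₁ := by
    rintro rfl
    rw [h₀] at h₁
    have : a ∈ s(b, c) := h₁ ▸ Sym2.mem_mk_left a b
    simp [hab, hac] at this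
  let tr : E → F → Option F := fun e g => if (e = e₀ ∨ e = e₁) ∧ g = f then none else some g
  let w : E → ZMod 2 := fun e => (if e = e₀ then 1 else 0) + if e = e₁ then 1 else 0
  have hw : ∀ v, parity ends w v = (if v = a then 1 else 0) + if v = c then 1 else 0 := by
    intro v
    have h1 : ∀ e' : E, parity ends (fun e => if e = e' then 1 else 0) v =
        if v ∈ ends e' then 1 else 0 := by
      intro e'
      unfold parity
      rw [sum_eq_single e'] <;> simp +contextual
    rw [parity_add, h1, h1, h₀, h₁]
    simp only [Sym2.mem_iff]
    by_cases h1 : v = a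
    · subst h1; simp [hab, hac]
    · by_cases h2 : v = b
      · subst h2
        simp [h1, hbc, CharTwo.add_self_eq_zero]
      · simp [h1, h2]
  have hδ : ∀ (s : Option F → ZMod 2) (e : E), s (tr e (L e)) + s (tr e (R e)) =
      (s (some (L e)) + s (some (R e))) + (s none + s (some f)) * w e := by
    intro s e
    have key : ∀ e', e' = e₀ ∨ e' = e₁ → Xor (L e' = f) (R e' = f) → w e' = 1 →
        s (tr e' (L e')) + s (tr e' (R e')) =
        (s (some (L e')) + s (some (R e'))) + (s none + s (some f)) * w e' := by
      rintro e' he' hx hw1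
      rw [hw1, mul_one]
      rcases hx with ⟨h1, h2⟩ | ⟨h1, h2⟩
      · simp only [tr, he', h1, h2, true_and, if_true, if_false]
        linear_combination -(CharTwo.add_self_eq_zero (s (some f)))
      · simp only [tr, he', h1, h2, true_and, if_true, if_false]
        linear_combination -(CharTwo.add_self_eq_zero (s (some f)))
    by_cases h1 : e = e₀
    · subst h1
      exact key e (Or.inl rfl) hf₀ (by simp [w, he])
    · by_cases h2 : e = e₁
      · subst h2
        exact key e (Or.inr rfl) hf₁ (by simp [w, h1])
      · simp [tr, w, h1, h2]
  have hpar : ∀ z : E → ZMod 2, (∀ v, parity (fun e => (ends e).map (merge a c)) z v = 0) ↔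
      ∃ t : ZMod 2, ∀ v, parity ends (fun e => z e + t * w e) v = 0 := by
    intro z
    have hne : ∀ v, v ≠ a → v ≠ c →
        parity (fun e => (ends e).map (merge a c)) z v = parity ends z v := by
      intro v hva hvc
      simp only [parity, mem_map_merge_of_ne hva hvc]
    have ha : parity (fun e => (ends e).map (merge a c)) z a =
        parity ends z a + parity ends z c := by
      simp only [parity, mem_map_merge_left hac]
      rw [← sum_add_distrib]
      refine sum_congr rfl fun e _ => ?_
      by_cases h1 : a ∈ ends e
      · by_cases h2 : c ∈ ends e
        · exact absurd ((Sym2.mem_and_mem_iff hac).1 ⟨h1, h2⟩) (hnadj e)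
        · simp [h1, h2]
      · simp [h1]
    have hc : parity (fun e => (ends e).map (merge a c)) z c = 0 := by
      simp only [parity, right_notMem_map_merge hac, if_false, sum_const_zero]
    have htw : ∀ t v, parity ends (fun e => t * w e) v = t * parity ends w v := by
      intro t v
      simp only [parity, mul_sum, mul_ite, mul_zero]
    simp only [parity_add, htw, hw]
    constructor
    · intro h
      refine ⟨parity ends z a, fun v => ?_⟩
      have haa := h a
      rw [ha] at haa
      by_cases h1 : v = a
      · subst h1
        simp [hac, CharTwo.add_self_eq_zero]
      · by_cases h2 : v = c
        · subst h2
          simp [h1]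
          rw [add_comm]; exact haa
        · rw [← hne v h1 h2, h v]
          simp [h1, h2]
    · rintro ⟨t, ht⟩ v
      by_cases h1 : v = a
      · subst h1
        have h3 := ht v
        have h4 := ht c
        simp [hac, hac.symm] at h3 h4
        rw [ha]
        linear_combination h3 + h4 - CharTwo.add_self_eq_zero t
      · by_cases h2 : v = c
        · rw [h2, hc]
        · have := ht v
          rw [hne v h1 h2]
          simpa [h1, h2] using this
  refine ⟨fun e => tr e (L e), fun e => tr e (R e), fun z => ?_⟩
  rw [hpar]
  simp only [hδ]
  constructor
  · rintro ⟨t, ht⟩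
    obtain ⟨s, hs⟩ := (h _).1 ht
    refine ⟨fun o => o.elim (t + s f) s, fun e => ?_⟩
    simp only [Option.elim]
    rw [← hs e]
    linear_combination -(t * w e + w e * s f) * (CharTwo.two_eq_zero (R := ZMod 2))
  · rintro ⟨s, hs⟩
    refine ⟨s none + s (some f), (h _).2 ⟨fun g => s (some g), fun e => ?_⟩⟩
    rw [hs e]
    linear_combination (s none + s (some f)) * w e * (CharTwo.two_eq_zero (R := ZMod 2))

/-- The combinatorial shadow of a drawing in the plane. -/
def HasDual {V : Type u} [Fintype V] (G : SimpleGraph V) : Prop :=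
  ∃ (F : Type u) (_ : Finite F) (L R : G.edgeSet → F),
    IsDual (fun e : G.edgeSet => (e : Sym2 V)) L R

theorem HasDual.mono {V : Type u} [Fintype V] {G G' : SimpleGraph V} (h : G' ≤ G)
    (hG : HasDual G) : HasDual G' := by
  obtain ⟨F, hF, L, R, hd⟩ := hG
  have hsub := SimpleGraph.edgeSet_mono h
  obtain ⟨r, hr⟩ := hd.restrict (Set.inclusion_injective hsub)
  exact ⟨Quot r, inferInstance, _, _, hr⟩

/-- The graph obtained by identifying `c` with `a`. -/
def identify {V : Type*} (G : SimpleGraph V) (a c : V) : SimpleGraph V where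
  Adj x y := x ≠ y ∧ ∃ p q, G.Adj p q ∧ merge a c p = x ∧ merge a c q = y
  symm := ⟨by
    rintro x y ⟨h, p, q, h1, h2, h3⟩
    exact ⟨h.symm, q, p, h1.symm, h3, h2⟩⟩
  loopless := ⟨fun x h => h.1 rfl⟩

theorem HasDual.identify {V : Type u} [Fintype V] {G : SimpleGraph V} {F : Type u} [Finite F]
    {L R : G.edgeSet → F} (h : IsDual (fun e : G.edgeSet => (e : Sym2 V)) L R)
    {a b c : V} (hac : a ≠ c) (hnadj : ¬ G.Adj a c) (hab : G.Adj a b) (hbc : G.Adj b c) {f : F}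
    (hf₀ : Xor (L ⟨s(a, b), hab⟩ = f) (R ⟨s(a, b), hab⟩ = f))
    (hf₁ : Xor (L ⟨s(b, c), hbc⟩ = f) (R ⟨s(b, c), hbc⟩ = f)) :
    HasDual (GraphDual.identify G a c) := by
  obtain ⟨L', R', h'⟩ := IsDual.identify h hac hab.ne hbc.ne
    (fun e he => hnadj (by have := e.2; rw [he] at this; exact this)) rfl rfl hf₀ hf₁
  have hlift : ∀ e : (GraphDual.identify G a c).edgeSet, ∃ e' : G.edgeSet,
      (e' : Sym2 V).map (merge a c) = e := by
    rintro ⟨e, he⟩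
    induction e using Sym2.ind with
    | _ x y =>
      obtain ⟨-, p, q, hpq, h1, h2⟩ := he
      exact ⟨⟨s(p, q), hpq⟩, by simp [h1, h2]⟩
  choose ι hι using hlift
  have hinj : Function.Injective ι := fun e e' hee => by
    apply Subtype.ext
    rw [← hι, ← hι, hee]
  obtain ⟨r, hr⟩ := h'.restrict hinj
  have he : (fun e : (GraphDual.identify G a c).edgeSet => (e : Sym2 V)) =
      (fun e : G.edgeSet => (e : Sym2 V).map (merge a c)) ∘ ι := funext fun e => (hι e).symm
  rw [← he] at hr
  exact ⟨Quot r, inferInstance, _, _, hr⟩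

end GraphDual

namespace GraphDual

open Finset Classical

variable {V : Type u} [Fintype V] {G : SimpleGraph V} {F : Type u} {L R : G.edgeSet → F}

theorem parity_restrict (G : SimpleGraph V) (z : Sym2 V → ZMod 2)
    (hz : ∀ e ∉ G.edgeSet, z e = 0) (v : V) :
    parity (fun e : G.edgeSet => (e : Sym2 V)) (fun e => z e) v = ∑ w, z s(v, w) := by
  have h1 : parity (fun e : G.edgeSet => (e : Sym2 V)) (fun e => z e) v =
      ∑ e : Sym2 V, if v ∈ e then z e else 0 := by
    unfold parity
    refine sum_of_injOn (fun e : G.edgeSet => (e : Sym2 V)) Subtype.val_injective.injOn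
      (fun _ _ => by simp) (fun e _ he => ?_) fun e _ => rfl
    rw [hz e (by simpa using he)]
    simp
  rw [h1, ← sum_filter]
  symm
  refine sum_bij (fun w _ => s(v, w)) (fun w _ => by simp) (fun w _ w' _ h => ?_) (fun e he => ?_)
    fun _ _ => rfl
  · exact Sym2.congr_right.1 h
  · rw [mem_filter] at he
    obtain ⟨w, rfl⟩ := he.2
    exact ⟨w, mem_univ _, rfl⟩

theorem isDual_iff : IsDual (fun e : G.edgeSet => (e : Sym2 V)) L R ↔
    ∀ z : Sym2 V → ZMod 2, (∀ e ∉ G.edgeSet, z e = 0) → ((∀ v, ∑ w, z s(v, w) = 0) ↔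
      ∃ s : F → ZMod 2, ∀ e : G.edgeSet, z e = s (L e) + s (R e)) := by
  constructor
  · intro h z hz
    rw [← h fun e => z e]
    simp only [parity_restrict G z hz]
  · intro h z
    have := h (fun e => if he : e ∈ G.edgeSet then z ⟨e, he⟩ else 0)
      (fun e he => by simp [he])
    simp only [Subtype.coe_prop, dite_true, Subtype.coe_eta] at this
    rw [← this]
    refine forall_congr' fun v => ?_
    rw [← parity_restrict G (fun e => if he : e ∈ G.edgeSet then z ⟨e, he⟩ else 0)
      (fun e he => by simp [he])]
    simp

theorem sum_sum_swap_eq_zero (X : Finset V) (z : Sym2 V → ZMod 2) (hz : ∀ v, z s(v, v) = 0) :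
    ∑ v ∈ X, ∑ w ∈ X, z s(v, w) = 0 := by
  rw [← sum_product']
  refine sum_involution (fun p _ => p.swap) (fun p _ => ?_) (fun p _ hp h => ?_) (fun p hp => ?_)
    fun p _ => Prod.swap_swap p
  · rw [Prod.fst_swap, Prod.snd_swap, Sym2.eq_swap, CharTwo.add_self_eq_zero]
  · have : p.2 = p.1 := congrArg Prod.fst h
    rw [this, hz] at hp
    exact hp rfl
  · simpa [and_comm] using hp

/-- Two disjoint connections between opposite corners of a face cannot exist. Here `s` and `t` are
the face labellings belonging to the two cycles which consist of such a connection and of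
two consecutive sides of the face. -/
theorem separation (hd : IsDual (fun e : G.edgeSet => (e : Sym2 V)) L R) {X Y : Finset V}
    (hXY : Disjoint X Y) {a b c d : V} (ha : a ∈ X) (hc : c ∈ X) (hb : b ∈ Y) (hdY : d ∈ Y)
    (hab : G.Adj a b) (hbc : G.Adj b c) (hcd : G.Adj c d) (hac : a ≠ c) (hbd : b ≠ d)
    (s t : F → ZMod 2)
    (hs : ∀ e : G.edgeSet, (∃ v ∈ (e : Sym2 V), v ∉ X) →
      s (L e) + s (R e) = if (e : Sym2 V) = s(a, b) ∨ (e : Sym2 V) = s(b, c) then 1 else 0)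
    (ht : ∀ e : G.edgeSet, (∃ v ∈ (e : Sym2 V), v ∉ Y) →
      t (L e) + t (R e) = if (e : Sym2 V) = s(b, c) ∨ (e : Sym2 V) = s(c, d) then 1 else 0)
    {f₁ g f₃ : F} (hf₁ : L ⟨s(a, b), hab⟩ = f₁ ∨ R ⟨s(a, b), hab⟩ = f₁)
    (hg : L ⟨s(b, c), hbc⟩ = g ∨ R ⟨s(b, c), hbc⟩ = g)
    (hf₃ : L ⟨s(c, d), hcd⟩ = f₃ ∨ R ⟨s(c, d), hcd⟩ = f₃)
    (htg : t f₁ = t g) (hsg : s f₃ = s g) : False := by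
  have hne : ∀ x ∈ X, ∀ y ∈ Y, x ≠ y := fun x hx y hy => disjoint_iff_ne.1 hXY x hx y hy
  have hbX : b ∉ X := fun h => hne b h b hb rfl
  have hdX : d ∉ X := fun h => hne d h d hdY rfl
  set z : Sym2 V → ZMod 2 := fun e => if he : e ∈ G.edgeSet then
    s (L ⟨e, he⟩) * t (L ⟨e, he⟩) + s (R ⟨e, he⟩) * t (R ⟨e, he⟩) else 0 with hz
  have hev : ∀ v, ∑ w, z s(v, w) = 0 := by
    refine ((isDual_iff.1 hd) z fun e he => by simp [hz, he]).2 ⟨fun f => s f * t f, fun e => ?_⟩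
    simp [hz]
  have hdiag : ∀ v, z s(v, v) = 0 := fun v => by simp [hz]
  have hcut : ∑ v ∈ X, ∑ w ∈ Xᶜ, z s(v, w) = 0 := by
    have h1 : ∑ v ∈ X, ∑ w, z s(v, w) = 0 := sum_eq_zero fun v _ => hev v
    simp_rw [← sum_add_sum_compl X] at h1
    rw [sum_add_distrib, sum_sum_swap_eq_zero X z hdiag, zero_add] at h1
    exact h1
  have key : ∀ v ∈ X, ∀ w ∈ Xᶜ, z s(v, w) = (if v = a then if w = b then t f₁ else 0 else 0) +
      ((if v = c then if w = b then s g + t g + 1 else 0 else 0) +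
      (if v = c then if w = d then s f₃ else 0 else 0)) := by
    intro v hv w hw
    have hwX : w ∉ X := by simpa using hw
    by_cases he : s(v, w) ∈ G.edgeSet
    swap
    · have h1 : ¬ (v = a ∧ w = b) := by rintro ⟨rfl, rfl⟩; exact he hab
      have h2 : ¬ (v = c ∧ w = b) := by rintro ⟨rfl, rfl⟩; exact he hbc.symm
      have h3 : ¬ (v = c ∧ w = d) := by rintro ⟨rfl, rfl⟩; exact he hcd
      simp only [hz, he, dite_false, ← ite_and, h1, h2, h3, if_false, add_zero]
    have hsv := hs ⟨s(v, w), he⟩ ⟨w, by simp, hwX⟩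
    have htv := ht ⟨s(v, w), he⟩ ⟨v, by simp, fun h => hne v hv v h rfl⟩
    have hvb : v ≠ b := hne v hv b hb
    have hvd : v ≠ d := hne v hv d hdY
    have hwa : w ≠ a := fun h => hwX (h ▸ ha)
    have hwc : w ≠ c := fun h => hwX (h ▸ hc)
    have e1 : (s(v, w) = s(a, b)) ↔ v = a ∧ w = b := by simp [hvb]
    have e2 : (s(v, w) = s(b, c)) ↔ v = c ∧ w = b := by simp [hvb]
    have e3 : (s(v, w) = s(c, d)) ↔ v = c ∧ w = d := by simp [hvd]
    simp only [e1, e2, e3] at hsv htv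
    simp only [hz, he, dite_true]
    have z2 : ∀ x y p q : ZMod 2, p + q = 0 → x * p + y * q = (x + y) * p := by decide
    have z3 : ∀ x y p q : ZMod 2, p + q = 0 → p * x + q * y = p * (x + y) := by decide
    have z4 : ∀ x y p q : ZMod 2, x + y = 1 → p + q = 1 → x * p + y * q = x + p + 1 := by decide
    have z5 : ∀ x y p q : ZMod 2, x + y = 1 → p + q = 1 → x * p + y * q = y + q + 1 := by decide
    by_cases h1 : v = a ∧ w = b
    · obtain ⟨rfl, rfl⟩ := h1
      simp only [hac, hbd, and_self, true_or, if_true, false_and, or_self, if_false]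
        at hsv htv ⊢
      rw [z2 _ _ _ _ htv, hsv, one_mul, add_zero, add_zero]
      rcases hf₁ with rfl | rfl
      · rfl
      · exact CharTwo.add_eq_zero.1 htv
    by_cases h2 : v = c ∧ w = b
    · obtain ⟨rfl, rfl⟩ := h2
      simp only [hac.symm, hbd, and_self, or_true, true_or, if_true, false_and, if_false]
        at hsv htv ⊢
      rw [zero_add, add_zero]
      have hs' : (⟨s(w, v), hbc⟩ : G.edgeSet) = ⟨s(v, w), he⟩ := Subtype.ext Sym2.eq_swap
      rw [hs'] at hg
      rcases hg with rfl | rfl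
      · exact z4 _ _ _ _ hsv htv
      · exact z5 _ _ _ _ hsv htv
    by_cases h3 : v = c ∧ w = d
    · obtain ⟨rfl, rfl⟩ := h3
      simp only [hac.symm, hbd.symm, and_self, or_true, if_true, and_false, or_self,
        if_false] at hsv htv ⊢
      rw [z3 _ _ _ _ hsv, htv, mul_one, zero_add, zero_add]
      rcases hf₃ with rfl | rfl
      · rfl
      · exact CharTwo.add_eq_zero.1 hsv
    simp only [h1, h2, h3, or_self, if_false] at hsv htv
    rw [z2 _ _ _ _ htv, hsv, zero_mul]
    simp only [← ite_and, h1, h2, h3, if_false, add_zero]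
  rw [sum_congr rfl fun v hv => sum_congr rfl fun w hw => key v hv w hw] at hcut
  simp only [sum_add_distrib, sum_ite_irrel, sum_const_zero, sum_ite_eq', ha, hc, mem_compl, hbX,
    hdX, not_false_eq_true, if_true] at hcut
  rw [htg, hsg] at hcut
  have : ∀ x y : ZMod 2, x + (y + x + 1 + y) ≠ 0 := by decide
  exact this _ _ hcut

/-- The edges of a walk, as a function modulo 2. -/
noncomputable def walkSum {a b : V} (p : G.Walk a b) (e : Sym2 V) : ZMod 2 := p.edges.count e

theorem walkSum_eq_zero {a b : V} (p : G.Walk a b) {e : Sym2 V} (he : e ∉ p.edges) :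
    walkSum p e = 0 := by
  simp [walkSum, List.count_eq_zero_of_not_mem he]

theorem walkSum_eq_zero_of_notMem {a b v : V} (p : G.Walk a b) {e : Sym2 V} (hv : v ∈ e)
    (h : v ∉ p.support) : walkSum p e = 0 :=
  walkSum_eq_zero p fun he => h (p.mem_support_of_mem_edges he hv)

theorem walkSum_eq_zero_of_notMem_edgeSet {a b : V} (p : G.Walk a b) {e : Sym2 V}
    (he : e ∉ G.edgeSet) : walkSum p e = 0 :=
  walkSum_eq_zero p fun h => he (p.edges_subset_edgeSet h)

theorem sum_edge_indicator {a b : V} (hab : a ≠ b) (v : V) :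
    ∑ w, (if s(v, w) = s(a, b) then (1 : ZMod 2) else 0) =
      (if v = a then 1 else 0) + if v = b then 1 else 0 := by
  by_cases h1 : v = a
  · subst h1
    simp [hab]
  · by_cases h2 : v = b
    · subst h2
      simp [h1]
    · simp [h1, h2]

theorem sum_walkSum {a b : V} (p : G.Walk a b) (v : V) :
    ∑ w, walkSum p s(v, w) = (if v = a then 1 else 0) + if v = b then 1 else 0 := by
  induction p with
  | nil => simp [walkSum, CharTwo.add_self_eq_zero]
  | cons h p ih =>
    rename_i x y z
    have : ∀ e, walkSum (SimpleGraph.Walk.cons h p) e =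
        walkSum p e + if e = s(x, y) then 1 else 0 := by
      intro e
      simp only [walkSum, SimpleGraph.Walk.edges_cons, List.count_cons]
      push_cast
      by_cases he : e = s(x, y)
      · simp [he]
      · simp [he, Ne.symm he]
    simp only [this, sum_add_distrib, ih, sum_edge_indicator h.ne]
    linear_combination CharTwo.add_self_eq_zero (if v = y then (1 : ZMod 2) else 0)

theorem exists_labelling (hd : IsDual (fun e : G.edgeSet => (e : Sym2 V)) L R) {a b c : V}
    (p : G.Walk a c) (hab : G.Adj a b) (hbc : G.Adj b c) (hac : a ≠ c) :
    ∃ s : F → ZMod 2, ∀ e : G.edgeSet, s (L e) + s (R e) = walkSum p e +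
      if (e : Sym2 V) = s(a, b) ∨ (e : Sym2 V) = s(b, c) then 1 else 0 := by
  have hne : s(a, b) ≠ s(b, c) := by simp [hab.ne, hac]
  have hite : ∀ e : Sym2 V, (if e = s(a, b) ∨ e = s(b, c) then (1 : ZMod 2) else 0) =
      (if e = s(a, b) then 1 else 0) + if e = s(b, c) then 1 else 0 := by
    intro e
    by_cases h1 : e = s(a, b)
    · subst h1
      simp only [hne, if_true, true_or, if_false, add_zero]
    · simp only [h1, false_or, if_false, zero_add]
  obtain ⟨s, hs⟩ := (isDual_iff.1 hd (fun e => walkSum p e +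
      if e = s(a, b) ∨ e = s(b, c) then 1 else 0) (fun e he => by
        have h1 : ¬ (e = s(a, b) ∨ e = s(b, c)) := by
          rintro (rfl | rfl)
          · exact he hab
          · exact he hbc
        simp only [walkSum_eq_zero_of_notMem_edgeSet p he, h1, if_false, add_zero])).1 (fun v => by
      simp only [hite, sum_add_distrib, sum_walkSum, sum_edge_indicator hab.ne,
        sum_edge_indicator hbc.ne]
      generalize (if v = a then (1 : ZMod 2) else 0) = x
      generalize (if v = b then (1 : ZMod 2) else 0) = y
      generalize (if v = c then (1 : ZMod 2) else 0) = z
      revert x y z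
      decide)
  exact ⟨s, fun e => (hs e).symm⟩

/-- Two walks that join opposite corners of a quadrilateral with two consecutive sides on
the face `g` and another side on `f₁` must meet, provided that `f₁` and `g` lie on
the same side of the cycle given by the second walk. -/
theorem walks_meet (hd : IsDual (fun e : G.edgeSet => (e : Sym2 V)) L R) {a b c d : V}
    (p : G.Walk a c) (q : G.Walk b d) (hpq : p.support.Disjoint q.support)
    (hab : G.Adj a b) (hbc : G.Adj b c) (hcd : G.Adj c d) (hac : a ≠ c) (hbd : b ≠ d) {f₁ g : F}
    (hf₁ : L ⟨s(a, b), hab⟩ = f₁ ∨ R ⟨s(a, b), hab⟩ = f₁)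
    (hg : L ⟨s(b, c), hbc⟩ = g ∨ R ⟨s(b, c), hbc⟩ = g)
    (hg' : L ⟨s(c, d), hcd⟩ = g ∨ R ⟨s(c, d), hcd⟩ = g)
    (hfg : ∀ t : F → ZMod 2, (∀ e : G.edgeSet, t (L e) + t (R e) = walkSum q e +
      if (e : Sym2 V) = s(b, c) ∨ (e : Sym2 V) = s(c, d) then 1 else 0) → t f₁ = t g) :
    False := by
  obtain ⟨s, hs⟩ := exists_labelling hd p hab hbc hac
  obtain ⟨t, ht⟩ := exists_labelling hd q hbc hcd hbd
  refine separation hd (X := p.support.toFinset) (Y := q.support.toFinset) ?_ (by simp) (by simp)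
    (by simp) (by simp) hab hbc hcd hac hbd s t (fun e he => ?_) (fun e he => ?_) hf₁ hg hg'
    (hfg t ht) rfl
  · rw [disjoint_left]
    intro v hv hv'
    exact hpq (List.mem_toFinset.1 hv) (List.mem_toFinset.1 hv')
  · obtain ⟨v, hv, hvX⟩ := he
    rw [hs, walkSum_eq_zero_of_notMem p hv (by simpa using hvX), zero_add]
  · obtain ⟨v, hv, hvX⟩ := he
    rw [ht, walkSum_eq_zero_of_notMem q hv (by simpa using hvX), zero_add]

end GraphDual

namespace GraphDual

open Finset Classical

variable {V : Type u} [Fintype V] {G : SimpleGraph V} {F : Type u} {L R : G.edgeSet → F}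

/-- The edges on the boundary of a face. -/
noncomputable def boundary (L R : G.edgeSet → F) (f : F) : Finset (Sym2 V) :=
  univ.filter fun e => ∃ h : e ∈ G.edgeSet, Xor (L ⟨e, h⟩ = f) (R ⟨e, h⟩ = f)

theorem mem_boundary {f : F} {e : Sym2 V} :
    e ∈ boundary L R f ↔ ∃ h : e ∈ G.edgeSet, Xor (L ⟨e, h⟩ = f) (R ⟨e, h⟩ = f) := by
  simp [boundary]

theorem boundary_even (hd : IsDual (fun e : G.edgeSet => (e : Sym2 V)) L R) (f : F) (v : V) :
    ∑ w, (if s(v, w) ∈ boundary L R f then (1 : ZMod 2) else 0) = 0 := by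
  refine ((isDual_iff.1 hd) (fun e => if e ∈ boundary L R f then 1 else 0) (fun e he => ?_)).2
    ⟨fun g => if g = f then 1 else 0, fun e => ?_⟩ v
  · exact if_neg fun h => he (mem_boundary.1 h).1
  · simp only [mem_boundary, Subtype.coe_prop, Subtype.coe_eta, exists_const, Xor]
    by_cases h1 : L e = f <;> by_cases h2 : R e = f <;>
      simp [h1, h2, CharTwo.add_self_eq_zero]

theorem exists_ne_mem_boundary (hd : IsDual (fun e : G.edgeSet => (e : Sym2 V)) L R) {f : F}
    {v w : V} (h : s(v, w) ∈ boundary L R f) : ∃ x, x ≠ w ∧ s(v, x) ∈ boundary L R f := by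
  by_contra! hcon
  have := boundary_even hd f v
  rw [sum_eq_single w (fun x _ hx => if_neg (hcon x hx)) (by simp), if_pos h] at this
  exact one_ne_zero this

theorem adj_of_mem_boundary {f : F} {v w : V} (h : s(v, w) ∈ boundary L R f) : G.Adj v w :=
  (mem_boundary.1 h).1

theorem boundary_quadrilateral (hd : IsDual (fun e : G.edgeSet => (e : Sym2 V)) L R)
    (htf : ∀ x y z, G.Adj x y → G.Adj y z → ¬ G.Adj x z) {f : F}
    (hne : (boundary L R f).Nonempty) : 4 ≤ #(boundary L R f) ∧ (#(boundary L R f) = 4 →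
      ∃ a b c d, G.Adj a b ∧ G.Adj b c ∧ G.Adj c d ∧ G.Adj d a ∧ a ≠ c ∧ b ≠ d ∧
        boundary L R f = {s(a, b), s(b, c), s(c, d), s(d, a)}) := by
  obtain ⟨e, he⟩ := hne
  induction e using Sym2.ind with
  | _ a b =>
  obtain ⟨c, hca, hbc⟩ := exists_ne_mem_boundary hd (show s(b, a) ∈ boundary L R f by
    rwa [Sym2.eq_swap])
  obtain ⟨d, hdb, had⟩ := exists_ne_mem_boundary hd he
  obtain ⟨x, hxb, hcx⟩ := exists_ne_mem_boundary hd (show s(c, b) ∈ boundary L R f by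
    rwa [Sym2.eq_swap])
  have Aab := adj_of_mem_boundary he
  have Abc := adj_of_mem_boundary hbc
  have Aad := adj_of_mem_boundary had
  have Acx := adj_of_mem_boundary hcx
  have hcd : c ≠ d := by rintro rfl; exact htf _ _ _ Aab Abc Aad
  have hxa : x ≠ a := by rintro rfl; exact htf _ _ _ Aab Abc Acx.symm
  have hcard : #({s(a, b), s(b, c), s(c, x), s(d, a)} : Finset (Sym2 V)) = 4 := by
    rw [card_insert_of_notMem, card_insert_of_notMem, card_pair]
    · simp [hca, hcd]
    · simp [Abc.ne, Ne.symm hxb, Aab.ne', Ne.symm hdb]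
    · simp [Aab.ne, Ne.symm hca, Ne.symm hxa, Ne.symm hdb, Aad.ne]
  have hsub : ({s(a, b), s(b, c), s(c, x), s(d, a)} : Finset (Sym2 V)) ⊆ boundary L R f := by
    intro e he'
    simp only [mem_insert, mem_singleton] at he'
    rcases he' with rfl | rfl | rfl | rfl
    · exact he
    · exact hbc
    · exact hcx
    · rwa [Sym2.eq_swap]
  refine ⟨hcard ▸ card_le_card hsub, fun h4 => ?_⟩
  have heq := eq_of_subset_of_card_le hsub (by omega)
  obtain ⟨y, hya, hdy⟩ := exists_ne_mem_boundary hd (show s(d, a) ∈ boundary L R f by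
    rwa [Sym2.eq_swap])
  have hxd : x = d := by
    rw [← heq] at hdy
    simp only [mem_insert, mem_singleton, Sym2.eq_iff] at hdy
    have hda := Aad.ne'
    grind
  subst hxd
  exact ⟨a, b, c, x, Aab, Abc, Acx, Aad.symm, hca.symm, hxb.symm, heq.symm⟩

theorem sum_card_boundary_le [Fintype F] (L R : G.edgeSet → F) (A : Finset F) :
    ∑ f ∈ A, #(boundary L R f) ≤ 2 * #G.edgeFinset := by
  have h1 : ∀ f, #(boundary L R f) =
      ∑ e ∈ G.edgeFinset, if e ∈ boundary L R f then 1 else 0 := by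
    intro f
    rw [sum_boole, Nat.cast_id]
    congr 1
    ext e
    simp only [mem_filter, SimpleGraph.mem_edgeFinset, iff_and_self]
    exact fun h => (mem_boundary.1 h).1
  simp only [h1]
  rw [sum_comm, mul_comm, ← smul_eq_mul, ← sum_const]
  refine sum_le_sum fun e he => ?_
  rw [sum_boole, Nat.cast_id]
  have he' : e ∈ G.edgeSet := SimpleGraph.mem_edgeFinset.1 he
  refine (card_le_card (t := {L ⟨e, he'⟩, R ⟨e, he'⟩}) fun f hf => ?_).trans card_le_two
  obtain ⟨_, h | h⟩ := mem_boundary.1 (mem_filter.1 hf).2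
  · simp [h.1]
  · simp [h.1]

/-- A consequence of the Euler formula. -/
theorem card_edges_le (hd : IsDual (fun e : G.edgeSet => (e : Sym2 V)) L R) [Fintype F]
    {S : Finset V} (hS : S.Nonempty) (hGS : ∀ x y, G.Adj x y → x ∈ S) :
    #G.edgeFinset + 1 ≤ #S ∨
      #G.edgeFinset + 2 ≤ #(univ.filter fun f => (boundary L R f).Nonempty) + #S := by
  let E := G.edgeSet
  have hcE : Fintype.card E = #G.edgeFinset := by rw [SimpleGraph.edgeFinset_card]
  let bd : (E → ZMod 2) →ₗ[ZMod 2] (S → ZMod 2) :=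
    { toFun := fun z v => parity (fun e : E => (e : Sym2 V)) z v
      map_add' := fun z z' => by
        ext v
        exact parity_add (fun e : E => (e : Sym2 V)) z z' v
      map_smul' := fun t z => by
        ext v
        simp only [parity, Pi.smul_apply, smul_eq_mul, RingHom.id_apply, mul_sum, mul_ite,
          mul_zero] }
  let tot : (S → ZMod 2) →ₗ[ZMod 2] ZMod 2 := ∑ v, LinearMap.proj v
  have htot : ∀ z, tot z = ∑ v, z v := fun z => by simp [tot]
  have hbd0 : ∀ z, bd z ∈ LinearMap.ker tot := by
    intro z
    rw [LinearMap.mem_ker, htot]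
    change ∑ v : S, ∑ e : E, (if (v : V) ∈ (e : Sym2 V) then z e else 0) = 0
    rw [sum_comm]
    refine sum_eq_zero fun e _ => ?_
    obtain ⟨e, he⟩ := e
    induction e using Sym2.ind with
    | _ x y =>
    have hxy : G.Adj x y := he
    have hx := hGS x y hxy
    have hy := hGS y x hxy.symm
    rw [← sum_filter, sum_const]
    have : (univ.filter fun v : S => (v : V) ∈ s(x, y)) = {⟨x, hx⟩, ⟨y, hy⟩} := by
      ext v
      simp [Subtype.ext_iff]
    change #(univ.filter fun v : S => (v : V) ∈ s(x, y)) • _ = _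
    rw [this, card_pair (by simpa using hxy.ne), two_nsmul, CharTwo.add_self_eq_zero]
  have hker1 : Module.finrank (ZMod 2) (LinearMap.ker tot) + 1 = #S := by
    have h1 := LinearMap.finrank_range_add_finrank_ker tot
    have h2 : LinearMap.range tot = ⊤ := by
      rw [LinearMap.range_eq_top]
      intro t
      obtain ⟨x, hx⟩ := hS
      exact ⟨Pi.single ⟨x, hx⟩ t, by rw [htot]; simp⟩
    rw [h2, finrank_top, Module.finrank_self, Module.finrank_fintype_fun_eq_card] at h1
    rw [Fintype.card_coe] at h1
    omega
  have hrange : Module.finrank (ZMod 2) (LinearMap.range bd) + 1 ≤ #S := by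
    rw [← hker1]
    refine Nat.add_le_add_right (Submodule.finrank_mono ?_) 1
    rintro _ ⟨z, rfl⟩
    exact hbd0 z
  have hker := LinearMap.finrank_range_add_finrank_ker bd
  rw [Module.finrank_fintype_fun_eq_card, hcE] at hker
  let F' := univ.filter fun f => (boundary L R f).Nonempty
  have hF' : ∀ e : E, L e ≠ R e → L e ∈ F' ∧ R e ∈ F' := by
    intro e he
    have h1 : (e : Sym2 V) ∈ boundary L R (L e) := mem_boundary.2 ⟨e.2, Or.inl ⟨rfl, he.symm⟩⟩
    have h2 : (e : Sym2 V) ∈ boundary L R (R e) := mem_boundary.2 ⟨e.2, Or.inr ⟨rfl, he⟩⟩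
    exact ⟨mem_filter.2 ⟨mem_univ _, _, h1⟩, mem_filter.2 ⟨mem_univ _, _, h2⟩⟩
  let ext0 : (F' → ZMod 2) → F → ZMod 2 := fun s f => if h : f ∈ F' then s ⟨f, h⟩ else 0
  let δ : (F' → ZMod 2) →ₗ[ZMod 2] (E → ZMod 2) :=
    { toFun := fun s e => ext0 s (L e) + ext0 s (R e)
      map_add' := fun s s' => by
        ext e
        simp only [ext0, Pi.add_apply]
        split_ifs <;> ring
      map_smul' := fun t s => by
        ext e
        simp only [ext0, Pi.smul_apply, smul_eq_mul, RingHom.id_apply]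
        split_ifs <;> ring }
  have hsub : LinearMap.ker bd ≤ LinearMap.range δ := by
    intro z hz
    rw [LinearMap.mem_ker] at hz
    have hall : ∀ v, parity (fun e : E => (e : Sym2 V)) z v = 0 := by
      intro v
      by_cases hv : v ∈ S
      · exact congrFun hz ⟨v, hv⟩
      · refine sum_eq_zero fun e _ => if_neg ?_
        rintro ⟨w, hw⟩
        have : G.Adj v w := by have := e.2; rw [show (e : Sym2 V) = s(↑v, w) from hw] at this; exact this
        exact hv (hGS _ _ this)
    obtain ⟨s, hs⟩ := (hd z).1 hall
    refine ⟨fun f => s f, ?_⟩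
    ext e
    change ext0 (fun f => s f) (L e) + ext0 (fun f => s f) (R e) = z e
    rw [hs e]
    by_cases he : L e = R e
    · rw [he, CharTwo.add_self_eq_zero, CharTwo.add_self_eq_zero]
    · simp [ext0, hF' e he]
  have hle := Submodule.finrank_mono hsub
  have hδ := LinearMap.finrank_range_add_finrank_ker δ
  rw [Module.finrank_fintype_fun_eq_card, Fintype.card_coe] at hδ
  by_cases hF0 : F' = ∅
  · left
    have hF0' : #F' = 0 := by rw [hF0, card_empty]
    omega
  · right
    have hpos : 0 < Module.finrank (ZMod 2) (LinearMap.ker δ) := by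
      have hone : (fun _ => 1 : F' → ZMod 2) ∈ LinearMap.ker δ := by
        rw [LinearMap.mem_ker]
        ext e
        change ext0 (fun _ => 1) (L e) + ext0 (fun _ => 1) (R e) = 0
        by_cases he : L e = R e
        · rw [he, CharTwo.add_self_eq_zero]
        · simp [ext0, hF' e he, CharTwo.add_self_eq_zero]
      obtain ⟨f, hf⟩ := nonempty_iff_ne_empty.2 hF0
      have : Nontrivial (LinearMap.ker δ) := by
        refine ⟨⟨⟨_, hone⟩, 0, fun h => ?_⟩⟩
        have := congrFun (congrArg Subtype.val h) ⟨f, hf⟩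
        exact one_ne_zero this
      exact Module.finrank_pos
    change _ ≤ #F' + _
    omega

theorem euler_bound (hd : IsDual (fun e : G.edgeSet => (e : Sym2 V)) L R) [Fintype F]
    (htf : ∀ x y z, G.Adj x y → G.Adj y z → ¬ G.Adj x z)
    {S : Finset V} (hS : S.Nonempty) (hGS : ∀ x y, G.Adj x y → x ∈ S) :
    #G.edgeFinset + 1 ≤ #S ∨ 3 * #G.edgeFinset + 10 ≤
      5 * #S + #(univ.filter fun f => #(boundary L R f) = 4) := by
  refine (card_edges_le hd hS hGS).imp_right fun h => ?_
  set A := univ.filter fun f => (boundary L R f).Nonempty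
  set B := univ.filter fun f => #(boundary L R f) = 4
  have hBA : B ⊆ A := by
    intro f hf
    have := (mem_filter.1 hf).2
    exact mem_filter.2 ⟨mem_univ _, card_pos.1 (by omega)⟩
  have h1 := sum_card_boundary_le L R A
  have h2 : 5 * #A ≤ ∑ f ∈ A, #(boundary L R f) + #B := by
    have : #B = ∑ f ∈ A, if f ∈ B then 1 else 0 := by
      rw [sum_boole, Nat.cast_id, filter_mem_eq_inter, inter_eq_right.2 hBA]
    rw [this, ← sum_add_distrib, mul_comm, ← smul_eq_mul, ← sum_const]
    refine sum_le_sum fun f hf => ?_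
    have h4 := (boundary_quadrilateral hd htf (mem_filter.1 hf).2).1
    split_ifs with hB
    · omega
    · have : #(boundary L R f) ≠ 4 := fun h => hB (mem_filter.2 ⟨mem_univ _, h⟩)
      omega
  omega

end GraphDual

namespace GraphDual

open Finset Classical

variable {V : Type u} [Fintype V] {G : SimpleGraph V} {F : Type u} {L R : G.edgeSet → F}

/-- The boundary of the face `f` is the 4-cycle `a b c d`. -/
structure IsQuad (L R : G.edgeSet → F) (f : F) (a b c d : V) : Prop where
  ab : G.Adj a b
  bc : G.Adj b c
  cd : G.Adj c d
  da : G.Adj d a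
  ac : a ≠ c
  bd : b ≠ d
  boundary_eq : boundary L R f = {s(a, b), s(b, c), s(c, d), s(d, a)}

namespace IsQuad

variable {f f' : F} {a b c d : V}

theorem reflect (h : IsQuad L R f a b c d) : IsQuad L R f a d c b where
  ab := h.da.symm
  bc := h.cd.symm
  cd := h.bc.symm
  da := h.ab.symm
  ac := h.ac
  bd := h.bd.symm
  boundary_eq := by
    rw [h.boundary_eq]
    ext e
    simp only [mem_insert, mem_singleton, Sym2.eq_swap (a := a) (b := d),
      Sym2.eq_swap (a := d) (b := c), Sym2.eq_swap (a := c) (b := b),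
      Sym2.eq_swap (a := b) (b := a)]
    tauto

theorem rotate (h : IsQuad L R f a b c d) : IsQuad L R f b c d a where
  ab := h.bc
  bc := h.cd
  cd := h.da
  da := h.ab
  ac := h.bd
  bd := h.ac.symm
  boundary_eq := by
    rw [h.boundary_eq]
    ext e
    simp only [mem_insert, mem_singleton]
    tauto

theorem side (h : IsQuad L R f a b c d) (hadj : G.Adj a b) :
    Xor (L ⟨s(a, b), hadj⟩ = f) (R ⟨s(a, b), hadj⟩ = f) := by
  have : s(a, b) ∈ boundary L R f := by simp [h.boundary_eq]
  exact (mem_boundary.1 this).2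

theorem side' (h : IsQuad L R f a b c d) (hadj : G.Adj a b) :
    L ⟨s(a, b), hadj⟩ = f ∨ R ⟨s(a, b), hadj⟩ = f := (h.side hadj).or

theorem walks_meet (h : IsQuad L R f a b c d)
    (hd : IsDual (fun e : G.edgeSet => (e : Sym2 V)) L R) (p : G.Walk a c) (q : G.Walk b d)
    (hpq : p.support.Disjoint q.support) : False :=
  GraphDual.walks_meet hd p q hpq h.ab h.bc h.cd h.ac h.bd (h.side' h.ab) (h.rotate.side' h.bc)
    (h.rotate.rotate.side' h.cd) fun _ _ => rfl

theorem not_both_paths (h : IsQuad L R f a b c d)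
    (hd : IsDual (fun e : G.edgeSet => (e : Sym2 V)) L R)
    (htf : ∀ x y z, G.Adj x y → G.Adj y z → ¬ G.Adj x z) {x y x' y' : V} (hax : G.Adj a x)
    (hxy : G.Adj x y) (hyc : G.Adj y c) (hbx : G.Adj b x') (hxy' : G.Adj x' y')
    (hyd : G.Adj y' d) : False := by
  refine h.walks_meet hd (.cons hax (.cons hxy (.cons hyc .nil)))
    (.cons hbx (.cons hxy' (.cons hyd .nil))) fun z hz hz' => ?_
  simp only [SimpleGraph.Walk.support_cons, SimpleGraph.Walk.support_nil, List.mem_cons,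
    List.not_mem_nil, or_false] at hz hz'
  obtain ⟨hab, hbc, hcd, hda, hac, hbd, -⟩ := h
  have hs := @SimpleGraph.adj_comm V G
  have hl := @SimpleGraph.irrefl V G
  grind

/-- The walk `b x y d` bars all walks between the other two corners of a face. -/
theorem mem_path_of_walk (h : IsQuad L R f a b c d)
    (hd : IsDual (fun e : G.edgeSet => (e : Sym2 V)) L R) {x y : V}
    (hbx : G.Adj b x) (hxy : G.Adj x y) (hyd : G.Adj y d) (p : G.Walk a c) :
    ∃ z ∈ p.support, z = b ∨ z = x ∨ z = y ∨ z = d := by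
  by_contra! hcon
  refine h.walks_meet hd p (.cons hbx (.cons hxy (.cons hyd .nil))) fun z hz hz' => ?_
  simp only [SimpleGraph.Walk.support_cons, SimpleGraph.Walk.support_nil, List.mem_cons,
    List.not_mem_nil, or_false] at hz'
  have := hcon z hz
  tauto

/-- A quadrilateral face `u b c d` obstructing the identification of `u` and `c`,
where `c` is adjacent to `v`. -/
structure _root_.GraphDual.IsObstruction (L R : G.edgeSet → F) (f : F) (u v b c d x y : V) :
    Prop where
  quad : IsQuad L R f u b c d
  vc : G.Adj v c
  bx : G.Adj b x
  xy : G.Adj x y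
  yd : G.Adj y d

theorem _root_.GraphDual.IsObstruction.reflect {u v b c d x y : V}
    (h : IsObstruction L R f u v b c d x y) : IsObstruction L R f u v d c b y x where
  quad := h.quad.reflect
  vc := h.vc
  bx := h.yd.symm
  xy := h.xy.symm
  yd := h.bx.symm

variable {u v x y b' c' d' x' y' : V}

theorem _root_.GraphDual.IsObstruction.opposite_mem_path
    (hd : IsDual (fun e : G.edgeSet => (e : Sym2 V)) L R)
    (htf : ∀ x y z, G.Adj x y → G.Adj y z → ¬ G.Adj x z) (huv : ¬ G.Adj u v)
    (h : IsObstruction L R f u v b c d x y) (h' : IsObstruction L R f' u v b' c' d' x' y')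
    (h1 : b' ≠ b) (h2 : b' ≠ d) : c' ≠ c ∧ (c' = x ∨ c' = y) := by
  have hs := @SimpleGraph.adj_comm V G
  have hl := @SimpleGraph.irrefl V G
  have hq := @mem_path_of_walk _ _ _ _ _ _ _ _ _ _ _ h.quad hd x y h.bx h.xy h.yd
  obtain ⟨⟨hab, hbc, hcd, hda, hac, hbd, -⟩, hvc, hbx, hxy, hyd⟩ := h
  obtain ⟨⟨hab', hbc', hcd', hda', hac', hbd', -⟩, hvc', hbx', hxy', hyd'⟩ := h'
  by_cases hcc : c' = c
  · subst hcc
    obtain ⟨z, hz, hz'⟩ := hq (.cons hab' (.cons hbc' .nil))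
    simp only [SimpleGraph.Walk.support_cons, SimpleGraph.Walk.support_nil, List.mem_cons,
      List.not_mem_nil, or_false] at hz
    grind
  · refine ⟨hcc, ?_⟩
    obtain ⟨z, hz, hz'⟩ := hq (.cons hab' (.cons hbc' (.cons hvc'.symm (.cons hvc .nil))))
    simp only [SimpleGraph.Walk.support_cons, SimpleGraph.Walk.support_nil, List.mem_cons,
      List.not_mem_nil, or_false] at hz
    grind

theorem _root_.GraphDual.IsObstruction.false_of_common
    (hd : IsDual (fun e : G.edgeSet => (e : Sym2 V)) L R)
    (htf : ∀ x y z, G.Adj x y → G.Adj y z → ¬ G.Adj x z) (huv : ¬ G.Adj u v) (hff : f ≠ f')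
    (h : IsObstruction L R f u v b c d x y) (h' : IsObstruction L R f' u v b c' d x' y') :
    False := by
  have hs := @SimpleGraph.adj_comm V G
  have hl := @SimpleGraph.irrefl V G
  have hub := h.quad.ab
  have hsides : ∀ t : F → ZMod 2, t (L ⟨s(u, b), hub⟩) + t (R ⟨s(u, b), hub⟩) = t f + t f' := by
    intro t
    rcases h.quad.side hub with ⟨h1, h2⟩ | ⟨h1, h2⟩ <;>
    rcases h'.quad.side hub with ⟨h3, h4⟩ | ⟨h3, h4⟩
    · exact absurd (h1.symm.trans h3) hff
    · rw [h1, h3]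
    · rw [h1, h3, add_comm]
    · exact absurd (h1.symm.trans h3) hff
  let q : G.Walk b d := .cons h.bx (.cons h.xy (.cons h.yd .nil))
  have hq : ∀ z, z ∈ q.support ↔ z = b ∨ z = x ∨ z = y ∨ z = d := by
    intro z
    simp only [q, SimpleGraph.Walk.support_cons, SimpleGraph.Walk.support_nil, List.mem_cons,
      List.not_mem_nil, or_false]
  have huq : u ∉ q.support := by
    rw [hq]
    obtain ⟨⟨hab, hbc, hcd, hda, hac, hbd, -⟩, hvc, hbx, hxy, hyd⟩ := h
    grind
  have hw : walkSum q s(u, b) = 0 := walkSum_eq_zero_of_notMem q (Sym2.mem_mk_left u b) huq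
  by_cases hcc : c' = c
  · subst hcc
    obtain ⟨t, ht⟩ := exists_labelling hd q h.quad.bc h.quad.cd h.quad.bd
    have h1 := ht ⟨s(u, b), hub⟩
    have h2 := ht ⟨s(b, c'), h.quad.bc⟩
    have hcq : c' ∉ q.support := by
      rw [hq]
      obtain ⟨⟨hab, hbc, hcd, hda, hac, hbd, -⟩, hvc, hbx, hxy, hyd⟩ := h
      grind
    have hne1 : s(u, b) ≠ s(b, c') := by simp [hub.ne, h.quad.ac]
    have hne2 : s(u, b) ≠ s(c', d) := by simp [h.quad.ac, h.quad.da.ne']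
    rw [hsides, hw] at h1
    rw [walkSum_eq_zero_of_notMem q (Sym2.mem_mk_right b c') hcq] at h2
    simp only [hne1, hne2, or_self, if_false, add_zero, true_or, if_true, zero_add] at h1 h2
    have h3 : t (L ⟨s(b, c'), h.quad.bc⟩) + t (R ⟨s(b, c'), h.quad.bc⟩) = t f + t f' := by
      rcases h.quad.rotate.side h.quad.bc with ⟨h1, h2⟩ | ⟨h1, h2⟩ <;>
      rcases h'.quad.rotate.side h.quad.bc with ⟨h3, h4⟩ | ⟨h3, h4⟩
      · exact absurd (h1.symm.trans h3) hff
      · rw [h1, h3]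
      · rw [h1, h3, add_comm]
      · exact absurd (h1.symm.trans h3) hff
    rw [h3, h1] at h2
    exact zero_ne_one h2
  · refine GraphDual.walks_meet hd (.cons h.vc.symm (.cons h'.vc .nil)) q ?_ h.quad.bc.symm
      h'.quad.bc h'.quad.cd (Ne.symm hcc) h.quad.bd (f₁ := f) (g := f')
      (h.quad.reflect.rotate.rotate.side' h.quad.bc.symm)
      (h'.quad.rotate.side' _) (h'.quad.rotate.rotate.side' _) fun t ht => ?_
    · intro z hz hz'
      rw [hq] at hz'
      simp only [SimpleGraph.Walk.support_cons, SimpleGraph.Walk.support_nil, List.mem_cons,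
        List.not_mem_nil, or_false] at hz
      obtain ⟨⟨hab, hbc, hcd, hda, hac, hbd, -⟩, hvc, hbx, hxy, hyd⟩ := h
      obtain ⟨⟨hab', hbc', hcd', hda', hac', hbd', -⟩, hvc', hbx', hxy', hyd'⟩ := h'
      grind
    · have h1 := ht ⟨s(u, b), hub⟩
      have hne1 : s(u, b) ≠ s(b, c') := by simp [hub.ne, h'.quad.ac]
      have hne2 : s(u, b) ≠ s(c', d) := by simp [h'.quad.ac, h.quad.da.ne']
      rw [hsides, hw] at h1
      simp only [hne1, hne2, or_self, if_false, add_zero] at h1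
      exact CharTwo.add_eq_zero.1 h1

theorem _root_.GraphDual.IsObstruction.unique
    (hd : IsDual (fun e : G.edgeSet => (e : Sym2 V)) L R)
    (htf : ∀ x y z, G.Adj x y → G.Adj y z → ¬ G.Adj x z) (huv : ¬ G.Adj u v) (hff : f ≠ f')
    (h : IsObstruction L R f u v b c d x y) (h' : IsObstruction L R f' u v b' c' d' x' y') :
    False := by
  by_cases hbb : (b' = b ∨ b' = d) ∧ (d' = b ∨ d' = d)
  · have := h'.quad.bd
    rcases hbb with ⟨rfl | rfl, rfl | rfl⟩
    · exact this rfl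
    · exact h.false_of_common hd htf huv hff h'
    · exact h.false_of_common hd htf huv hff h'.reflect
    · exact this rfl
  have hcx : c' ≠ c ∧ (c' = x ∨ c' = y) := by
    by_cases h1 : b' = b ∨ b' = d
    · have h2 : ¬ (d' = b ∨ d' = d) := fun h2 => hbb ⟨h1, h2⟩
      push Not at h2
      exact h.opposite_mem_path hd htf huv h'.reflect h2.1 h2.2
    · push Not at h1
      exact h.opposite_mem_path hd htf huv h' h1.1 h1.2
  have hcx' : c = x' ∨ c = y' := by
    by_cases h1 : b = b' ∨ b = d'
    · have h2 : ¬ (d = b' ∨ d = d') := by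
        have := h.quad.bd
        have := h'.quad.bd
        grind
      push Not at h2
      exact (h'.opposite_mem_path hd htf huv h.reflect h2.1 h2.2).2
    · push Not at h1
      exact (h'.opposite_mem_path hd htf huv h h1.1 h1.2).2
  have main : ∀ {b d x y b' d' x' y'}, IsObstruction L R f u v b c d x y →
      IsObstruction L R f' u v b' c' d' x' y' →
      ¬ ((b' = b ∨ b' = d) ∧ (d' = b ∨ d' = d)) → c' = x → c = x' → False := by
    intro b d x y b' d' x' y' h h' hbb hcx hcx'
    have hs := @SimpleGraph.adj_comm V G
    have hl := @SimpleGraph.irrefl V G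
    have hq := @mem_path_of_walk _ _ _ _ _ _ _ _ _ _ _ h.quad hd x y h.bx h.xy h.yd
    obtain ⟨⟨hab, hbc, hcd, hda, hac, hbd, -⟩, hvc, hbx, hxy, hyd⟩ := h
    obtain ⟨⟨hab', hbc', hcd', hda', hac', hbd', -⟩, hvc', hbx', hxy', hyd'⟩ := h'
    have hbeq : b' = b := by
      obtain ⟨z, hz, hz'⟩ := hq (.cons hab' (.cons (hcx' ▸ hbx') .nil))
      simp only [SimpleGraph.Walk.support_cons, SimpleGraph.Walk.support_nil, List.mem_cons,
        List.not_mem_nil, or_false] at hz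
      grind
    obtain ⟨z, hz, hz'⟩ := hq (.cons hda'.symm (.cons hyd'.symm
      (.cons (hcx' ▸ hxy'.symm) .nil)))
    simp only [SimpleGraph.Walk.support_cons, SimpleGraph.Walk.support_nil, List.mem_cons,
      List.not_mem_nil, or_false] at hz
    grind
  rcases hcx.2 with h1 | h1 <;> rcases hcx' with h2 | h2
  · exact main h h' hbb h1 h2
  · exact main h h'.reflect (by tauto) h1 h2
  · exact main h.reflect h' (by tauto) h1 h2
  · exact main h.reflect h'.reflect (by tauto) h1 h2

end IsQuad

end GraphDual

namespace GraphDual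

open Finset Classical KostochkaYancey

variable {V : Type u} [Fintype V] {G : SimpleGraph V}

/-- `φ` is a proper 3-colouring of `G`. -/
def IsColoring (G : SimpleGraph V) (φ : V → Fin 3) : Prop := ∀ x y, G.Adj x y → φ x ≠ φ y

/-- No three vertices of `G` are pairwise adjacent. -/
def TriangleFree (G : SimpleGraph V) : Prop := ∀ x y z, G.Adj x y → G.Adj y z → ¬ G.Adj x z

/-- Any two non-adjacent vertices of `G` can be given equal colours and distinct colours. -/
def IsFlexible (G : SimpleGraph V) : Prop := ∀ u v, u ≠ v → ¬ G.Adj u v →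
  (∃ φ, IsColoring G φ ∧ φ u ≠ φ v) ∧ ∃ φ, IsColoring G φ ∧ φ u = φ v

/-- All graphs with fewer edges than `G` to which the main theorem applies are flexible. -/
def SmallerFlexible (G : SimpleGraph V) : Prop := ∀ H : SimpleGraph V,
  #H.edgeFinset < #G.edgeFinset → HasDual H → TriangleFree H → IsFlexible H

theorem TriangleFree.mono {G G' : SimpleGraph V} (h : G' ≤ G) (hG : TriangleFree G) :
    TriangleFree G' := fun x y z h1 h2 h3 => hG x y z (h h1) (h h2) (h h3)

theorem card_edgeFinset_lt {G G' : SimpleGraph V} (h : G' ≤ G) {x y : V} (hxy : G.Adj x y)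
    (hxy' : ¬ G'.Adj x y) : #G'.edgeFinset < #G.edgeFinset := by
  refine card_lt_card (SimpleGraph.edgeFinset_ssubset_edgeFinset.2 (lt_of_le_of_ne h ?_))
  rintro rfl
  exact hxy' hxy

theorem SmallerFlexible.exists_coloring (hG : SmallerFlexible G) {H : SimpleGraph V}
    (hlt : #H.edgeFinset < #G.edgeFinset) (hH : HasDual H) (htf : TriangleFree H) :
    ∃ φ, IsColoring H φ := by
  by_cases he : ∃ x y, H.Adj x y
  · obtain ⟨x, y, hxy⟩ := he
    have hle : H.deleteEdges {s(x, y)} ≤ H := SimpleGraph.deleteEdges_le _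
    have hn : ¬ (H.deleteEdges {s(x, y)}).Adj x y := by simp
    obtain ⟨φ, hφ, hne⟩ := (hG _ ((card_edgeFinset_lt hle hxy hn).trans hlt) (hH.mono hle)
      (htf.mono hle) x y hxy.ne hn).1
    refine ⟨φ, fun p q hpq => ?_⟩
    by_cases h : s(p, q) = s(x, y)
    · rcases Sym2.eq_iff.1 h with ⟨rfl, rfl⟩ | ⟨rfl, rfl⟩
      · exact hne
      · exact hne.symm
    · exact hφ p q (by simpa [hpq] using h)
  · push Not at he
    exact ⟨fun _ => 0, fun x y h => absurd h (he x y)⟩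

theorem card_edgeFinset_identify_le (G : SimpleGraph V) (a c : V) :
    #(identify G a c).edgeFinset ≤ #G.edgeFinset := by
  refine (card_le_card (fun e he => ?_)).trans
    (card_image_le (s := G.edgeFinset) (f := Sym2.map (merge a c)))
  induction e using Sym2.ind with
  | _ x y =>
    rw [SimpleGraph.mem_edgeFinset] at he
    obtain ⟨-, p, q, hpq, rfl, rfl⟩ := he
    exact mem_image.2 ⟨s(p, q), by simpa using hpq, rfl⟩

theorem card_edgeFinset_identify_lt {a b c : V} (hac : a ≠ c) (hab : G.Adj a b)
    (hbc : G.Adj b c) : #(identify G a c).edgeFinset < #G.edgeFinset := by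
  have hsub : (identify G a c).edgeFinset ⊆
      (G.edgeFinset.erase s(b, c)).image (Sym2.map (merge a c)) := fun e he => by
    induction e using Sym2.ind with
    | _ x y =>
      rw [SimpleGraph.mem_edgeFinset] at he
      obtain ⟨-, p, q, hpq, rfl, rfl⟩ := he
      rw [mem_image]
      by_cases h : s(p, q) = s(b, c)
      · refine ⟨s(a, b), ?_, ?_⟩
        · simp [hab, hac, hab.ne]
        · rw [← Sym2.map_mk, h]
          simp [merge_self, merge_of_ne hbc.ne, merge_of_ne hac, Sym2.eq_swap]
      · exact ⟨s(p, q), by simp [hpq, h], rfl⟩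
  have h1 := (card_le_card hsub).trans card_image_le
  have h2 : s(b, c) ∈ G.edgeFinset := by simpa using hbc
  have h3 := card_erase_lt_of_mem h2
  omega

theorem adj_of_identify {a c x y : V} (h : (identify G a c).Adj x y) :
    G.Adj x y ∨ (x = a ∧ G.Adj c y) ∨ (y = a ∧ G.Adj x c) := by
  obtain ⟨hne, p, q, hpq, rfl, rfl⟩ := h
  by_cases hp : p = c <;> by_cases hq : q = c
  · exact absurd (hp.trans hq.symm) hpq.ne
  · subst hp
    rw [merge_self, merge_of_ne hq]
    exact Or.inr (Or.inl ⟨rfl, hpq⟩)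
  · subst hq
    rw [merge_self, merge_of_ne hp]
    exact Or.inr (Or.inr ⟨rfl, hpq⟩)
  · rw [merge_of_ne hq, merge_of_ne hp]
    exact Or.inl hpq

theorem triangleFree_identify (htf : TriangleFree G) {a c : V}
    (hpath : ∀ x y, G.Adj a x → G.Adj x y → ¬ G.Adj y c) : TriangleFree (identify G a c) := by
  intro x y z h1 h2 h3
  have h1' := adj_of_identify h1
  have h2' := adj_of_identify h2
  have h3' := adj_of_identify h3
  have h4 := h1.ne
  have h5 := h2.ne
  have h6 := h3.ne
  have hs := @SimpleGraph.adj_comm V G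
  have htf' : ∀ x y z, G.Adj x y → G.Adj y z → ¬ G.Adj x z := htf
  grind

theorem IsColoring.comp_merge {a c : V} (hac : a ≠ c) (hnadj : ¬ G.Adj a c) {φ : V → Fin 3}
    (hφ : IsColoring (identify G a c) φ) : IsColoring G (φ ∘ merge a c) := by
  intro x y hxy
  refine hφ _ _ ⟨fun h => ?_, x, y, hxy, rfl, rfl⟩
  by_cases hx : x = c <;> by_cases hy : y = c
  · exact hxy.ne (hx.trans hy.symm)
  · subst hx
    rw [merge_self, merge_of_ne hy] at h
    exact hnadj (h ▸ hxy.symm)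
  · subst hy
    rw [merge_self, merge_of_ne hx] at h
    exact hnadj (h ▸ hxy)
  · rw [merge_of_ne hx, merge_of_ne hy] at h
    exact hxy.ne h

section Faces

variable {F : Type u} {L R : G.edgeSet → F} {f : F} {a b c d : V}

theorem IsQuad.exists_ne [Finite F] (h : IsQuad L R f a b c d) (hG : SmallerFlexible G)
    (hd : IsDual (fun e : G.edgeSet => (e : Sym2 V)) L R) (htf : TriangleFree G)
    (hpath : ∀ x y, G.Adj a x → G.Adj x y → ¬ G.Adj y c) {u v : V}
    (huv : merge a c u ≠ merge a c v) : ∃ φ, IsColoring G φ ∧ φ u ≠ φ v := by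
  have hnadj : ¬ G.Adj a c := htf a b c h.ab h.bc
  have hlt := card_edgeFinset_identify_lt h.ac h.ab h.bc
  have hdual : HasDual (identify G a c) :=
    HasDual.identify hd h.ac hnadj h.ab h.bc (h.side _) (h.rotate.side _)
  have htf' := triangleFree_identify htf hpath
  by_cases hadj : (identify G a c).Adj (merge a c u) (merge a c v)
  · obtain ⟨φ, hφ⟩ := hG.exists_coloring hlt hdual htf'
    exact ⟨_, hφ.comp_merge h.ac hnadj, hφ _ _ hadj⟩
  · obtain ⟨φ, hφ, hne⟩ := (hG _ hlt hdual htf' _ _ huv hadj).1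
    exact ⟨_, hφ.comp_merge h.ac hnadj, hne⟩

theorem IsQuad.exists_eq [Finite F] (h : IsQuad L R f a b c d) (hG : SmallerFlexible G)
    (hd : IsDual (fun e : G.edgeSet => (e : Sym2 V)) L R) (htf : TriangleFree G)
    (hpath : ∀ x y, G.Adj a x → G.Adj x y → ¬ G.Adj y c) {u v : V}
    (huv : ¬ (identify G a c).Adj (merge a c u) (merge a c v)) :
    ∃ φ, IsColoring G φ ∧ φ u = φ v := by
  have hnadj : ¬ G.Adj a c := htf a b c h.ab h.bc
  have hlt := card_edgeFinset_identify_lt h.ac h.ab h.bc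
  have hdual : HasDual (identify G a c) :=
    HasDual.identify hd h.ac hnadj h.ab h.bc (h.side _) (h.rotate.side _)
  have htf' := triangleFree_identify htf hpath
  by_cases hne : merge a c u = merge a c v
  · obtain ⟨φ, hφ⟩ := hG.exists_coloring hlt hdual htf'
    exact ⟨_, hφ.comp_merge h.ac hnadj, congrArg φ hne⟩
  · obtain ⟨φ, hφ, hne⟩ := (hG _ hlt hdual htf' _ _ hne huv).2
    exact ⟨_, hφ.comp_merge h.ac hnadj, hne⟩

theorem merge_eq_merge {u v : V} (huv : u ≠ v) (h : merge a c u = merge a c v) :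
    (u = a ∧ v = c) ∨ (u = c ∧ v = a) := by
  by_cases hu : u = c <;> by_cases hv : v = c
  · exact absurd (hu.trans hv.symm) huv
  · rw [hu, merge_self, merge_of_ne hv] at h
    exact Or.inr ⟨hu, h.symm⟩
  · rw [hv, merge_self, merge_of_ne hu] at h
    exact Or.inl ⟨h, hv⟩
  · rw [merge_of_ne hu, merge_of_ne hv] at h
    exact absurd h huv

theorem adj_of_identify_merge {u v : V} (huv : u ≠ v) (hadj : ¬ G.Adj u v)
    (h : (identify G a c).Adj (merge a c u) (merge a c v)) :
    (u = a ∧ G.Adj v c) ∨ (u = c ∧ G.Adj v a) ∨ (v = a ∧ G.Adj u c) ∨ (v = c ∧ G.Adj u a) := by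
  obtain ⟨hne, p, q, hpq, hp, hq⟩ := h
  have hs := @SimpleGraph.adj_comm V G
  by_cases hpu : p = u <;> by_cases hqv : q = v
  · exact absurd (hpu ▸ hqv ▸ hpq) hadj
  · have := merge_eq_merge hqv hq
    grind
  · have := merge_eq_merge hpu hp
    grind
  · have h1 := merge_eq_merge hqv hq
    have h2 := merge_eq_merge hpu hp
    have h3 := hpq.ne
    grind

end Faces

theorem crossing_univ (G : SimpleGraph V) :
    crossing G univ univ = 2 * (#G.edgeFinset : ℤ) := by
  rw [crossing_eq_sum_card]
  have := G.sum_degrees_eq_twice_card_edges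
  rw [← Nat.cast_ofNat, ← Nat.cast_mul, ← this, Nat.cast_sum]
  refine sum_congr rfl fun v _ => ?_
  rw [← SimpleGraph.card_neighborFinset_eq_degree, SimpleGraph.neighborFinset_eq_filter]

theorem two_le_card_of_not_threeColorableOn {H : SimpleGraph V} {Q : Finset V}
    (h : ¬ ThreeColorableOn H Q) : 2 ≤ #Q := by
  by_contra! hlt
  refine h ⟨fun _ => 0, fun x hx y hy hxy => ?_⟩
  exact absurd (card_le_one.1 (by omega) x hx y hy) hxy.ne

/-- The graph `G` without the edges not contained in `Q`. -/
def inside (G : SimpleGraph V) (Q : Finset V) : SimpleGraph V where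
  Adj x y := G.Adj x y ∧ x ∈ Q ∧ y ∈ Q
  symm := ⟨fun _ _ h => ⟨h.1.symm, h.2.2, h.2.1⟩⟩
  loopless := ⟨fun _ h => h.1.ne rfl⟩

theorem inside_le (G : SimpleGraph V) (Q : Finset V) : inside G Q ≤ G := fun _ _ h => h.1

theorem exists_five_quads_or {F : Type u} [Fintype F] {L R : G.edgeSet → F}
    (hd : IsDual (fun e : G.edgeSet => (e : Sym2 V)) L R) (htf : TriangleFree G)
    (hG : SmallerFlexible G) {u v : V} (huv : u ≠ v) (hadj : ¬ G.Adj u v) :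
    5 ≤ #(univ.filter fun f => #(boundary L R f) = 4) ∨ ∃ φ, IsColoring G φ ∧ φ u ≠ φ v := by
  by_cases hcol : ThreeColorableOn (G ⊔ SimpleGraph.edge u v) univ
  · obtain ⟨φ, hφ⟩ := hcol
    refine Or.inr ⟨φ, fun x y hxy => hφ x (mem_univ _) y (mem_univ _) (Or.inl hxy),
      hφ u (mem_univ _) v (mem_univ _) (Or.inr ?_)⟩
    simp [SimpleGraph.edge_adj, huv]
  obtain ⟨Q, -, hQ, hpot⟩ := exists_potential_le_two _ _ hcol
  have hE : ∀ x y, G.Adj x y → x ∈ Q ∧ y ∈ Q := by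
    intro x y hxy
    by_contra hxQ
    have hle := inside_le G Q
    obtain ⟨φ, hφ, hne⟩ := (hG _ (card_edgeFinset_lt hle hxy fun h => hxQ h.2)
      (HasDual.mono hle ⟨F, inferInstance, L, R, hd⟩) (htf.mono hle) u v huv
      fun h => hadj (hle h)).1
    refine hQ ⟨φ, fun x hx y hy hxy => ?_⟩
    rcases hxy with hxy | hxy
    · exact hφ x y ⟨hxy, hx, hy⟩
    · rw [SimpleGraph.edge_adj] at hxy
      rcases hxy.1 with ⟨rfl, rfl⟩ | ⟨rfl, rfl⟩
      · exact hne
      · exact hne.symm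
  have hQ2 := two_le_card_of_not_threeColorableOn hQ
  have h1 := two_mul_potential (G ⊔ SimpleGraph.edge u v) Q
  have h2 := IsMinimalCounterexample.crossing_sup_edge_le G u v Q
  have h3 := crossing_mono G (subset_univ Q) (subset_univ Q)
  rw [crossing_univ] at h3
  left
  rcases euler_bound hd htf (card_pos.1 (by omega : 0 < #Q)) fun x y h => (hE x y h).1 with
    h4 | h4 <;> omega

theorem exists_three_quads_or {F : Type u} [Fintype F] {L R : G.edgeSet → F}
    (hd : IsDual (fun e : G.edgeSet => (e : Sym2 V)) L R) (htf : TriangleFree G)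
    (hG : SmallerFlexible G) {u v : V} (huv : u ≠ v) (hadj : ¬ G.Adj u v) :
    3 ≤ #(univ.filter fun f => #(boundary L R f) = 4) ∨ ∃ φ, IsColoring G φ ∧ φ u = φ v := by
  by_cases hcol : ThreeColorableOn (identify G u v) (univ.erase v)
  · obtain ⟨φ, hφ⟩ := hcol
    have hmem : ∀ x, merge u v x ∈ univ.erase v := fun x => by
      rw [mem_erase]
      refine ⟨fun h => ?_, mem_univ _⟩
      by_cases hx : x = v
      · exact huv (by rwa [hx, merge_self] at h)
      · exact hx (by rwa [merge_of_ne hx] at h)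
    refine Or.inr ⟨φ ∘ merge u v, fun x y hxy => hφ _ (hmem x) _ (hmem y)
      ⟨fun h => ?_, x, y, hxy, rfl, rfl⟩, ?_⟩
    · rcases merge_eq_merge hxy.ne h with ⟨rfl, rfl⟩ | ⟨rfl, rfl⟩
      · exact hadj hxy
      · exact hadj hxy.symm
    · simp [merge_self, merge_of_ne huv]
  obtain ⟨Q, hQv, hQ, hpot⟩ := exists_potential_le_two _ _ hcol
  have hvQ : v ∉ Q := fun h => by simpa using hQv h
  have hE : ∀ x y, G.Adj x y → x ∈ insert v Q ∧ y ∈ insert v Q := by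
    intro x y hxy
    by_contra hxQ
    have hle := inside_le G (insert v Q)
    obtain ⟨φ, hφ, heq⟩ := (hG _ (card_edgeFinset_lt hle hxy fun h => hxQ h.2)
      (HasDual.mono hle ⟨F, inferInstance, L, R, hd⟩) (htf.mono hle) u v huv
      fun h => hadj (hle h)).2
    have hm : ∀ p, merge u v p ∈ Q → p ∈ insert v Q ∧ φ (merge u v p) = φ p := by
      intro p hp
      by_cases hpv : p = v
      · subst hpv
        simp [merge_self, heq]
      · rw [merge_of_ne hpv] at hp ⊢
        exact ⟨mem_insert_of_mem hp, rfl⟩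
    refine hQ ⟨φ, fun x hx y hy hxy => ?_⟩
    obtain ⟨-, p, q, hpq, rfl, rfl⟩ := hxy
    rw [(hm p hx).2, (hm q hy).2]
    exact hφ p q ⟨hpq, (hm p hx).1, (hm q hy).1⟩
  have hQ2 := two_le_card_of_not_threeColorableOn hQ
  have h1 := two_mul_potential (identify G u v) Q
  have h3 := crossing_mono (identify G u v) (subset_univ Q) (subset_univ Q)
  rw [crossing_univ] at h3
  have h5 := card_edgeFinset_identify_le G u v
  have h6 := card_insert_of_notMem hvQ
  left
  rcases euler_bound hd htf (insert_nonempty v Q) fun x y h => (hE x y h).1 with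
    h4 | h4 <;> omega

theorem exists_isQuad {F : Type u} {L R : G.edgeSet → F}
    (hd : IsDual (fun e : G.edgeSet => (e : Sym2 V)) L R) (htf : TriangleFree G) {f : F}
    (hf : #(boundary L R f) = 4) : ∃ a b c d, IsQuad L R f a b c d := by
  obtain ⟨a, b, c, d, h1, h2, h3, h4, h5, h6, h7⟩ :=
    (boundary_quadrilateral hd htf (card_pos.1 (by omega : 0 < #(boundary L R f)))).2 hf
  exact ⟨a, b, c, d, h1, h2, h3, h4, h5, h6, h7⟩

theorem exists_coloring_ne {F : Type u} [Fintype F] {L R : G.edgeSet → F}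
    (hd : IsDual (fun e : G.edgeSet => (e : Sym2 V)) L R) (htf : TriangleFree G)
    (hG : SmallerFlexible G) {u v : V} (huv : u ≠ v) (hadj : ¬ G.Adj u v) :
    ∃ φ, IsColoring G φ ∧ φ u ≠ φ v := by
  refine (exists_five_quads_or hd htf hG huv hadj).elim (fun h5 => ?_) id
  by_contra hno
  have key : ∀ f, #(boundary L R f) = 4 → ∃ b d x y, IsQuad L R f u b v d ∧ G.Adj b x ∧
      G.Adj x y ∧ G.Adj y d := by
    intro f hf
    have bad : ∀ {a b c d}, IsQuad L R f a b c d → (u = a ∧ v = c ∨ u = c ∧ v = a) ∨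
        ∃ x y, G.Adj a x ∧ G.Adj x y ∧ G.Adj y c := by
      intro a b c d h
      by_contra! hcon
      refine hno (h.exists_ne hG hd htf hcon.2 (u := u) (v := v) fun h => ?_)
      have := merge_eq_merge huv h
      tauto
    have main : ∀ {a b c d}, IsQuad L R f a b c d → (u = a ∧ v = c ∨ u = c ∧ v = a) →
        ∃ b d x y, IsQuad L R f u b v d ∧ G.Adj b x ∧ G.Adj x y ∧ G.Adj y d := by
      intro a b c d h h1
      have h2 : ∃ x y, G.Adj b x ∧ G.Adj x y ∧ G.Adj y d := by
        refine (bad h.rotate).resolve_left fun h2 => ?_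
        have := h.ab.ne
        have := h.bc.ne
        grind
      obtain ⟨x, y, hbx, hxy, hyd⟩ := h2
      rcases h1 with ⟨rfl, rfl⟩ | ⟨rfl, rfl⟩
      · exact ⟨b, d, x, y, h, hbx, hxy, hyd⟩
      · exact ⟨d, b, y, x, h.rotate.rotate, hyd.symm, hxy.symm, hbx.symm⟩
    obtain ⟨a, b, c, d, h⟩ := exists_isQuad hd htf hf
    rcases bad h with h1 | ⟨x, y, hax, hxy, hyc⟩
    · exact main h h1
    rcases bad h.rotate with h1 | ⟨x', y', hbx, hxy', hyd⟩
    · exact main h.rotate h1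
    exact (h.not_both_paths hd htf hax hxy hyc hbx hxy' hyd).elim
  set B := univ.filter fun f => #(boundary L R f) = 4
  obtain ⟨f₀, hf₀⟩ := card_pos.1 (by omega : 0 < #B)
  obtain ⟨b, d, x, y, h, hbx, hxy, hyd⟩ := key f₀ (mem_filter.1 hf₀).2
  have hsub : B ⊆ {L ⟨s(u, b), h.ab⟩, R ⟨s(u, b), h.ab⟩} := by
    intro f hf
    obtain ⟨b', d', x', y', h', hbx', hxy', hyd'⟩ := key f (mem_filter.1 hf).2
    have hs := @SimpleGraph.adj_comm V G
    have hl := @SimpleGraph.irrefl V G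
    have hux : u ≠ x ∧ u ≠ y ∧ v ≠ x ∧ v ≠ y := by
      have h1 := htf u b d h.ab
      obtain ⟨hab, hbc, hcd, hda, hac, hbd, -⟩ := h
      refine ⟨?_, ?_, ?_, ?_⟩ <;> rintro rfl
      · exact htf _ _ _ hxy hyd hda.symm
      · exact htf _ _ _ hbx hxy hab.symm
      · exact htf _ _ _ hxy hyd hcd
      · exact htf _ _ _ hbx hxy hbc
    have hmem : ∀ p, G.Adj u p → G.Adj p v → p = b ∨ p = d := by
      intro p hup hpv
      obtain ⟨z, hz, hz'⟩ := h.mem_path_of_walk hd hbx hxy hyd (.cons hup (.cons hpv .nil))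
      simp only [SimpleGraph.Walk.support_cons, SimpleGraph.Walk.support_nil, List.mem_cons,
        List.not_mem_nil, or_false] at hz
      have h3 := h.ab.ne
      have h4 := h.bc.ne
      have h5 := h.cd.ne
      have h6 := h.da.ne
      have h7 := htf u p v hup hpv
      have h8 := htf b x y
      have h9 := htf x y d
      have h10 := htf u b x h.ab
      have h11 := htf v d y h.cd
      have h12 := htf v b x h.bc.symm
      have h13 := htf u d y h.da.symm
      grind
    have h1 := hmem b' h'.ab h'.bc
    have h2 := hmem d' h'.da.symm h'.cd.symm
    have h3 := h'.bd
    have hbd : s(u, b) ∈ boundary L R f := by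
      rw [h'.boundary_eq]
      rcases h1 with rfl | rfl
      · simp
      · rcases h2 with rfl | rfl
        · simp [Sym2.eq_swap]
        · exact absurd rfl h3
    obtain ⟨_, hx⟩ := mem_boundary.1 hbd
    rcases hx.or with hx | hx <;> simp [hx]
  have h6 := card_le_card hsub
  have h7 := card_le_two (a := L ⟨s(u, b), h.ab⟩) (b := R ⟨s(u, b), h.ab⟩)
  omega

theorem exists_coloring_eq {F : Type u} [Fintype F] {L R : G.edgeSet → F}
    (hd : IsDual (fun e : G.edgeSet => (e : Sym2 V)) L R) (htf : TriangleFree G)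
    (hG : SmallerFlexible G) {u v : V} (huv : u ≠ v) (hadj : ¬ G.Adj u v) :
    ∃ φ, IsColoring G φ ∧ φ u = φ v := by
  refine (exists_three_quads_or hd htf hG huv hadj).elim (fun h5 => ?_) id
  by_contra hno
  have key : ∀ f, #(boundary L R f) = 4 → (∃ b c d x y, IsObstruction L R f u v b c d x y) ∨
      ∃ b c d x y, IsObstruction L R f v u b c d x y := by
    intro f hf
    have bad : ∀ {a b c d}, IsQuad L R f a b c d → ((u = a ∧ G.Adj v c) ∨ (u = c ∧ G.Adj v a) ∨
        (v = a ∧ G.Adj u c) ∨ (v = c ∧ G.Adj u a)) ∨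
        ∃ x y, G.Adj a x ∧ G.Adj x y ∧ G.Adj y c := by
      intro a b c d h
      by_contra! hcon
      refine hno (h.exists_eq hG hd htf hcon.2 (u := u) (v := v) fun h => ?_)
      have := adj_of_identify_merge huv hadj h
      tauto
    have main : ∀ {a b c d}, IsQuad L R f a b c d → ((u = a ∧ G.Adj v c) ∨ (u = c ∧ G.Adj v a) ∨
        (v = a ∧ G.Adj u c) ∨ (v = c ∧ G.Adj u a)) →
        (∃ b c d x y, IsObstruction L R f u v b c d x y) ∨
        ∃ b c d x y, IsObstruction L R f v u b c d x y := by
      intro a b c d h h1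
      have h2 : ∃ x y, G.Adj b x ∧ G.Adj x y ∧ G.Adj y d := by
        refine (bad h.rotate).resolve_left fun h2 => ?_
        obtain ⟨hab, hbc, hcd, hda, hac, hbd, -⟩ := h
        have hs := @SimpleGraph.adj_comm V G
        have htf' : ∀ x y z, G.Adj x y → G.Adj y z → ¬ G.Adj x z := htf
        rcases h1 with h1 | h1 | h1 | h1 <;> rcases h2 with h2 | h2 | h2 | h2 <;>
          obtain ⟨h1, h1'⟩ := h1 <;> obtain ⟨h2, h2'⟩ := h2 <;>
          subst h1 <;> subst h2 <;> grind
      obtain ⟨x, y, hbx, hxy, hyd⟩ := h2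
      rcases h1 with ⟨rfl, h1⟩ | ⟨rfl, h1⟩ | ⟨rfl, h1⟩ | ⟨rfl, h1⟩
      · exact Or.inl ⟨b, c, d, x, y, h, h1, hbx, hxy, hyd⟩
      · exact Or.inl ⟨d, a, b, y, x, h.rotate.rotate, h1, hyd.symm, hxy.symm, hbx.symm⟩
      · exact Or.inr ⟨b, c, d, x, y, h, h1, hbx, hxy, hyd⟩
      · exact Or.inr ⟨d, a, b, y, x, h.rotate.rotate, h1, hyd.symm, hxy.symm, hbx.symm⟩
    obtain ⟨a, b, c, d, h⟩ := exists_isQuad hd htf hf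
    rcases bad h with h1 | ⟨x, y, hax, hxy, hyc⟩
    · exact main h h1
    rcases bad h.rotate with h1 | ⟨x', y', hbx, hxy', hyd⟩
    · exact main h.rotate h1
    exact (h.not_both_paths hd htf hax hxy hyc hbx hxy' hyd).elim
  obtain ⟨f₁, f₂, f₃, h1, h2, h3, h12, h13, h23⟩ := two_lt_card_iff.1 h5
  simp only [mem_filter, mem_univ, true_and] at h1 h2 h3
  have huv1 : ∀ {f g}, f ≠ g → (∃ b c d x y, IsObstruction L R f u v b c d x y) →
      (∃ b c d x y, IsObstruction L R g u v b c d x y) → False := by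
    rintro f g hfg ⟨b, c, d, x, y, h⟩ ⟨b', c', d', x', y', h'⟩
    exact h.unique hd htf hadj hfg h'
  have huv2 : ∀ {f g}, f ≠ g → (∃ b c d x y, IsObstruction L R f v u b c d x y) →
      (∃ b c d x y, IsObstruction L R g v u b c d x y) → False := by
    rintro f g hfg ⟨b, c, d, x, y, h⟩ ⟨b', c', d', x', y', h'⟩
    exact h.unique hd htf (fun h => hadj h.symm) hfg h'
  rcases key _ h1 with k1 | k1 <;> rcases key _ h2 with k2 | k2 <;> rcases key _ h3 with k3 | k3
  · exact huv1 h12 k1 k2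
  · exact huv1 h12 k1 k2
  · exact huv1 h13 k1 k3
  · exact huv2 h23 k2 k3
  · exact huv1 h23 k2 k3
  · exact huv2 h13 k1 k3
  · exact huv2 h12 k1 k2
  · exact huv2 h12 k1 k2

theorem isFlexible (hG : HasDual G) (htf : TriangleFree G) : IsFlexible G := by
  induction hn : #G.edgeFinset using Nat.strong_induction_on generalizing G with
  | _ n ih =>
    subst hn
    have hsmall : SmallerFlexible G := fun H hlt hH htf' => ih _ hlt hH htf' rfl
    obtain ⟨F, hF, L, R, hd⟩ := hG
    have := Fintype.ofFinite F
    exact fun u v huv hadj => ⟨exists_coloring_ne hd htf hsmall huv hadj,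
      exists_coloring_eq hd htf hsmall huv hadj⟩

theorem HasDual.exists_coloring_extending (hG : HasDual G) (htf : TriangleFree G) {u v : V}
    (huv : u ≠ v) (hadj : ¬ G.Adj u v) (cu cv : Fin 3) :
    ∃ φ, IsColoring G φ ∧ φ u = cu ∧ φ v = cv := by
  have hperm : ∀ p q r s : Fin 3, (p = q ↔ r = s) →
      ∃ σ : Equiv.Perm (Fin 3), σ p = r ∧ σ q = s := by decide
  obtain ⟨⟨φ, hφ, h1⟩, ψ, hψ, h2⟩ := isFlexible hG htf u v huv hadj
  by_cases hc : cu = cv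
  · obtain ⟨σ, hu, hv⟩ := hperm (ψ u) (ψ v) cu cv (by tauto)
    exact ⟨σ ∘ ψ, fun x y hxy h => hψ x y hxy (σ.injective h), hu, hv⟩
  · obtain ⟨σ, hu, hv⟩ := hperm (φ u) (φ v) cu cv (by tauto)
    exact ⟨σ ∘ φ, fun x y hxy h => hφ x y hxy (σ.injective h), hu, hv⟩

end GraphDual

namespace PlaneTopology
open Set Filter Topology

/-- `f` has a continuous logarithm on `K`. -/
def HasLog (K : Set ℂ) (f : ℂ → ℂ) : Prop :=
  ∃ h : ℂ → ℂ, ContinuousOn h K ∧ ∀ z ∈ K, Complex.exp (h z) = f z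

theorem HasLog.mono {K L : Set ℂ} {f : ℂ → ℂ} (h : HasLog K f) (hL : L ⊆ K) : HasLog L f := by
  obtain ⟨g, hg, he⟩ := h
  exact ⟨g, hg.mono hL, fun z hz => he z (hL hz)⟩

theorem HasLog.congr {K : Set ℂ} {f g : ℂ → ℂ} (h : HasLog K f) (hfg : ∀ z ∈ K, f z = g z) :
    HasLog K g := by
  obtain ⟨l, hl, he⟩ := h
  exact ⟨l, hl, fun z hz => (he z hz).trans (hfg z hz)⟩

theorem HasLog.ne_zero {K : Set ℂ} {f : ℂ → ℂ} (h : HasLog K f) {z : ℂ} (hz : z ∈ K) :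
    f z ≠ 0 := by
  obtain ⟨l, -, he⟩ := h
  rw [← he z hz]; exact Complex.exp_ne_zero _

theorem HasLog.continuousOn {K : Set ℂ} {f : ℂ → ℂ} (h : HasLog K f) : ContinuousOn f K := by
  obtain ⟨l, hl, he⟩ := h
  exact (hl.cexp).congr fun z hz => (he z hz).symm

theorem HasLog.mul {K : Set ℂ} {f g : ℂ → ℂ} (hf : HasLog K f) (hg : HasLog K g) :
    HasLog K fun z => f z * g z := by
  obtain ⟨l, hl, he⟩ := hf
  obtain ⟨m, hm, he'⟩ := hg
  exact ⟨fun z => l z + m z, hl.add hm, fun z hz => by simp [Complex.exp_add, he z hz, he' z hz]⟩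

theorem HasLog.zpow {K : Set ℂ} {f : ℂ → ℂ} (hf : HasLog K f) (n : ℤ) :
    HasLog K fun z => f z ^ n := by
  obtain ⟨l, hl, he⟩ := hf
  exact ⟨fun z => n * l z, continuousOn_const.mul hl,
    fun z hz => by simp [Complex.exp_int_mul, he z hz]⟩

theorem HasLog.inv {K : Set ℂ} {f : ℂ → ℂ} (hf : HasLog K f) : HasLog K fun z => (f z)⁻¹ := by
  simpa using hf.zpow (-1)

theorem hasLog_const (K : Set ℂ) {c : ℂ} (hc : c ≠ 0) : HasLog K fun _ => c :=
  ⟨fun _ => Complex.log c, continuousOn_const, fun _ _ => Complex.exp_log hc⟩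

theorem hasLog_empty (f : ℂ → ℂ) : HasLog ∅ f := ⟨0, continuousOn_empty _, by simp⟩

theorem exists_glue {α β : Type*} [TopologicalSpace α] [TopologicalSpace β] {A B : Set α}
    (hA : IsClosed A) (hB : IsClosed B) {f g : α → β} (hf : ContinuousOn f A)
    (hg : ContinuousOn g B) (hfg : EqOn f g (A ∩ B)) :
    ∃ h : α → β, ContinuousOn h (A ∪ B) ∧ EqOn h f A ∧ EqOn h g B := by
  classical
  have h1 : EqOn (A.piecewise f g) f A := A.piecewise_eqOn f g
  have h2 : EqOn (A.piecewise f g) g B := by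
    intro x hx
    by_cases hxA : x ∈ A
    · rw [h1 hxA]; exact hfg ⟨hxA, hx⟩
    · exact piecewise_eq_of_notMem _ _ _ hxA
  exact ⟨_, ContinuousOn.union_of_isClosed (hf.congr h1) (hg.congr h2) hA hB, h1, h2⟩

theorem HasLog.exists_open {K A : Set ℂ} (hK : IsCompact K) (hA : IsClosed A)
    {f : ℂ → ℂ} (hf : ContinuousOn f K) (hlog : HasLog A f) :
    ∃ U, IsOpen U ∧ A ⊆ U ∧ HasLog (K ∩ U) f := by
  obtain ⟨h, hh, he⟩ := hlog
  obtain ⟨H, hH⟩ := ContinuousMap.exists_restrict_eq hA (⟨A.domRestrict h, hh.domRestrict⟩ : C(A, ℂ))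
  have hH' : ∀ z ∈ A, H z = h z := fun z hz => by
    have := congrArg (fun q : C(A, ℂ) => q ⟨z, hz⟩) hH
    exact this
  set g : ℂ → ℂ := fun z => f z * Complex.exp (-H z) with hg
  have hgc : ContinuousOn g K := hf.mul (H.continuous.neg.cexp).continuousOn
  have hcl : IsClosed (K ∩ (fun z => ‖g z - 1‖) ⁻¹' Ici 1) :=
    ((hgc.sub continuousOn_const).norm).preimage_isClosed_of_isClosed hK.isClosed isClosed_Ici
  refine ⟨_, hcl.isOpen_compl, ?_, fun z => H z + Complex.log (g z), ?_, ?_⟩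
  · intro z hz hz'
    have : g z = 1 := by
      simp only [hg, ← he z hz, hH' z hz, ← Complex.exp_add]; simp
    have h2 := hz'.2
    simp [this] at h2
    linarith
  · refine H.continuous.continuousOn.add ((hgc.mono inter_subset_left).clog ?_)
    rintro z ⟨hzK, hz⟩
    have hlt : ‖g z - 1‖ < 1 := by
      by_contra hcon
      exact hz ⟨hzK, not_lt.mp hcon⟩
    have := Complex.mem_slitPlane_of_norm_lt_one hlt
    simpa using this
  · rintro z ⟨hzK, hz⟩
    have hlt : ‖g z - 1‖ < 1 := by
      by_contra hcon
      exact hz ⟨hzK, not_lt.mp hcon⟩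
    have hne : g z ≠ 0 := by
      intro h0; rw [h0] at hlt; simp at hlt
    rw [Complex.exp_add, Complex.exp_log hne]
    simp only [hg, Complex.exp_neg]
    field_simp [Complex.exp_ne_zero]

theorem exists_strip {K U : Set ℂ} (hK : IsCompact K) {φ : ℂ → ℝ} (hφ : Continuous φ) (b : ℝ)
    (hU : IsOpen U) (h : K ∩ {z | φ z = b} ⊆ U) :
    ∃ d > 0, K ∩ {z | |φ z - b| ≤ d} ⊆ U := by
  have hc : IsCompact (K \ U) := hK.diff hU
  rcases (K \ U).eq_empty_or_nonempty with h0 | hne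
  · exact ⟨1, one_pos, fun z hz => by_contra fun hzU => by
      have : z ∈ K \ U := ⟨hz.1, hzU⟩
      simp [h0] at this⟩
  · obtain ⟨z0, hz0, hmin⟩ := hc.exists_isMinOn hne
      ((hφ.sub continuous_const).abs.continuousOn (s := K \ U) (f := fun z => |φ z - b|))
    have hpos : 0 < |φ z0 - b| := by
      rw [abs_pos, sub_ne_zero]
      intro hb
      exact hz0.2 (h ⟨hz0.1, hb⟩)
    refine ⟨|φ z0 - b| / 2, by positivity, fun z hz => by_contra fun hzU => ?_⟩
    have h1 : |φ z0 - b| ≤ |φ z - b| := hmin ⟨hz.1, hzU⟩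
    have h2 : |φ z - b| ≤ |φ z0 - b| / 2 := hz.2
    linarith

theorem continuous_induction {P : ℝ → Prop} {a : ℝ} (ha : P a)
    (step : ∀ b, ∃ d > 0, ∀ x y, b - d ≤ x → x ≤ y → y ≤ b + d → P x → P y) :
    ∀ x, a ≤ x → P x := by
  intro x hx
  by_contra hPx
  set S : Set ℝ := {y | a ≤ y ∧ ¬ P y} with hS
  have hne : S.Nonempty := ⟨x, hx, hPx⟩
  have hbdd : BddBelow S := ⟨a, fun y hy => hy.1⟩
  obtain ⟨d, hd, hstep⟩ := step (sInf S)
  have ha' : a ≤ sInf S := le_csInf hne fun y hy => hy.1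
  obtain ⟨y, hyS, hy⟩ := exists_lt_of_csInf_lt hne (show sInf S < sInf S + d by linarith)
  have hmy : sInf S ≤ y := csInf_le hbdd hyS
  apply hyS.2
  rcases le_total a (sInf S - d) with h | h
  · have : P (sInf S - d) := by
      by_contra hcon
      have := csInf_le hbdd (show sInf S - d ∈ S from ⟨h, hcon⟩)
      linarith
    exact hstep _ y le_rfl (by linarith) hy.le this
  · exact hstep a y h hyS.1 hy.le ha

/-- A nonvanishing function on a compact set meeting every horizontal line at most once has a
logarithm. -/
theorem hasLog_of_injOn_im {K : Set ℂ} (hK : IsCompact K) (hinj : InjOn Complex.im K)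
    {f : ℂ → ℂ} (hf : ContinuousOn f K) (h0 : ∀ z ∈ K, f z ≠ 0) : HasLog K f := by
  obtain ⟨r, hr⟩ := hK.isBounded.exists_norm_le
  have him : ∀ z ∈ K, |z.im| ≤ r := fun z hz => (Complex.abs_im_le_norm z).trans (hr z hz)
  have key := continuous_induction (P := fun x => HasLog (K ∩ {z | z.im ≤ x}) f) (a := -r - 1)
    ?_ ?_
  · refine (key (max r (-r-1)) (le_max_right _ _)).mono fun z hz => ⟨hz, ?_⟩
    exact (le_abs_self _).trans ((him z hz).trans (le_max_left _ _))
  · refine (hasLog_empty f).mono fun z hz => ?_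
    have h1 := neg_le_of_abs_le (him z hz.1)
    have h2 : z.im ≤ -r - 1 := hz.2
    linarith
  intro b
  have hAcl : IsClosed (K ∩ {z | z.im = b}) :=
    hK.isClosed.inter (isClosed_eq Complex.continuous_im continuous_const)
  have hA : HasLog (K ∩ {z | z.im = b}) f := by
    refine ⟨fun z => Complex.log (f z), ?_, fun z hz => Complex.exp_log (h0 z hz.1)⟩
    apply Set.Subsingleton.continuousOn
    intro z hz w hw
    exact hinj hz.1 hw.1 (hz.2.trans hw.2.symm)
  obtain ⟨U, hU, hAU, g, hg, hge⟩ := hA.exists_open hK hAcl hf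
  obtain ⟨d, hd, hstrip⟩ := exists_strip hK Complex.continuous_im b hU hAU
  refine ⟨d, hd, fun x y hx hxy hy hP => ?_⟩
  obtain ⟨h, hh, he⟩ := hP
  have hsub : K ∩ {z | x ≤ z.im ∧ z.im ≤ y} ⊆ K ∩ U := fun z hz => ⟨hz.1, hstrip ⟨hz.1, by
    have h1 : x ≤ z.im ∧ z.im ≤ y := hz.2
    simp only [mem_ofPred_eq, abs_le]; constructor <;> linarith [h1.1, h1.2]⟩⟩
  have hBcl : IsClosed (K ∩ {z | x ≤ z.im ∧ z.im ≤ y}) :=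
    hK.isClosed.inter ((isClosed_le continuous_const Complex.continuous_im).inter
      (isClosed_le Complex.continuous_im continuous_const))
  have hCcl : IsClosed (K ∩ {z | z.im ≤ x}) :=
    hK.isClosed.inter (isClosed_le Complex.continuous_im continuous_const)
  obtain ⟨c, hc⟩ : ∃ c : ℂ, Complex.exp c = 1 ∧ ∀ z ∈ K, z.im = x → h z = g z + c := by
    by_cases hex : ∃ z ∈ K, z.im = x
    · obtain ⟨z, hz, hzx⟩ := hex
      refine ⟨h z - g z, ?_, fun w hw hwx => ?_⟩
      · have hz2 := hsub ⟨hz, hzx.ge, hzx.le.trans hxy⟩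
        rw [Complex.exp_sub, he z ⟨hz, hzx.le⟩, hge z hz2]
        exact div_self (h0 z hz)
      · rw [hinj hw hz (hwx.trans hzx.symm)]; ring
    · exact ⟨0, by simp, fun z hz hzx => (hex ⟨z, hz, hzx⟩).elim⟩
  obtain ⟨H, hH, hH1, hH2⟩ := exists_glue hCcl hBcl hh ((hg.mono hsub).add (continuousOn_const
      (c := c))) (fun z hz => hc.2 z hz.1.1 (le_antisymm hz.1.2 hz.2.2.1))
  refine ⟨H, hH.mono ?_, ?_⟩
  · rintro z ⟨hz, hzy⟩
    rcases le_total z.im x with h1 | h1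
    · exact Or.inl ⟨hz, h1⟩
    · exact Or.inr ⟨hz, h1, hzy⟩
  · rintro z ⟨hz, hzy⟩
    rcases le_total z.im x with h1 | h1
    · rw [hH1 ⟨hz, h1⟩, he z ⟨hz, h1⟩]
    · rw [hH2 ⟨hz, h1, hzy⟩, Pi.add_apply, Complex.exp_add, hc.1, mul_one, hge z (hsub ⟨hz, h1, hzy⟩)]

end PlaneTopology

namespace PlaneTopology
open Set Filter Topology

/-- The rational function with zeros and poles prescribed by a list with multiplicities. -/
noncomputable def ratFun (l : List (ℂ × ℤ)) (z : ℂ) : ℂ := (l.map fun q => (z - q.1) ^ q.2).prod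

@[simp] theorem ratFun_nil (z : ℂ) : ratFun [] z = 1 := by simp [ratFun]

@[simp] theorem ratFun_cons (q : ℂ × ℤ) (l : List (ℂ × ℤ)) (z : ℂ) :
    ratFun (q :: l) z = (z - q.1) ^ q.2 * ratFun l z := by simp [ratFun]

theorem ratFun_append (l m : List (ℂ × ℤ)) (z : ℂ) :
    ratFun (l ++ m) z = ratFun l z * ratFun m z := by simp [ratFun]

theorem hasLog_ratFun {K : Set ℂ} {l : List (ℂ × ℤ)}
    (h : ∀ q ∈ l, HasLog K fun z => z - q.1) : HasLog K (ratFun l) := by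
  induction l with
  | nil => exact (hasLog_const K one_ne_zero).congr (by simp)
  | cons q l ih =>
    refine (((h q (by simp)).zpow q.2).mul (ih fun q hq => h q (by simp [hq]))).congr ?_
    intro z _; simp

theorem ratFun_ne_zero {l : List (ℂ × ℤ)} {z : ℂ} (h : ∀ q ∈ l, z ≠ q.1) : ratFun l z ≠ 0 := by
  induction l with
  | nil => simp
  | cons q l ih =>
    rw [ratFun_cons]
    exact mul_ne_zero (zpow_ne_zero _ (sub_ne_zero.2 (h q (by simp))))
      (ih fun q hq => h q (by simp [hq]))

theorem continuousOn_ratFun {K : Set ℂ} {l : List (ℂ × ℤ)} (h : ∀ q ∈ l, q.1 ∉ K) :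
    ContinuousOn (ratFun l) K := by
  induction l with
  | nil => exact (continuousOn_const (c := (1 : ℂ))).congr (by intro z _; simp)
  | cons q l ih =>
    have h1 : ContinuousOn (fun z : ℂ => (z - q.1) ^ q.2) K :=
      (continuousOn_id.sub continuousOn_const).zpow₀ _ fun z hz =>
        Or.inl (sub_ne_zero.2 fun he => h q (by simp) (by simpa [← he] using hz))
    exact (h1.mul (ih fun q hq => h q (by simp [hq]))).congr (by intro z _; simp)

theorem exists_intStep {C : Set ℂ} (hC : IsCompact C) (hinj : InjOn Complex.im C) {σ : ℂ → ℤ}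
    (hσ : ContinuousOn σ C) :
    ∃ (l : List (ℝ × ℤ)) (ε : ℤ), (∀ q ∈ l, q.1 ∉ Complex.im '' C) ∧
      ∀ z ∈ C, σ z = ε + (l.map fun q => if z.im < q.1 then q.2 else 0).sum := by
  obtain ⟨r, hr⟩ := hC.isBounded.exists_norm_le
  have him : ∀ z ∈ C, |z.im| ≤ r := fun z hz => (Complex.abs_im_le_norm z).trans (hr z hz)
  have key := continuous_induction (P := fun t => ∃ (l : List (ℝ × ℤ)) (ε : ℤ),
      (∀ q ∈ l, q.1 ∉ Complex.im '' C ∧ q.1 ≤ t) ∧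
      ∀ z ∈ C, z.im ≤ t → σ z = ε + (l.map fun q => if z.im < q.1 then q.2 else 0).sum)
      (a := -r - 1) ⟨[], 0, by simp, fun z hz hzt => ?_⟩ ?_
  · obtain ⟨l, ε, h1, h2⟩ := key (max r (-r-1)) (le_max_right _ _)
    exact ⟨l, ε, fun q hq => (h1 q hq).1, fun z hz => h2 z hz
      ((le_abs_self _).trans ((him z hz).trans (le_max_left _ _)))⟩
  · have h1 := neg_le_of_abs_le (him z hz)
    linarith
  intro b
  obtain ⟨τ, U, hU, hCU, hUτ⟩ : ∃ (τ : ℤ) (U : Set ℂ), IsOpen U ∧ C ∩ {z | z.im = b} ⊆ U ∧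
      ∀ z ∈ C ∩ U, σ z = τ := by
    by_cases hex : ∃ z ∈ C, z.im = b
    · obtain ⟨z0, hz0, hb⟩ := hex
      obtain ⟨U, hU, hUe⟩ := continuousOn_iff'.1 hσ {σ z0} (isOpen_discrete _)
      refine ⟨σ z0, U, hU, ?_, ?_⟩
      · rintro z ⟨hz, hzb⟩
        have : z = z0 := hinj hz hz0 (hzb.trans hb.symm)
        subst this
        have : z ∈ σ ⁻¹' {σ z} ∩ C := ⟨rfl, hz⟩
        rw [hUe] at this
        exact this.1
      · rintro z ⟨hz, hzU⟩
        have : z ∈ U ∩ C := ⟨hzU, hz⟩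
        rw [← hUe] at this
        exact this.1
    · exact ⟨0, ∅, isOpen_empty, fun z hz => (hex ⟨z, hz.1, hz.2⟩).elim, by simp⟩
  obtain ⟨d, hd, hstrip⟩ := exists_strip hC Complex.continuous_im b hU hCU
  refine ⟨d, hd, fun x y hx hxy hy hP => ?_⟩
  obtain ⟨l, ε, h1, h2⟩ := hP
  have hτ : ∀ z ∈ C, x ≤ z.im → z.im ≤ y → σ z = τ := fun z hz h3 h4 =>
    hUτ z ⟨hz, hstrip ⟨hz, by simp only [mem_ofPred_eq, abs_le]; constructor <;> linarith⟩⟩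
  have hzero : ∀ z : ℂ, x ≤ z.im → (l.map fun q => if z.im < q.1 then q.2 else 0).sum = 0 := by
    intro z hz
    apply List.sum_eq_zero
    intro n hn
    obtain ⟨q, hq, rfl⟩ := List.mem_map.1 hn
    have := (h1 q hq).2
    rw [if_neg (by linarith)]
  by_cases hxC : x ∈ Complex.im '' C
  · obtain ⟨z0, hz0, hz0x⟩ := hxC
    have hε : ε = τ := by
      have e1 := h2 z0 hz0 hz0x.le
      rw [hzero z0 hz0x.ge, hτ z0 hz0 hz0x.ge (hz0x.le.trans hxy)] at e1
      omega
    refine ⟨l, ε, fun q hq => ⟨(h1 q hq).1, (h1 q hq).2.trans hxy⟩, fun z hz hzy => ?_⟩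
    rcases le_total z.im x with h3 | h3
    · exact h2 z hz h3
    · rw [hzero z h3, hτ z hz h3 hzy, hε, add_zero]
  · refine ⟨(x, ε - τ) :: l, τ, ?_, fun z hz hzy => ?_⟩
    · intro q hq
      rcases List.mem_cons.1 hq with rfl | hq
      · exact ⟨hxC, hxy⟩
      · exact ⟨(h1 q hq).1, (h1 q hq).2.trans hxy⟩
    · rcases lt_or_ge z.im x with h3 | h3
      · rw [h2 z hz h3.le]; simp [h3]; ring
      · rw [List.map_cons, List.sum_cons, hzero z h3, hτ z hz h3 hzy]; simp [not_lt.2 h3]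

theorem exists_logs_sides (K : Set ℂ) (x : ℝ) (l : List (ℝ × ℤ))
    (hl : ∀ q ∈ l, (⟨x, q.1⟩ : ℂ) ∉ K) :
    ∃ Λ P : ℂ → ℂ, ContinuousOn Λ (K ∩ {z | z.re ≤ x}) ∧ ContinuousOn P (K ∩ {z | x ≤ z.re}) ∧
      (∀ z ∈ K ∩ {z | z.re ≤ x},
        Complex.exp (Λ z) = ratFun (l.map fun q => ((⟨x, q.1⟩ : ℂ), q.2)) z) ∧
      (∀ z ∈ K ∩ {z | x ≤ z.re},
        Complex.exp (P z) = ratFun (l.map fun q => ((⟨x, q.1⟩ : ℂ), q.2)) z) ∧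
      ∀ z ∈ K, z.re = x → Λ z - P z = 2 * Real.pi * Complex.I *
        ((l.map fun q => if z.im < q.1 then q.2 else 0).sum : ℤ) := by
  induction l with
  | nil =>
    exact ⟨0, 0, continuousOn_const, continuousOn_const, by simp, by simp, by simp⟩
  | cons q l ih =>
    obtain ⟨Λ, P, hΛ, hP, hΛe, hPe, hd⟩ := ih fun q hq => hl q (by simp [hq])
    obtain ⟨y, n⟩ := q
    have hyK : (⟨x, y⟩ : ℂ) ∉ K := hl (y, n) (by simp)
    set p : ℂ := ⟨x, y⟩ with hp
    have hne : ∀ z ∈ K, z ≠ p := fun z hz h => hyK (h ▸ hz)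
    refine ⟨fun z => n * (Complex.log (p - z) + Real.pi * Complex.I) + Λ z,
      fun z => n * Complex.log (z - p) + P z, ?_, ?_, ?_, ?_, ?_⟩
    · refine (continuousOn_const.mul (((continuousOn_const.sub continuousOn_id).clog ?_).add
        continuousOn_const)).add hΛ
      rintro z ⟨hz, hzx⟩
      rw [Complex.mem_slitPlane_iff]
      rcases lt_or_eq_of_le (show z.re ≤ x from hzx) with h | h
      · left; simp [h]
      · right
        intro h0
        apply hne z hz
        apply Complex.ext
        · simp [hp, h]
        · simp [hp] at h0 ⊢; linarith
    · refine (continuousOn_const.mul ((continuousOn_id.sub continuousOn_const).clog ?_)).add hP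
      rintro z ⟨hz, hzx⟩
      rw [Complex.mem_slitPlane_iff]
      rcases lt_or_eq_of_le (show x ≤ z.re from hzx) with h | h
      · left; simp [h]
      · right
        intro h0
        apply hne z hz
        apply Complex.ext
        · simp [hp, h]
        · simp [hp] at h0 ⊢; linarith
    · intro z hz
      rw [Complex.exp_add, Complex.exp_int_mul, Complex.exp_add, Complex.exp_log
        (sub_ne_zero.2 (hne z hz.1).symm), Complex.exp_pi_mul_I, hΛe z hz]
      simp [hp]
    · intro z hz
      rw [Complex.exp_add, Complex.exp_int_mul, Complex.exp_log
        (sub_ne_zero.2 (hne z hz.1)), hPe z hz]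
      simp [hp]
    · intro z hz hzx
      have hd' := hd z hz hzx
      have key : Complex.log (p - z) + Real.pi * Complex.I - Complex.log (z - p) =
          2 * Real.pi * Complex.I * ((if z.im < y then 1 else 0 : ℤ) : ℂ) := by
        have e1 : p - z = -(z - p) := by ring
        rw [Complex.log, Complex.log, e1, norm_neg]
        rcases lt_trichotomy z.im y with h | h | h
        · rw [Complex.arg_neg_eq_arg_add_pi_of_im_neg (by simp [hp, h]), if_pos h]
          push_cast; ring
        · exact (hne z hz (Complex.ext (by simp [hp, hzx]) (by simp [hp, h]))).elim
        · rw [Complex.arg_neg_eq_arg_sub_pi_of_im_pos (by simp [hp, h]), if_neg h.le.not_gt]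
          push_cast; ring
      rw [List.map_cons, List.sum_cons]
      have e2 : (n : ℂ) * (Complex.log (p - z) + Real.pi * Complex.I) + Λ z -
          (n * Complex.log (z - p) + P z) = n * (Complex.log (p - z) + Real.pi * Complex.I -
          Complex.log (z - p)) + (Λ z - P z) := by ring
      rw [e2, key, hd']
      split_ifs <;> push_cast <;> ring

theorem exists_int_of_exp_eq {C : Set ℂ} {g h : ℂ → ℂ} (hg : ContinuousOn g C)
    (hh : ContinuousOn h C) (he : ∀ z ∈ C, Complex.exp (g z) = Complex.exp (h z)) :
    ∃ σ : ℂ → ℤ, ContinuousOn σ C ∧ ∀ z ∈ C, g z = h z + 2 * Real.pi * Complex.I * σ z := by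
  have h1 : ∀ z, ∃ n : ℤ, z ∈ C → g z = h z + n * (2 * Real.pi * Complex.I) := by
    intro z
    by_cases hz : z ∈ C
    · obtain ⟨n, hn⟩ := Complex.exp_eq_exp_iff_exists_int.1 (he z hz)
      exact ⟨n, fun _ => hn⟩
    · exact ⟨0, fun h => (hz h).elim⟩
  choose σ hσ using h1
  refine ⟨σ, ?_, fun z hz => by rw [hσ z hz]; ring⟩
  rw [Complex.isClosedEmbedding_intCast.isInducing.continuousOn_iff]
  refine ((hg.sub hh).div_const (2 * Real.pi * Complex.I)).congr fun z hz => ?_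
  have : (2 * Real.pi * Complex.I : ℂ) ≠ 0 := Complex.two_pi_I_ne_zero
  simp only [Function.comp, Pi.sub_apply, hσ z hz]
  field_simp
  ring

theorem exists_ratFun_hasLog {K : Set ℂ} (hK : IsCompact K) {f : ℂ → ℂ} (hf : ContinuousOn f K)
    (h0 : ∀ z ∈ K, f z ≠ 0) :
    ∃ l : List (ℂ × ℤ), (∀ q ∈ l, q.1 ∉ K) ∧ HasLog K fun z => f z * ratFun l z := by
  obtain ⟨r, hr⟩ := hK.isBounded.exists_norm_le
  have hre : ∀ z ∈ K, |z.re| ≤ r := fun z hz => (Complex.abs_re_le_norm z).trans (hr z hz)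
  have key := continuous_induction (P := fun x => ∃ l : List (ℂ × ℤ),
      (∀ q ∈ l, q.1 ∉ K ∧ q.1.re ≤ x) ∧ HasLog (K ∩ {z | z.re ≤ x}) fun z => f z * ratFun l z)
      (a := -r - 1) ⟨[], by simp, (hasLog_empty _).mono fun z hz => ?_⟩ ?_
  · obtain ⟨l, h1, h2⟩ := key (max r (-r-1)) (le_max_right _ _)
    exact ⟨l, fun q hq => (h1 q hq).1, h2.mono fun z hz => ⟨hz, 
      ((le_abs_self _).trans ((hre z hz).trans (le_max_left _ _)))⟩⟩
  · have h1 := neg_le_of_abs_le (hre z hz.1)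
    have h2 : z.re ≤ -r - 1 := hz.2
    linarith
  intro b
  have hline : ∀ x : ℝ, IsCompact (K ∩ {z | z.re = x}) := fun x =>
    hK.inter_right (isClosed_eq Complex.continuous_re continuous_const)
  have hinj : ∀ x : ℝ, InjOn Complex.im (K ∩ {z | z.re = x}) := fun x z hz w hw h =>
    Complex.ext (hz.2.trans hw.2.symm) h
  obtain ⟨U, hU, hAU, g, hg, hge⟩ := (hasLog_of_injOn_im (hline b) (hinj b)
    (hf.mono inter_subset_left) fun z hz => h0 z hz.1).exists_open hK (hline b).isClosed hf
  obtain ⟨d, hd, hstrip⟩ := exists_strip hK Complex.continuous_re b hU hAU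
  refine ⟨d, hd, fun x y hx hxy hy hP => ?_⟩
  obtain ⟨l, hl, h, hh, he⟩ := hP
  have hsub : K ∩ {z | x ≤ z.re ∧ z.re ≤ y} ⊆ K ∩ U := fun z hz => ⟨hz.1, hstrip ⟨hz.1, by
    have h1 : x ≤ z.re ∧ z.re ≤ y := hz.2
    simp only [mem_ofPred_eq, abs_le]; constructor <;> linarith [h1.1, h1.2]⟩⟩
  have hBcl : IsClosed (K ∩ {z | x ≤ z.re ∧ z.re ≤ y}) :=
    hK.isClosed.inter ((isClosed_le continuous_const Complex.continuous_re).inter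
      (isClosed_le Complex.continuous_re continuous_const))
  have hCcl : IsClosed (K ∩ {z | z.re ≤ x}) :=
    hK.isClosed.inter (isClosed_le Complex.continuous_re continuous_const)
  obtain ⟨r, hrc, hre⟩ : HasLog (K ∩ {z | x ≤ z.re}) (ratFun l) := by
    refine hasLog_ratFun fun q hq => ⟨fun z => Complex.log (z - q.1),
      (continuousOn_id.sub continuousOn_const).clog ?_, fun z hz => Complex.exp_log ?_⟩
    · rintro z ⟨hz, hzx⟩
      have hzx' : x ≤ z.re := hzx
      rw [Complex.mem_slitPlane_iff]
      rcases lt_or_eq_of_le ((hl q hq).2.trans hzx') with h | h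
      · left; simp [h]
      · right
        intro h0
        apply (hl q hq).1
        have : q.1 = z := by
          apply Complex.ext h
          simp at h0; linarith
        rwa [this]
    · intro h0
      apply (hl q hq).1
      rw [← sub_eq_zero.1 h0]; exact hz.1
  have hL1 : K ∩ {z | z.re = x} ⊆ K ∩ {z | z.re ≤ x} := fun z hz => ⟨hz.1, le_of_eq hz.2⟩
  have hL2 : K ∩ {z | z.re = x} ⊆ K ∩ {z | x ≤ z.re ∧ z.re ≤ y} := fun z hz =>
    ⟨hz.1, ge_of_eq hz.2, (le_of_eq hz.2).trans hxy⟩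
  have hL3 : K ∩ {z | x ≤ z.re ∧ z.re ≤ y} ⊆ K ∩ {z | x ≤ z.re} := fun z hz => ⟨hz.1, hz.2.1⟩
  obtain ⟨σ, hσ, hσe⟩ := exists_int_of_exp_eq (hh.mono hL1)
    ((hg.mono (hL2.trans hsub)).add (hrc.mono (hL2.trans hL3))) (fun z hz => by
      rw [he z (hL1 hz), Pi.add_apply, Complex.exp_add, hge z (hsub (hL2 hz)),
        hre z (hL3 (hL2 hz))])
  obtain ⟨l0, ε, hl0, hε⟩ := exists_intStep (hline x) (hinj x) hσ
  set l1 : List (ℝ × ℤ) := l0.map fun q => (q.1, -q.2) with hl1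
  have hl1K : ∀ q ∈ l1, (⟨x, q.1⟩ : ℂ) ∉ K := by
    intro q hq hqK
    obtain ⟨q', hq', rfl⟩ := List.mem_map.1 hq
    exact hl0 q' hq' ⟨_, ⟨hqK, rfl⟩, rfl⟩
  obtain ⟨Λ, P, hΛ, hP, hΛe, hPe, hΛP⟩ := exists_logs_sides K x l1 hl1K
  have hsum : ∀ z ∈ K, z.re = x → Λ z - P z = 2 * Real.pi * Complex.I * (ε - σ z) := by
    intro z hz hzx
    rw [hΛP z hz hzx, hε z ⟨hz, hzx⟩, hl1, List.map_map]
    have : ∀ l : List (ℝ × ℤ), (l.map ((fun q : ℝ × ℤ => if z.im < q.1 then q.2 else 0) ∘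
        fun q => (q.1, -q.2))).sum = - (l.map fun q => if z.im < q.1 then q.2 else 0).sum := by
      intro l
      induction l with
      | nil => simp
      | cons q l ih => 
        simp only [List.map_cons, List.sum_cons, ih, Function.comp]
        split_ifs <;> ring
    rw [this]
    push_cast; ring
  obtain ⟨H, hH, hH1, hH2⟩ := exists_glue hCcl hBcl (hh.add hΛ)
    ((((hg.mono hsub).add (hrc.mono hL3)).add (hP.mono hL3)).add (continuousOn_const
      (c := 2 * Real.pi * Complex.I * ε))) (fun z hz => by
        have hzx : z.re = x := le_antisymm hz.1.2 hz.2.2.1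
        have e1 := hsum z hz.1.1 hzx
        have e2 := hσe z ⟨hz.1.1, hzx⟩
        simp only [Pi.add_apply] at e2 ⊢
        linear_combination e1 + e2)
  refine ⟨(l1.map fun q => ((⟨x, q.1⟩ : ℂ), q.2)) ++ l, ?_, H, hH.mono ?_, ?_⟩
  · intro q hq
    rcases List.mem_append.1 hq with hq | hq
    · obtain ⟨q', hq', rfl⟩ := List.mem_map.1 hq
      exact ⟨hl1K q' hq', hxy⟩
    · exact ⟨(hl q hq).1, (hl q hq).2.trans hxy⟩
  · rintro z ⟨hz, hzy⟩
    rcases le_total z.re x with h1 | h1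
    · exact Or.inl ⟨hz, h1⟩
    · exact Or.inr ⟨hz, h1, hzy⟩
  · rintro z ⟨hz, hzy⟩
    beta_reduce
    rw [ratFun_append]
    rcases le_total z.re x with h1 | h1
    · rw [hH1 ⟨hz, h1⟩, Pi.add_apply, Complex.exp_add, he z ⟨hz, h1⟩, hΛe z ⟨hz, h1⟩]; ring
    · rw [hH2 ⟨hz, h1, hzy⟩]
      simp only [Pi.add_apply]
      rw [Complex.exp_add, Complex.exp_add, Complex.exp_add, hge z (hsub ⟨hz, h1, hzy⟩),
        hre z ⟨hz, h1⟩, hPe z ⟨hz, h1⟩, mul_comm _ (ε : ℂ), Complex.exp_int_mul_two_pi_mul_I]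
      ring

end PlaneTopology

namespace PlaneTopology
open Set Filter Topology

/-- The number of zeros minus poles inside `U`. -/
noncomputable def index (U : Set ℂ) (l : List (ℂ × ℤ)) : ℤ :=
  open Classical in (l.map fun q => if q.1 ∈ U then q.2 else 0).sum

theorem hasLog_one_add {K : Set ℂ} {f : ℂ → ℂ} (hf : ContinuousOn f K) (h : ∀ z ∈ K, ‖f z‖ < 1) :
    HasLog K fun z => 1 + f z :=
  ⟨fun z => Complex.log (1 + f z), (continuousOn_const.add hf).clog fun z hz =>
    Complex.mem_slitPlane_of_norm_lt_one (h z hz), fun z hz => Complex.exp_log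
    (Complex.slitPlane_ne_zero (Complex.mem_slitPlane_of_norm_lt_one (h z hz)))⟩

theorem hasLog_sub_of_norm_lt {K : Set ℂ} {q : ℂ} (h : ∀ z ∈ K, ‖z‖ < ‖q‖) :
    HasLog K fun z => z - q := by
  rcases K.eq_empty_or_nonempty with rfl | ⟨w, hw⟩
  · exact hasLog_empty _
  have hq' : 0 < ‖q‖ := (norm_nonneg w).trans_lt (h w hw)
  have hq : q ≠ 0 := norm_pos_iff.1 hq'
  refine ((hasLog_const K (neg_ne_zero.2 hq)).mul (hasLog_one_add (f := fun z => -z / q)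
    (by fun_prop) ?_)).congr ?_
  · intro z hz
    rw [norm_div, norm_neg, div_lt_one hq']
    exact h z hz
  · intro z _
    field_simp; ring

theorem hasLog_sub_div_sub {K : Set ℂ} {p q : ℂ} (h : ∀ z ∈ K, ‖p - q‖ < ‖z - q‖) :
    HasLog K fun z => (z - p) / (z - q) := by
  have h0 : ∀ z ∈ K, z - q ≠ 0 := fun z hz => norm_pos_iff.1 ((norm_nonneg _).trans_lt (h z hz))
  refine (hasLog_one_add (f := fun z => (q - p) / (z - q)) ?_ ?_).congr ?_
  · exact continuousOn_const.div (by fun_prop) h0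
  · intro z hz
    rw [norm_div, norm_sub_rev, div_lt_one (norm_pos_iff.2 (h0 z hz))]
    exact h z hz
  · intro z hz
    have := h0 z hz
    field_simp; ring

theorem eq_zero_of_hasLog_zpow_sphere {r : ℝ} (hr : 0 < r) {N : ℤ}
    (h : HasLog (Metric.sphere 0 r) fun z => z ^ N) : N = 0 := by
  obtain ⟨l, hl, he⟩ := h
  have hmaps : ∀ t : ℝ, (r : ℂ) * Complex.exp (t * Complex.I) ∈ Metric.sphere (0 : ℂ) r := by
    intro t
    simp [Complex.norm_exp_ofReal_mul_I, abs_of_pos hr]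
  have hr0 : (r : ℂ) ≠ 0 := by exact_mod_cast hr.ne'
  obtain ⟨σ, hσ, hσe⟩ := exists_int_of_exp_eq (C := Complex.ofReal '' Icc 0 (2 * Real.pi))
    (g := fun z => l (r * Complex.exp (z * Complex.I)))
    (h := fun z => N * (Complex.log r + z * Complex.I))
    (hl.comp (by fun_prop) (by rintro _ ⟨t, _, rfl⟩; exact hmaps t)) (by fun_prop) (by
      rintro _ ⟨t, _, rfl⟩
      rw [he _ (hmaps t), Complex.exp_int_mul, Complex.exp_add, Complex.exp_log hr0])
  have hpre : IsPreconnected (Complex.ofReal '' Icc 0 (2 * Real.pi)) :=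
    isPreconnected_Icc.image _ Complex.continuous_ofReal.continuousOn
  have h0 : (0 : ℂ) ∈ Complex.ofReal '' Icc 0 (2 * Real.pi) :=
    ⟨0, ⟨le_rfl, by positivity⟩, by simp⟩
  have h1 : (2 * Real.pi : ℂ) ∈ Complex.ofReal '' Icc 0 (2 * Real.pi) :=
    ⟨2 * Real.pi, ⟨by positivity, le_rfl⟩, by simp⟩
  have hc : σ 0 = σ (2 * Real.pi) := hpre.constant hσ h0 h1
  have e0 := hσe _ h0
  have e1 := hσe _ h1
  rw [← hc] at e1
  simp only [Complex.exp_two_pi_mul_I, zero_mul, Complex.exp_zero] at e0 e1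
  have : (N : ℂ) * (2 * Real.pi * Complex.I) = 0 := by linear_combination e0 - e1
  simpa [Complex.two_pi_I_ne_zero] using this

theorem closure_connectedComponentIn_subset {K : Set ℂ} (hK : IsClosed K) (p : ℂ) :
    closure (connectedComponentIn Kᶜ p) ⊆ connectedComponentIn Kᶜ p ∪ K := by
  intro z hz
  by_contra hcon
  rw [mem_union, not_or] at hcon
  have hzo : IsOpen (connectedComponentIn Kᶜ z) := hK.isOpen_compl.connectedComponentIn
  have hzm : z ∈ connectedComponentIn Kᶜ z := mem_connectedComponentIn hcon.2
  obtain ⟨w, hw1, hw2⟩ := mem_closure_iff.1 hz _ hzo hzm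
  apply hcon.1
  rw [connectedComponentIn_eq hw2, ← connectedComponentIn_eq hw1]
  exact hzm

theorem ratFun_filter_mul (l : List (ℂ × ℤ)) (U : Set ℂ) [DecidablePred (· ∈ U)] (z : ℂ) :
    ratFun (l.filter (·.1 ∈ U)) z * ratFun (l.filter (·.1 ∉ U)) z = ratFun l z := by
  induction l with
  | nil => simp
  | cons q l ih =>
    by_cases h : q.1 ∈ U <;> simp [h, ← ih] <;> ring

theorem index_eq_zero_of_hasLog {K : Set ℂ} (hK : IsCompact K) {l : List (ℂ × ℤ)}
    (hlK : ∀ q ∈ l, q.1 ∉ K) (hl : HasLog K (ratFun l)) {p : ℂ}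
    (hb : Bornology.IsBounded (connectedComponentIn Kᶜ p)) :
    index (connectedComponentIn Kᶜ p) l = 0 := by
  classical
  set U := connectedComponentIn Kᶜ p with hU
  have hUo : IsOpen U := hK.isClosed.isOpen_compl.connectedComponentIn
  have hUcl : closure U ⊆ U ∪ K := closure_connectedComponentIn_subset hK.isClosed p
  obtain ⟨h, hh, he⟩ := hl
  obtain ⟨H, hH⟩ := ContinuousMap.exists_restrict_eq hK.isClosed
    (⟨K.domRestrict h, hh.domRestrict⟩ : C(K, ℂ))
  have hH' : ∀ z ∈ K, H z = h z := fun z hz => by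
    have := congrArg (fun q : C(K, ℂ) => q ⟨z, hz⟩) hH
    exact this
  set lin := l.filter (·.1 ∈ U) with hlin
  set lout := l.filter (·.1 ∉ U) with hlout
  have hlin' : ∀ q ∈ lin, q.1 ∈ U := fun q hq => by simpa using (List.mem_filter.1 hq).2
  have hlout' : ∀ q ∈ lout, q.1 ∉ closure U := fun q hq hqU => by
    rcases hUcl hqU with h | h
    · have := (List.mem_filter.1 hq).2
      simp at this; exact this h
    · exact hlK q (List.mem_filter.1 hq).1 h
  have hout0 : ∀ z ∈ closure U, ratFun lout z ≠ 0 := fun z hz =>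
    ratFun_ne_zero fun q hq h => hlout' q hq (h ▸ hz)
  have hin0 : ∀ z ∈ Uᶜ, ratFun lin z ≠ 0 := fun z hz =>
    ratFun_ne_zero fun q hq h => hz (h ▸ hlin' q hq)
  obtain ⟨F, hF, hF1, hF2⟩ := exists_glue (f := fun z => Complex.exp (H z) / ratFun lout z)
    (g := ratFun lin) isClosed_closure hUo.isClosed_compl
    (H.continuous.cexp.continuousOn.div (continuousOn_ratFun hlout') hout0)
    (continuousOn_ratFun fun q hq h => h (hlin' q hq)) (by
      rintro z ⟨hz1, hz2⟩
      have hzK : z ∈ K := (hUcl hz1).resolve_left hz2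
      beta_reduce
      rw [hH' z hzK, he z hzK, div_eq_iff (hout0 z hz1), ratFun_filter_mul])
  have huniv : ∀ z, z ∈ closure U ∪ Uᶜ := fun z => by
    by_cases hz : z ∈ U
    · exact Or.inl (subset_closure hz)
    · exact Or.inr hz
  obtain ⟨r, hr0, hr⟩ := hb.exists_pos_norm_lt
  have hF0 : ∀ z, F z ≠ 0 := fun z => by
    rcases huniv z with hz | hz
    · rw [hF1 hz]; exact div_ne_zero (Complex.exp_ne_zero _) (hout0 z hz)
    · rw [hF2 hz]; exact hin0 z hz
  obtain ⟨l', hl', hlog⟩ := exists_ratFun_hasLog (isCompact_closedBall (0 : ℂ) r)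
    (hF.mono fun z _ => huniv z) (fun z _ => hF0 z)
  have hR : HasLog (Metric.closedBall (0 : ℂ) r) (ratFun l') := by
    refine hasLog_ratFun fun q hq => hasLog_sub_of_norm_lt fun z hz => ?_
    have h1 := hl' q hq
    simp only [Metric.mem_closedBall, dist_zero_right, not_le] at h1 hz
    exact hz.trans_lt h1
  have hlogF : HasLog (Metric.sphere (0 : ℂ) r) (ratFun lin) := by
    refine ((hlog.mul hR.inv).mono Metric.sphere_subset_closedBall).congr fun z hz => ?_
    have h1 := hR.ne_zero (Metric.sphere_subset_closedBall hz)
    have hzU : z ∈ Uᶜ := fun hzU => by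
      have := hr z hzU
      simp only [mem_sphere_iff_norm, sub_zero] at hz
      linarith
    rw [← hF2 hzU]
    field_simp
  have hpow : ∀ m : List (ℂ × ℤ), (∀ q ∈ m, q.1 ∈ U) → HasLog (Metric.sphere (0 : ℂ) r)
      (fun z => ratFun m z / z ^ (m.map (·.2)).sum) := by
    intro m
    induction m with
    | nil => intro _; simpa using hasLog_const _ one_ne_zero
    | cons q m ih =>
      intro hm
      refine (((hasLog_sub_div_sub (p := q.1) (q := 0) ?_).zpow q.2).mul
        (ih fun q hq => hm q (by simp [hq]))).congr fun z hz => ?_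
      · intro z hz
        simp only [mem_sphere_iff_norm, sub_zero] at hz ⊢
        rw [hz]
        exact hr _ (hm q (by simp))
      · have hz0 : z ≠ 0 := by
          rintro rfl
          simp at hz; linarith
        simp only [ratFun_cons, List.map_cons, List.sum_cons, sub_zero, zpow_add₀ hz0, div_zpow]
        field_simp
  have hN := eq_zero_of_hasLog_zpow_sphere hr0 ((hlogF.mul (hpow lin hlin').inv).congr
    (g := fun z => z ^ (lin.map (·.2)).sum) fun z hz => by
      have := hlogF.ne_zero hz
      field_simp)
  rw [← hN, index, hlin]
  clear_value U
  clear hlin' hpow hlogF hF2 hF1 hin0 hlin hN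
  clear hlK he hlout' hout0 hlout lout lin
  induction l with
  | nil => simp
  | cons q l ih =>
    by_cases h : q.1 ∈ U <;> simp [h, ih]

open Classical in
theorem even_card_of_prod_eq_sq {K : Set ℂ} (hK : IsCompact K) {ι : Type*} (A : Finset ι)
    (p : ι → ℂ) (hp : ∀ i ∈ A, p i ∉ K) {g : ℂ → ℂ} (hg : ContinuousOn g K)
    (hgA : ∀ z ∈ K, g z ^ 2 = ∏ i ∈ A, (z - p i)) {q : ℂ}
    (hb : Bornology.IsBounded (connectedComponentIn Kᶜ q)) :
    Even (A.filter fun i => p i ∈ connectedComponentIn Kᶜ q).card := by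
  classical
  have hA0 : ∀ z ∈ K, ∏ i ∈ A, (z - p i) ≠ 0 := fun z hz => Finset.prod_ne_zero_iff.2
    fun i hi => sub_ne_zero.2 fun h => hp i hi (h ▸ hz)
  obtain ⟨l, hl, hlog⟩ := exists_ratFun_hasLog hK hg fun z hz h0 => hA0 z hz (by
    rw [← hgA z hz, h0]; simp)
  have hR1 : ∀ z, ratFun (A.toList.map fun i => (p i, 1)) z = ∏ i ∈ A, (z - p i) := by
    intro z
    rw [ratFun, List.map_map, Finset.prod_map_toList]
    simp
  have hR2 : ∀ z, ratFun (l.map fun q => (q.1, 2 * q.2)) z = ratFun l z ^ 2 := by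
    intro z
    clear hl hlog
    induction l with
    | nil => simp
    | cons q l ih => 
      rw [List.map_cons, ratFun_cons, ratFun_cons, ih, mul_pow, mul_comm 2, zpow_mul]
      norm_cast
  have h1 : HasLog K (ratFun ((A.toList.map fun i => (p i, (1 : ℤ))) ++
      l.map fun q => (q.1, 2 * q.2))) := by
    refine (hlog.zpow 2).congr fun z hz => ?_
    rw [ratFun_append, hR1, hR2, ← hgA z hz, mul_zpow]
    norm_cast
  have h2 := index_eq_zero_of_hasLog hK (fun q hq => by
    rcases List.mem_append.1 hq with hq | hq
    · obtain ⟨i, hi, rfl⟩ := List.mem_map.1 hq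
      exact hp i (by simpa using hi)
    · obtain ⟨i, hi, rfl⟩ := List.mem_map.1 hq
      exact hl i hi) h1 hb
  rw [index, List.map_append, List.sum_append, List.map_map, List.map_map] at h2
  set U := connectedComponentIn Kᶜ q
  have e1 : (A.toList.map ((fun q : ℂ × ℤ => if q.1 ∈ U then q.2 else 0) ∘
      fun i => (p i, (1 : ℤ)))).sum = ((A.filter fun i => p i ∈ U).card : ℤ) := by
    rw [Finset.sum_map_toList, Finset.card_filter]
    push_cast
    exact Finset.sum_congr rfl fun i _ => by simp only [Function.comp]
  have e2 : ∃ n : ℤ, (l.map ((fun q : ℂ × ℤ => if q.1 ∈ U then q.2 else 0) ∘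
      fun q => (q.1, 2 * q.2))).sum = 2 * n := by
    clear h2 h1 hR2 hlog hl
    induction l with
    | nil => exact ⟨0, by simp⟩
    | cons q l ih =>
      obtain ⟨n, hn⟩ := ih
      rw [List.map_cons, List.sum_cons, hn]
      by_cases h : q.1 ∈ U
      · exact ⟨q.2 + n, by simp [h]; ring⟩
      · exact ⟨n, by simp [h]⟩
  obtain ⟨n, hn⟩ := e2
  rw [e1, hn] at h2
  have : Even ((A.filter fun i => p i ∈ U).card : ℤ) := ⟨-n, by linarith⟩
  rw [Int.even_coe_nat] at this
  convert this

theorem hasLog_of_mem_connectedComponentIn {K : Set ℂ} (hK : IsClosed K) {p q : ℂ}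
    (hp : p ∈ Kᶜ) (h : q ∈ connectedComponentIn Kᶜ p) : HasLog K fun z => (z - p) / (z - q) := by
  have hpre : IsPreconnected (connectedComponentIn Kᶜ p) := isPreconnected_connectedComponentIn
  have hsub : connectedComponentIn Kᶜ p ⊆ Kᶜ := connectedComponentIn_subset _ _
  refine hpre.induction₂ (fun p q => HasLog K fun z => (z - p) / (z - q)) ?_ ?_ ?_
    (mem_connectedComponentIn hp) h
  · intro x hx
    obtain ⟨ε, hε, hball⟩ := Metric.isOpen_iff.1 hK.isOpen_compl x (hsub hx)
    refine mem_nhdsWithin_of_mem_nhds (Filter.mem_of_superset (Metric.ball_mem_nhds x hε) ?_)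
    intro y hy
    refine (hasLog_sub_div_sub (p := y) (q := x) fun z hz => ?_).inv.congr fun z hz => ?_
    · have h1 : z ∉ Metric.ball x ε := fun h => hball h hz
      simp only [Metric.mem_ball, dist_eq_norm, not_lt] at h1 hy
      linarith
    · rw [inv_div]
  · intro x y w hx hy hw h1 h2
    refine (h1.mul h2).congr fun z hz => ?_
    have : z - y ≠ 0 := sub_ne_zero.2 fun h => hsub hy (h ▸ hz)
    field_simp
  · intro x y hx hy h1
    exact h1.inv.congr fun z hz => by rw [inv_div]

theorem hasLog_of_not_isBounded {K : Set ℂ} (hK : IsCompact K) {p : ℂ} (hp : p ∈ Kᶜ)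
    (h : ¬ Bornology.IsBounded (connectedComponentIn Kᶜ p)) : HasLog K fun z => z - p := by
  obtain ⟨r, hr⟩ := hK.isBounded.exists_norm_le
  obtain ⟨q, hq, hqr⟩ : ∃ q ∈ connectedComponentIn Kᶜ p, r < ‖q‖ := by
    by_contra! hcon
    exact h (isBounded_iff_forall_norm_le.2 ⟨r, hcon⟩)
  refine ((hasLog_of_mem_connectedComponentIn hK.isClosed hp hq).mul
    (hasLog_sub_of_norm_lt (q := q) fun z hz => (hr z hz).trans_lt hqr)).congr fun z hz => ?_
  have : z - q ≠ 0 := sub_ne_zero.2 fun h => connectedComponentIn_subset _ _ hq (h ▸ hz)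
  field_simp

end PlaneTopology

namespace PlaneTopology
open Set Filter Topology

/-- A drawing of a multigraph in the complex plane. -/
structure Drawing (V E : Type*) where
  pos : V → ℂ
  pos_injective : Function.Injective pos
  src : E → V
  tgt : E → V
  arc : E → ℝ → ℂ
  arc_cont : ∀ e, ContinuousOn (arc e) (Icc 0 1)
  arc_injOn : ∀ e, InjOn (arc e) (Icc 0 1)
  arc_zero : ∀ e, arc e 0 = pos (src e)
  arc_one : ∀ e, arc e 1 = pos (tgt e)
  arc_ne_pos : ∀ e w, ∀ t ∈ Ioo (0 : ℝ) 1, arc e t ≠ pos w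
  arc_ne_arc : ∀ e e', e ≠ e' → ∀ t ∈ Ioo (0 : ℝ) 1, ∀ t' ∈ Icc (0 : ℝ) 1, arc e t ≠ arc e' t'

namespace Drawing
variable {V E : Type*} (D : Drawing V E)

/-- The points of the plane covered by the vertices and by the edges in `S`. -/
def support (S : Set E) : Set ℂ := range D.pos ∪ ⋃ e : S, D.arc e '' Icc 0 1

theorem pos_mem_support (S : Set E) (v : V) : D.pos v ∈ D.support S := Or.inl ⟨v, rfl⟩

theorem arc_mem_support {S : Set E} {e : E} (he : e ∈ S) {t : ℝ} (ht : t ∈ Icc (0 : ℝ) 1) :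
    D.arc e t ∈ D.support S := Or.inr (mem_iUnion.2 ⟨⟨e, he⟩, t, ht, rfl⟩)

theorem support_mono {S T : Set E} (h : S ⊆ T) : D.support S ⊆ D.support T := by
  rintro z (hz | hz)
  · exact Or.inl hz
  · obtain ⟨⟨e, he⟩, t, ht, rfl⟩ := mem_iUnion.1 hz
    exact D.arc_mem_support (h he) ht

theorem isCompact_support [Finite V] [Finite E] (S : Set E) : IsCompact (D.support S) :=
  (finite_range _).isCompact.union
    (isCompact_iUnion fun e => isCompact_Icc.image_of_continuousOn (D.arc_cont e))

theorem forall_mem_support {S : Set E} {p : ℂ → Prop} (hv : ∀ v, p (D.pos v))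
    (he : ∀ e ∈ S, ∀ t ∈ Icc (0 : ℝ) 1, p (D.arc e t)) : ∀ z ∈ D.support S, p z := by
  rintro z (⟨v, rfl⟩ | hz)
  · exact hv v
  · obtain ⟨⟨e, he'⟩, t, ht, rfl⟩ := mem_iUnion.1 hz
    exact he e he' t ht

theorem continuousOn_arc_image (e : E) {φ : ℝ → ℂ} (hφ : ContinuousOn φ (Icc 0 1)) {G : ℂ → ℂ}
    (hG : ∀ t ∈ Icc (0 : ℝ) 1, G (D.arc e t) = φ t) : ContinuousOn G (D.arc e '' Icc 0 1) := by
  rw [continuousOn_iff_continuous_domRestrict]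
  have hc : Continuous (fun t : Icc (0 : ℝ) 1 => (⟨D.arc e t, t, t.2, rfl⟩ : D.arc e '' Icc 0 1)) :=
    (D.arc_cont e).domRestrict.subtype_mk _
  have hq := hc.isClosedMap.isQuotientMap hc (by rintro ⟨_, t, ht, rfl⟩; exact ⟨⟨t, ht⟩, rfl⟩)
  rw [hq.continuous_iff]
  refine hφ.domRestrict.congr fun t => ?_
  exact (hG t t.2).symm

theorem exists_continuousOn_support [Finite V] [Finite E] (S : Set E) (ψ : V → ℂ) (φ : E → ℝ → ℂ)
    (hφ : ∀ e ∈ S, ContinuousOn (φ e) (Icc 0 1)) (h0 : ∀ e ∈ S, φ e 0 = ψ (D.src e))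
    (h1 : ∀ e ∈ S, φ e 1 = ψ (D.tgt e)) :
    ∃ G : ℂ → ℂ, ContinuousOn G (D.support S) ∧ (∀ v, G (D.pos v) = ψ v) ∧
      ∀ e ∈ S, ∀ t ∈ Icc (0 : ℝ) 1, G (D.arc e t) = φ e t := by
  classical
  set G : ℂ → ℂ := fun z => if h : ∃ v, D.pos v = z then ψ h.choose else
    if h : ∃ q : E × ℝ, q.2 ∈ Ioo (0 : ℝ) 1 ∧ D.arc q.1 q.2 = z then
      φ h.choose.1 h.choose.2 else 0 with hG
  have hGv : ∀ v, G (D.pos v) = ψ v := by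
    intro v
    have hex : ∃ w, D.pos w = D.pos v := ⟨v, rfl⟩
    simp only [hG]
    rw [dif_pos hex, D.pos_injective hex.choose_spec]
  have hGe : ∀ e ∈ S, ∀ t ∈ Icc (0 : ℝ) 1, G (D.arc e t) = φ e t := by
    intro e he t ht
    rcases eq_or_lt_of_le ht.1 with rfl | ht0
    · rw [D.arc_zero, hGv, h0 e he]
    rcases eq_or_lt_of_le ht.2 with rfl | ht1
    · rw [D.arc_one, hGv, h1 e he]
    have hnv : ¬ ∃ w, D.pos w = D.arc e t := fun ⟨w, hw⟩ => D.arc_ne_pos e w t ⟨ht0, ht1⟩ hw.symm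
    have hex : ∃ q : E × ℝ, q.2 ∈ Ioo (0 : ℝ) 1 ∧ D.arc q.1 q.2 = D.arc e t :=
      ⟨(e, t), ⟨ht0, ht1⟩, rfl⟩
    simp only [hG]
    rw [dif_neg hnv, dif_pos hex]
    obtain ⟨hq1, hq2⟩ := hex.choose_spec
    have he' : hex.choose.1 = e := by
      by_contra hne
      exact D.arc_ne_arc _ _ hne _ hq1 t ht hq2
    have ht' : hex.choose.2 = t :=
      D.arc_injOn e (Ioo_subset_Icc_self hq1) ht
        ((congrArg (fun e => D.arc e hex.choose.2) he').symm.trans hq2)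
    rw [he', ht']
  refine ⟨G, ?_, hGv, hGe⟩
  refine ContinuousOn.union_of_isClosed ?_ ?_ (finite_range _).isClosed ?_
  · rw [← iUnion_singleton_eq_range]
    exact (locallyFinite_of_finite _).continuousOn_iUnion (fun _ => isClosed_singleton)
      fun _ => continuousOn_singleton _ _
  · exact (locallyFinite_of_finite _).continuousOn_iUnion
      (fun e => (isCompact_Icc.image_of_continuousOn (D.arc_cont e)).isClosed)
      fun e => D.continuousOn_arc_image e (hφ e e.2) (hGe e e.2)
  · exact isClosed_iUnion_of_finite
      fun e => (isCompact_Icc.image_of_continuousOn (D.arc_cont e)).isClosed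

/-- The sign attached to a residue modulo two. -/
noncomputable def sgn (n : ZMod 2) : ℂ := if n = 0 then 1 else -1

theorem sgn_zero : sgn 0 = 1 := by simp [sgn]

theorem zmod_two_cases (n : ZMod 2) : n = 0 ∨ n = 1 := by revert n; decide

theorem sgn_add (a b : ZMod 2) : sgn (a + b) = sgn a * sgn b := by
  rcases zmod_two_cases a with rfl | rfl <;> rcases zmod_two_cases b with rfl | rfl <;>
    simp [sgn, show (1 + 1 : ZMod 2) = 0 from by decide]

theorem sgn_sq (a : ZMod 2) : sgn a ^ 2 = 1 := by
  rcases zmod_two_cases a with rfl | rfl <;> simp [sgn]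

theorem sgn_injective : Function.Injective sgn := by
  intro a b h
  rcases zmod_two_cases a with rfl | rfl <;> rcases zmod_two_cases b with rfl | rfl <;>
    first
    | rfl
    | (exfalso; simp [sgn] at h; norm_num [Complex.ext_iff] at h)

theorem exists_sgn_of_sq_eq_sq {a b : ℂ} (h : a ^ 2 = b ^ 2) : ∃ n, a = sgn n * b := by
  rcases sq_eq_sq_iff_eq_or_eq_neg.1 h with rfl | rfl
  · exact ⟨0, by simp [sgn]⟩
  · exact ⟨1, by simp [sgn]⟩

/-- The class modulo two of a function along the edges: `n e` records the sign with which a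
continuous square root along the edge `e` meets chosen square roots at its ends. -/
def IsClass (f : ℂ → ℂ) (n : E → ZMod 2) : Prop :=
  ∃ (s : V → ℂ) (r : E → ℝ → ℂ), (∀ v, s v ^ 2 = f (D.pos v)) ∧ ∀ e,
    ContinuousOn (r e) (Icc 0 1) ∧ (∀ t ∈ Icc (0 : ℝ) 1, r e t ^ 2 = f (D.arc e t)) ∧
    r e 0 = s (D.src e) ∧ r e 1 = sgn (n e) * s (D.tgt e)

theorem exists_path_sqrt {g : ℝ → ℂ} (hg : ContinuousOn g (Icc 0 1))
    (h0 : ∀ t ∈ Icc (0 : ℝ) 1, g t ≠ 0) :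
    ∃ r : ℝ → ℂ, ContinuousOn r (Icc 0 1) ∧ ∀ t ∈ Icc (0 : ℝ) 1, r t ^ 2 = g t := by
  have hemb : Continuous fun t : ℝ => (t : ℂ) * Complex.I := by fun_prop
  obtain ⟨h, hh, he⟩ := hasLog_of_injOn_im (K := (fun t : ℝ => (t : ℂ) * Complex.I) '' Icc 0 1)
    (isCompact_Icc.image hemb)
    (by rintro _ ⟨a, _, rfl⟩ _ ⟨b, _, rfl⟩ hab; simp at hab; simp [hab])
    (f := fun z => g z.im) (hg.comp Complex.continuous_im.continuousOn
      (by rintro _ ⟨a, ha, rfl⟩; simpa using ha))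
    (by rintro _ ⟨a, ha, rfl⟩; simpa using h0 a ha)
  refine ⟨fun t => Complex.exp (h ((t : ℂ) * Complex.I) / 2), ?_, fun t ht => ?_⟩
  · exact ((hh.comp hemb.continuousOn (mapsTo_image _ _)).div_const 2).cexp
  · have := he _ ⟨t, ht, rfl⟩
    rw [← Complex.exp_nat_mul]
    simpa [mul_div_cancel₀] using this

theorem exists_isClass {f : ℂ → ℂ} (hf : ContinuousOn f (D.support univ))
    (h0 : ∀ z ∈ D.support univ, f z ≠ 0) : ∃ n, D.IsClass f n := by
  have hs : ∀ v, ∃ s : ℂ, s ^ 2 = f (D.pos v) := fun v =>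
    IsAlgClosed.exists_pow_nat_eq _ two_pos
  choose s hs using hs
  have hr : ∀ e, ∃ (n : ZMod 2) (r : ℝ → ℂ), ContinuousOn r (Icc 0 1) ∧
      (∀ t ∈ Icc (0 : ℝ) 1, r t ^ 2 = f (D.arc e t)) ∧ r 0 = s (D.src e) ∧
      r 1 = sgn n * s (D.tgt e) := by
    intro e
    have hmaps : MapsTo (D.arc e) (Icc 0 1) (D.support univ) := fun t ht =>
      D.arc_mem_support (mem_univ _) ht
    obtain ⟨r, hr, hre⟩ := exists_path_sqrt (hf.comp (D.arc_cont e) hmaps)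
      fun t ht => h0 _ (hmaps ht)
    obtain ⟨m, hm⟩ := exists_sgn_of_sq_eq_sq (a := r 0) (b := s (D.src e)) (by
      rw [hre 0 (by simp), hs, ← D.arc_zero]; rfl)
    obtain ⟨k, hk⟩ := exists_sgn_of_sq_eq_sq (a := r 1) (b := s (D.tgt e)) (by
      rw [hre 1 (by simp), hs, ← D.arc_one]; rfl)
    refine ⟨m + k, fun t => sgn m * r t, continuousOn_const.mul hr, fun t ht => ?_, ?_, ?_⟩
    · rw [mul_pow, sgn_sq, hre t ht, one_mul]; rfl
    · beta_reduce
      rw [hm, ← mul_assoc, ← sq, sgn_sq, one_mul]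
    · beta_reduce
      rw [hk, sgn_add]; ring
  choose n r hr using hr
  exact ⟨n, s, r, hs, hr⟩

variable {D}

theorem IsClass.mul {f g : ℂ → ℂ} {n m : E → ZMod 2} (hf : D.IsClass f n) (hg : D.IsClass g m) :
    D.IsClass (fun z => f z * g z) (n + m) := by
  obtain ⟨s, r, hs, hr⟩ := hf
  obtain ⟨s', r', hs', hr'⟩ := hg
  refine ⟨fun v => s v * s' v, fun e t => r e t * r' e t, fun v => by rw [mul_pow, hs, hs'],
    fun e => ⟨(hr e).1.mul (hr' e).1, fun t ht => ?_, ?_, ?_⟩⟩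
  · rw [mul_pow, (hr e).2.1 t ht, (hr' e).2.1 t ht]
  · beta_reduce
    rw [(hr e).2.2.1, (hr' e).2.2.1]
  · beta_reduce
    rw [(hr e).2.2.2, (hr' e).2.2.2, Pi.add_apply, sgn_add]; ring

theorem isClass_one : D.IsClass (fun _ => 1) 0 :=
  ⟨fun _ => 1, fun _ _ => 1, by simp, fun e => ⟨continuousOn_const, by simp, rfl, by simp [sgn]⟩⟩

theorem IsClass.prod {ι : Type*} (A : Finset ι) {f : ι → ℂ → ℂ} {n : ι → E → ZMod 2}
    (h : ∀ i ∈ A, D.IsClass (f i) (n i)) :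
    D.IsClass (fun z => ∏ i ∈ A, f i z) (∑ i ∈ A, n i) := by
  classical
  induction A using Finset.induction_on with
  | empty => simpa using isClass_one
  | insert i A hi ih =>
    have := (h i (by simp)).mul (ih fun j hj => h j (by simp [hj]))
    simpa [Finset.prod_insert hi, Finset.sum_insert hi] using this

variable (D) in
/-- The coboundary of a function on the vertices. -/
def coboundary (c : V → ZMod 2) (e : E) : ZMod 2 := c (D.src e) + c (D.tgt e)

theorem IsClass.add_coboundary {f : ℂ → ℂ} {n : E → ZMod 2} (hf : D.IsClass f n)
    (c : V → ZMod 2) : D.IsClass f (n + D.coboundary c) := by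
  obtain ⟨s, r, hs, hr⟩ := hf
  refine ⟨fun v => sgn (c v) * s v, fun e t => sgn (c (D.src e)) * r e t,
    fun v => by rw [mul_pow, sgn_sq, hs, one_mul],
    fun e => ⟨continuousOn_const.mul (hr e).1, fun t ht => ?_, ?_, ?_⟩⟩
  · rw [mul_pow, sgn_sq, (hr e).2.1 t ht, one_mul]
  · beta_reduce
    rw [(hr e).2.2.1]
  · beta_reduce
    rw [(hr e).2.2.2, Pi.add_apply, coboundary, sgn_add, sgn_add]
    linear_combination (-sgn (n e) * s (D.tgt e) * sgn (c (D.src e))) * sgn_sq (c (D.tgt e))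

/-- `f` has a continuous square root on `K`. -/
def _root_.PlaneTopology.HasSqrt (K : Set ℂ) (f : ℂ → ℂ) : Prop :=
  ∃ g : ℂ → ℂ, ContinuousOn g K ∧ ∀ z ∈ K, g z ^ 2 = f z

theorem _root_.PlaneTopology.HasLog.hasSqrt {K : Set ℂ} {f : ℂ → ℂ} (h : HasLog K f) :
    HasSqrt K f := by
  obtain ⟨l, hl, he⟩ := h
  refine ⟨fun z => Complex.exp (l z / 2), (hl.div_const 2).cexp, fun z hz => ?_⟩
  rw [← he z hz, ← Complex.exp_nat_mul]
  congr 1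
  push_cast; ring

theorem IsClass.hasSqrt [Finite V] [Finite E] {f : ℂ → ℂ} {n : E → ZMod 2} (hf : D.IsClass f n)
    {S : Set E} (hS : ∀ e ∈ S, n e = 0) : HasSqrt (D.support S) f := by
  obtain ⟨s, r, hs, hr⟩ := hf
  obtain ⟨G, hG, hGv, hGe⟩ := D.exists_continuousOn_support S s r (fun e _ => (hr e).1)
    (fun e _ => (hr e).2.2.1) (fun e he => by rw [(hr e).2.2.2, hS e he, sgn_zero, one_mul])
  refine ⟨G, hG, D.forall_mem_support (fun v => ?_) fun e he t ht => ?_⟩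
  · rw [hGv, hs]
  · rw [hGe e he t ht, (hr e).2.1 t ht]

theorem IsClass.exists_coboundary {f : ℂ → ℂ} {n : E → ZMod 2} (hf : D.IsClass f n)
    {S : Set E} (h0 : ∀ z ∈ D.support S, f z ≠ 0) (hS : HasSqrt (D.support S) f) :
    ∃ c, ∀ e ∈ S, n e = D.coboundary c e := by
  obtain ⟨s, r, hs, hr⟩ := hf
  obtain ⟨g, hg, hge⟩ := hS
  have hg0 : ∀ z ∈ D.support S, g z ≠ 0 := fun z hz h => h0 z hz (by rw [← hge z hz, h]; simp)
  have hc : ∀ v, ∃ c, s v = sgn c * g (D.pos v) := fun v => exists_sgn_of_sq_eq_sq (by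
    rw [hs, hge _ (D.pos_mem_support S v)])
  choose c hc using hc
  refine ⟨c, fun e he => ?_⟩
  have hmaps : MapsTo (D.arc e) (Icc 0 1) (D.support S) := fun t ht => D.arc_mem_support he ht
  have hq : ∀ t ∈ Icc (0 : ℝ) 1, ∃ c, r e t = sgn c * g (D.arc e t) := fun t ht =>
    exists_sgn_of_sq_eq_sq (by rw [(hr e).2.1 t ht, hge _ (hmaps ht)])
  have hquot : ContinuousOn (fun t => r e t / g (D.arc e t)) (Icc 0 1) :=
    (hr e).1.div (hg.comp (D.arc_cont e) hmaps) fun t ht => hg0 _ (hmaps ht)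
  have hval : MapsTo (fun t => r e t / g (D.arc e t)) (Icc 0 1) (range sgn) := by
    intro t ht
    obtain ⟨k, hk⟩ := hq t ht
    refine ⟨k, ?_⟩
    beta_reduce
    rw [hk, mul_div_cancel_right₀ _ (hg0 _ (hmaps ht))]
  have hconst := isPreconnected_Icc.constant_of_mapsTo (finite_range sgn).isDiscrete hquot hval
    (show (0 : ℝ) ∈ Icc (0 : ℝ) 1 by simp) (show (1 : ℝ) ∈ Icc (0 : ℝ) 1 by simp)
  beta_reduce at hconst
  rw [(hr e).2.2.1, (hr e).2.2.2, D.arc_zero, D.arc_one, hc, hc,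
    mul_div_cancel_right₀ _ (hg0 _ (D.pos_mem_support S _)), ← mul_assoc,
    mul_div_cancel_right₀ _ (hg0 _ (D.pos_mem_support S _)), ← sgn_add] at hconst
  rw [coboundary, sgn_injective hconst, add_assoc, CharTwo.add_self_eq_zero, add_zero]

theorem exists_isClass_eq [Finite V] [Finite E] (n : E → ZMod 2) :
    ∃ f : ℂ → ℂ, ContinuousOn f (D.support univ) ∧ (∀ z ∈ D.support univ, f z ≠ 0) ∧
      D.IsClass f n := by
  obtain ⟨f, hf, hfv, hfe⟩ := D.exists_continuousOn_support univ (fun _ => 1)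
    (fun e t => Complex.exp ((n e).val * (2 * Real.pi * Complex.I) * t))
    (fun e _ => by fun_prop) (fun e _ => by simp) (fun e _ => by
      rw [← Complex.exp_nat_mul_two_pi_mul_I (n e).val]; simp)
  refine ⟨f, hf, D.forall_mem_support (fun v => by simp [hfv]) fun e he t ht => ?_,
    fun _ => 1, fun e t => Complex.exp ((n e).val * (Real.pi * Complex.I) * t),
    fun v => by simp [hfv], fun e => ⟨by fun_prop, fun t ht => ?_, by simp, ?_⟩⟩
  · rw [hfe e he t ht]; exact Complex.exp_ne_zero _
  · rw [hfe e (mem_univ _) t ht, ← Complex.exp_nat_mul]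
    congr 1; push_cast; ring
  · rcases zmod_two_cases (n e) with h | h <;> simp [h, sgn, ZMod.val_one]

end Drawing
end PlaneTopology

namespace PlaneTopology
open Set Filter Topology

theorem HasSqrt.mono {K L : Set ℂ} {f : ℂ → ℂ} (h : HasSqrt K f) (hL : L ⊆ K) : HasSqrt L f := by
  obtain ⟨g, hg, he⟩ := h
  exact ⟨g, hg.mono hL, fun z hz => he z (hL hz)⟩

theorem HasSqrt.congr {K : Set ℂ} {f g : ℂ → ℂ} (h : HasSqrt K f) (hfg : ∀ z ∈ K, f z = g z) :
    HasSqrt K g := by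
  obtain ⟨l, hl, he⟩ := h
  exact ⟨l, hl, fun z hz => (he z hz).trans (hfg z hz)⟩

theorem HasLog.hasSqrt_sub_mul_sub {K : Set ℂ} {p q : ℂ} (hq : q ∉ K)
    (h : HasLog K fun z => (z - p) / (z - q)) : HasSqrt K fun z => (z - p) * (z - q) := by
  obtain ⟨g, hg, he⟩ := h.hasSqrt
  refine ⟨fun z => g z * (z - q), hg.mul (by fun_prop), fun z hz => ?_⟩
  have : z - q ≠ 0 := sub_ne_zero.2 fun h => hq (h ▸ hz)
  rw [mul_pow, he z hz]
  field_simp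

/-- If a product of linear factors has a continuous square root, then so has one of the factors
or a product of two of them. -/
theorem hasSqrt_factor {K : Set ℂ} (hK : IsCompact K) {ι : Type*} {A : Finset ι} {p : ι → ℂ}
    (hp : ∀ i ∈ A, p i ∉ K) (hA : HasSqrt K fun z => ∏ i ∈ A, (z - p i)) {i : ι} (hi : i ∈ A) :
    (HasSqrt K fun z => z - p i) ∨
      ∃ j ∈ A, j ≠ i ∧ HasSqrt K fun z => (z - p i) * (z - p j) := by
  classical
  by_cases hb : Bornology.IsBounded (connectedComponentIn Kᶜ (p i))
  · right
    obtain ⟨g, hg, hge⟩ := hA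
    have heven := even_card_of_prod_eq_sq hK A p hp hg hge hb
    have himem : i ∈ A.filter fun j => p j ∈ connectedComponentIn Kᶜ (p i) :=
      Finset.mem_filter.2 ⟨hi, mem_connectedComponentIn (hp i hi)⟩
    obtain ⟨j, hj, hji⟩ : ∃ j ∈ A.filter fun j => p j ∈ connectedComponentIn Kᶜ (p i), j ≠ i := by
      apply Finset.exists_mem_ne
      have h0 := Finset.card_pos.2 ⟨i, himem⟩
      obtain ⟨k, hk⟩ := heven
      convert (show 1 < k + k by
        have : 0 < k + k := by rw [← hk]; convert h0
        omega)
    obtain ⟨hjA, hj⟩ := Finset.mem_filter.1 hj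
    exact ⟨j, hjA, hji, (hasLog_of_mem_connectedComponentIn hK.isClosed (hp i hi)
      hj).hasSqrt_sub_mul_sub (hp j hjA)⟩
  · exact Or.inl (hasLog_of_not_isBounded hK (hp i hi) hb).hasSqrt

namespace Drawing
variable {V E : Type*} (D : Drawing V E)

/-- The coboundary as a linear map. -/
def coboundaryMap : (V → ZMod 2) →ₗ[ZMod 2] (E → ZMod 2) where
  toFun := D.coboundary
  map_add' c c' := by
    funext e; simp only [coboundary, Pi.add_apply]; ring
  map_smul' a c := by
    funext e; simp only [coboundary, Pi.smul_apply, smul_eq_mul, RingHom.id_apply]; ring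

/-- The first cohomology group modulo two. -/
abbrev Cohomology : Type _ := (E → ZMod 2) ⧸ LinearMap.range D.coboundaryMap

theorem cohomology_add_self (x : D.Cohomology) : x + x = 0 := by
  rw [← two_smul (ZMod 2), show (2 : ZMod 2) = 0 from rfl, zero_smul]

theorem cohomology_add_eq_zero {x y : D.Cohomology} : x + y = 0 ↔ x = y := by
  constructor
  · intro h
    calc x = x + (y + y) := by rw [cohomology_add_self, add_zero]
      _ = y := by rw [← add_assoc, h, zero_add]
  · rintro rfl; exact D.cohomology_add_self x

/-- `x` is the cohomology class of the function `f`. -/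
def Rep (f : ℂ → ℂ) (x : D.Cohomology) : Prop := ∃ n, D.IsClass f n ∧ Submodule.Quotient.mk n = x

variable {D}

theorem mk_add_coboundary (n : E → ZMod 2) (c : V → ZMod 2) :
    (Submodule.Quotient.mk (n + D.coboundary c) : D.Cohomology) = Submodule.Quotient.mk n := by
  rw [Submodule.Quotient.eq]
  exact ⟨c, by simp [coboundaryMap]⟩

theorem Rep.isClass {f : ℂ → ℂ} {n : E → ZMod 2} (h : D.Rep f (Submodule.Quotient.mk n)) :
    D.IsClass f n := by
  obtain ⟨m, hm, hmn⟩ := h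
  rw [eq_comm, Submodule.Quotient.eq] at hmn
  obtain ⟨c, hc⟩ := hmn
  have : n = m + D.coboundary c := by
    rw [show D.coboundary c = n - m from hc]; abel
  rw [this]
  exact hm.add_coboundary c

theorem Rep.mul {f g : ℂ → ℂ} {x y : D.Cohomology} (hf : D.Rep f x) (hg : D.Rep g y) :
    D.Rep (fun z => f z * g z) (x + y) := by
  obtain ⟨n, hn, rfl⟩ := hf
  obtain ⟨m, hm, rfl⟩ := hg
  exact ⟨n + m, hn.mul hm, rfl⟩

theorem rep_one : D.Rep (fun _ => 1) 0 := ⟨0, isClass_one, rfl⟩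

theorem Rep.prod {ι : Type*} (A : Finset ι) {f : ι → ℂ → ℂ} {x : ι → D.Cohomology}
    (h : ∀ i ∈ A, D.Rep (f i) (x i)) : D.Rep (fun z => ∏ i ∈ A, f i z) (∑ i ∈ A, x i) := by
  classical
  induction A using Finset.induction_on with
  | empty => simpa using rep_one
  | insert i A hi ih =>
    have := (h i (by simp)).mul (ih fun j hj => h j (by simp [hj]))
    simpa [Finset.prod_insert hi, Finset.sum_insert hi] using this

theorem exists_rep {f : ℂ → ℂ} (hf : ContinuousOn f (D.support univ))
    (h0 : ∀ z ∈ D.support univ, f z ≠ 0) : ∃ x, D.Rep f x := by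
  obtain ⟨n, hn⟩ := D.exists_isClass hf h0
  exact ⟨_, n, hn, rfl⟩

/-- The class of a single edge. -/
noncomputable def edgeClass (D : Drawing V E) (e : E) : D.Cohomology :=
  open Classical in Submodule.Quotient.mk (Pi.single e 1)

theorem Rep.eq_zero {f : ℂ → ℂ} {x : D.Cohomology} (h : D.Rep f x)
    (hs : HasSqrt (D.support univ) f) (h0 : ∀ z ∈ D.support univ, f z ≠ 0) : x = 0 := by
  obtain ⟨n, hn, rfl⟩ := h
  obtain ⟨c, hc⟩ := hn.exists_coboundary h0 hs
  rw [Submodule.Quotient.mk_eq_zero]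
  exact ⟨c, funext fun e => (hc e (mem_univ e)).symm⟩

theorem Rep.eq_zero_or_edgeClass {f : ℂ → ℂ} {x : D.Cohomology} (h : D.Rep f x) {e : E}
    (hs : HasSqrt (D.support {e}ᶜ) f) (h0 : ∀ z ∈ D.support {e}ᶜ, f z ≠ 0) :
    x = 0 ∨ x = D.edgeClass e := by
  classical
  obtain ⟨n, hn, rfl⟩ := h
  obtain ⟨c, hc⟩ := hn.exists_coboundary h0 hs
  rw [← mk_add_coboundary n c]
  have hz : ∀ e' ≠ e, (n + D.coboundary c) e' = 0 := fun e' he' => by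
    rw [Pi.add_apply, hc e' he', CharTwo.add_self_eq_zero]
  rcases zmod_two_cases ((n + D.coboundary c) e) with h | h
  · left
    rw [Submodule.Quotient.mk_eq_zero]
    convert Submodule.zero_mem _
    funext e'
    by_cases he' : e' = e
    · rw [he', h]; rfl
    · exact hz e' he'
  · right
    rw [edgeClass]
    congr 1
    funext e'
    by_cases he' : e' = e
    · subst he'; rw [h]; simp
    · rw [hz e' he']; simp [he']

theorem Rep.eq {f g : ℂ → ℂ} {x y : D.Cohomology} (hf : D.Rep f x) (hg : D.Rep g y)
    (hs : HasSqrt (D.support univ) fun z => f z * g z) (h0 : ∀ z ∈ D.support univ, f z ≠ 0)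
    (h0' : ∀ z ∈ D.support univ, g z ≠ 0) : x = y :=
  D.cohomology_add_eq_zero.1 ((hf.mul hg).eq_zero hs fun z hz => mul_ne_zero (h0 z hz) (h0' z hz))

theorem Rep.hasSqrt [Finite V] [Finite E] {f : ℂ → ℂ} (h : D.Rep f 0) :
    HasSqrt (D.support univ) f :=
  (Rep.isClass (n := 0) h).hasSqrt (by simp)

theorem Rep.hasSqrt_of_edgeClass [Finite V] [Finite E] {f : ℂ → ℂ} {e : E}
    (h : D.Rep f (D.edgeClass e)) : HasSqrt (D.support {e}ᶜ) f := by
  classical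
  refine (Rep.isClass h).hasSqrt fun e' he' => ?_
  have : e' ≠ e := he'
  simp [this]

variable (D) in
/-- The cohomology classes of the linear functions without zeros on the drawing; they correspond
to the faces. -/
def faceSet : Set D.Cohomology := {x | ∃ p ∉ D.support univ, D.Rep (fun z => z - p) x}

theorem sub_ne_zero_of_notMem {K : Set ℂ} {p : ℂ} (hp : p ∉ K) : ∀ z ∈ K, z - p ≠ 0 :=
  fun _ hz => sub_ne_zero.2 fun h => hp (h ▸ hz)

theorem zero_mem_faceSet [Finite V] [Finite E] : (0 : D.Cohomology) ∈ D.faceSet := by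
  have hK := D.isCompact_support univ
  obtain ⟨r, hr⟩ := hK.isBounded.exists_norm_le
  have hlt : ∀ z ∈ D.support univ, ‖z‖ < ‖((|r| + 1 : ℝ) : ℂ)‖ := fun z hz => by
    rw [Complex.norm_real, Real.norm_of_nonneg (by positivity)]
    exact (hr z hz).trans_lt ((le_abs_self r).trans_lt (lt_add_one _))
  have hp : ((|r| + 1 : ℝ) : ℂ) ∉ D.support univ := fun h => (hlt _ h).false
  obtain ⟨x, hx⟩ := D.exists_rep (f := fun z => z - ((|r| + 1 : ℝ) : ℂ)) (by fun_prop)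
    (sub_ne_zero_of_notMem hp)
  have : x = 0 := hx.eq_zero (hasLog_sub_of_norm_lt hlt).hasSqrt (sub_ne_zero_of_notMem hp)
  exact ⟨_, hp, this ▸ hx⟩

theorem exists_sum_faceSet [Finite V] [Finite E] (x : D.Cohomology) :
    ∃ A : Finset D.Cohomology, (∀ y ∈ A, y ∈ D.faceSet ∧ y ≠ 0) ∧ ∑ y ∈ A, y = x := by
  classical
  set P : D.Cohomology → Prop := fun x =>
    ∃ A : Finset D.Cohomology, (∀ y ∈ A, y ∈ D.faceSet ∧ y ≠ 0) ∧ ∑ y ∈ A, y = x with hP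
  have hP0 : P 0 := ⟨∅, by simp, by simp⟩
  have hPadd : ∀ x y, P x → y ∈ D.faceSet → P (y + x) := by
    rintro x y ⟨A, hA, rfl⟩ hy
    by_cases hy0 : y = 0
    · rw [hy0, zero_add]; exact ⟨A, hA, rfl⟩
    by_cases hyA : y ∈ A
    · refine ⟨A.erase y, fun w hw => hA w (Finset.mem_of_mem_erase hw), ?_⟩
      rw [← Finset.add_sum_erase A _ hyA, ← add_assoc, cohomology_add_self, zero_add]
    · refine ⟨insert y A, fun w hw => ?_, by rw [Finset.sum_insert hyA]⟩
      rcases Finset.mem_insert.1 hw with rfl | hw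
      · exact ⟨hy, hy0⟩
      · exact hA w hw
  have hR : ∀ l : List (ℂ × ℤ), (∀ q ∈ l, q.1 ∉ D.support univ) → ∃ y, P y ∧ D.Rep (ratFun l) y := by
    intro l
    induction l with
    | nil =>
      intro _
      refine ⟨0, hP0, ?_⟩
      convert (rep_one (D := D)) using 2
      simp
    | cons q l ih =>
      intro hl
      obtain ⟨y, hy, hyR⟩ := ih fun q hq => hl q (by simp [hq])
      have hq : q.1 ∉ D.support univ := hl q (by simp)
      have hq0 := sub_ne_zero_of_notMem hq
      have hfun : ratFun (q :: l) = fun z => (z - q.1) ^ q.2 * ratFun l z := by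
        funext z; simp
      have hcont : ∀ k : ℤ, ContinuousOn (fun z : ℂ => (z - q.1) ^ k) (D.support univ) := fun k =>
        (continuousOn_id.sub continuousOn_const).zpow₀ _ fun z hz => Or.inl (hq0 z hz)
      obtain ⟨w, hw⟩ := D.exists_rep (hcont q.2) fun z hz => zpow_ne_zero _ (hq0 z hz)
      rw [hfun]
      refine ⟨w + y, ?_, hw.mul hyR⟩
      rcases Int.even_or_odd' q.2 with ⟨k, hk | hk⟩
      · have : w = 0 := hw.eq_zero ⟨_, hcont k, fun z hz => by
          beta_reduce; rw [hk, mul_comm 2 k, zpow_mul]; norm_cast⟩ fun z hz => zpow_ne_zero _ (hq0 z hz)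
        rw [this, zero_add]; exact hy
      · obtain ⟨v, hv⟩ := D.exists_rep (f := fun z => z - q.1) (by fun_prop) hq0
        have : w = v := hw.eq hv ⟨_, hcont (k + 1), fun z hz => by
          beta_reduce
          rw [← zpow_add_one₀ (hq0 z hz), hk, show 2 * k + 1 + 1 = (k + 1) * 2 by ring, zpow_mul]
          norm_cast⟩ (fun z hz => zpow_ne_zero _ (hq0 z hz)) hq0
        exact hPadd _ _ hy (this ▸ ⟨q.1, hq, hv⟩)
  obtain ⟨n, rfl⟩ := Submodule.Quotient.mk_surjective _ x
  obtain ⟨f, hf, h0, hn⟩ := exists_isClass_eq (D := D) n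
  obtain ⟨l, hl, hlog⟩ := exists_ratFun_hasLog (D.isCompact_support univ) hf h0
  obtain ⟨y, hy, hyR⟩ := hR l hl
  have : Submodule.Quotient.mk n = y := Rep.eq (D := D) ⟨n, hn, rfl⟩ hyR hlog.hasSqrt h0
    fun z hz => ratFun_ne_zero fun q hq h => hl q hq (h ▸ hz)
  rw [this]
  exact hy

theorem exists_edgeClass_eq_add [Finite V] [Finite E] (e : E) :
    ∃ x ∈ D.faceSet, ∃ y ∈ D.faceSet, D.edgeClass e = x + y := by
  obtain ⟨A, hA, hsum⟩ := exists_sum_faceSet (D.edgeClass e)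
  by_cases he0 : D.edgeClass e = 0
  · exact ⟨0, zero_mem_faceSet, 0, zero_mem_faceSet, by simp [he0]⟩
  obtain ⟨x, hx⟩ : A.Nonempty := by
    rw [Finset.nonempty_iff_ne_empty]
    rintro rfl
    exact he0 (by simpa using hsum.symm)
  have hp : ∀ y, ∃ p, y ∈ A → p ∉ D.support univ ∧ D.Rep (fun z => z - p) y := fun y => by
    by_cases hy : y ∈ A
    · obtain ⟨p, hp⟩ := (hA y hy).1
      exact ⟨p, fun _ => hp⟩
    · exact ⟨0, fun h => (hy h).elim⟩
  choose p hp using hp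
  have hrep := Rep.prod A fun y hy => (hp y hy).2
  rw [hsum] at hrep
  have hmono : D.support {e}ᶜ ⊆ D.support univ := D.support_mono (subset_univ _)
  have h0 : ∀ y ∈ A, ∀ z ∈ D.support {e}ᶜ, z - p y ≠ 0 := fun y hy z hz =>
    sub_ne_zero_of_notMem (hp y hy).1 z (hmono hz)
  rcases hasSqrt_factor (D.isCompact_support {e}ᶜ) (fun y hy h => (hp y hy).1 (hmono h))
    hrep.hasSqrt_of_edgeClass hx with h | ⟨y, hy, hyx, h⟩
  · refine ⟨x, (hA x hx).1, 0, zero_mem_faceSet, ?_⟩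
    rw [add_zero]
    exact (((hp x hx).2.eq_zero_or_edgeClass h (h0 x hx)).resolve_left (hA x hx).2).symm
  · refine ⟨x, (hA x hx).1, y, (hA y hy).1, ?_⟩
    refine ((((hp x hx).2.mul (hp y hy).2).eq_zero_or_edgeClass h fun z hz =>
      mul_ne_zero (h0 x hx z hz) (h0 y hy z hz)).resolve_left fun hxy => ?_).symm
    exact hyx (D.cohomology_add_eq_zero.1 hxy).symm

theorem eq_empty_of_sum_faceSet_eq_zero [Finite V] [Finite E] {A : Finset D.Cohomology}
    (hA : ∀ y ∈ A, y ∈ D.faceSet ∧ y ≠ 0) (hsum : ∑ y ∈ A, y = 0) : A = ∅ := by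
  by_contra hne
  obtain ⟨x, hx⟩ := Finset.nonempty_iff_ne_empty.2 hne
  have hp : ∀ y, ∃ p, y ∈ A → p ∉ D.support univ ∧ D.Rep (fun z => z - p) y := fun y => by
    by_cases hy : y ∈ A
    · obtain ⟨p, hp⟩ := (hA y hy).1
      exact ⟨p, fun _ => hp⟩
    · exact ⟨0, fun h => (hy h).elim⟩
  choose p hp using hp
  have hrep := Rep.prod A fun y hy => (hp y hy).2
  rw [hsum] at hrep
  rcases hasSqrt_factor (D.isCompact_support univ) (fun y hy => (hp y hy).1) hrep.hasSqrt hx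
    with h | ⟨y, hy, hyx, h⟩
  · exact (hA x hx).2 ((hp x hx).2.eq_zero h (sub_ne_zero_of_notMem (hp x hx).1))
  · exact hyx ((hp x hx).2.eq (hp y hy).2 h (sub_ne_zero_of_notMem (hp x hx).1)
      (sub_ne_zero_of_notMem (hp y hy).1)).symm

/-- Functions on the set of faces that vanish at the outer face extend to linear functionals. -/
theorem exists_functional [Finite V] [Finite E] (s : D.Cohomology → ZMod 2) (hs : s 0 = 0) :
    ∃ ψ : D.Cohomology →ₗ[ZMod 2] ZMod 2, ∀ x ∈ D.faceSet, ψ x = s x := by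
  classical
  set v : {x : D.Cohomology // x ∈ D.faceSet ∧ x ≠ 0} → D.Cohomology := Subtype.val with hv
  have hli : LinearIndependent (ZMod 2) v := by
    rw [linearIndependent_iff']
    intro t g hg
    have h1 : ∑ y ∈ (t.filter fun i => g i ≠ 0).map (Function.Embedding.subtype _), y = 0 := by
      rw [Finset.sum_map, Finset.sum_filter]
      refine Eq.trans ?_ hg
      refine Finset.sum_congr rfl fun i _ => ?_
      rcases zmod_two_cases (g i) with h | h <;> simp [h, hv]
    have h2 := eq_empty_of_sum_faceSet_eq_zero (fun y hy => by
      obtain ⟨i, -, rfl⟩ := Finset.mem_map.1 hy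
      exact i.2) h1
    rw [Finset.map_eq_empty, Finset.filter_eq_empty_iff] at h2
    intro i hi
    simpa using h2 hi
  have hsp : ⊤ ≤ Submodule.span (ZMod 2) (range v) := by
    intro x _
    obtain ⟨A, hA, rfl⟩ := exists_sum_faceSet x
    exact Submodule.sum_mem _ fun y hy => Submodule.subset_span ⟨⟨y, hA y hy⟩, rfl⟩
  set b := Module.Basis.mk hli hsp with hb
  refine ⟨b.constr (ZMod 2) fun i => s i, fun x hx => ?_⟩
  by_cases hx0 : x = 0
  · rw [hx0, map_zero, hs]
  · have : b ⟨x, hx, hx0⟩ = x := by rw [hb, Module.Basis.mk_apply]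
    conv_lhs => rw [← this]
    rw [Module.Basis.constr_basis]

theorem parity_eq_sum_coboundary [Fintype E] (hst : ∀ e, D.src e ≠ D.tgt e) (z : E → ZMod 2)
    (v : V) [DecidableEq V] : GraphDual.parity (fun e => s(D.src e, D.tgt e)) z v =
      ∑ e, z e * D.coboundary (Pi.single v 1) e := by
  unfold GraphDual.parity
  refine Finset.sum_congr rfl fun e _ => ?_
  have := hst e
  simp only [Sym2.mem_iff, coboundary, Pi.single_apply]
  by_cases h1 : v = D.src e
  · subst h1
    simp [this.symm]
  · by_cases h2 : v = D.tgt e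
    · subst h2; simp [h1, Ne.symm h1]
    · simp [h1, h2, Ne.symm h1, Ne.symm h2]

variable (D) in
theorem exists_isDual [Fintype V] [Fintype E] (hst : ∀ e, D.src e ≠ D.tgt e) :
    ∃ L R : E → D.faceSet, GraphDual.IsDual (fun e => s(D.src e, D.tgt e)) L R := by
  classical
  choose L hL R hR hLR using exists_edgeClass_eq_add (D := D)
  refine ⟨fun e => ⟨L e, hL e⟩, fun e => ⟨R e, hR e⟩, fun z => ⟨fun hz => ?_, ?_⟩⟩
  · set θ : (E → ZMod 2) →ₗ[ZMod 2] ZMod 2 := Fintype.linearCombination (ZMod 2) z with hθ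
    have hker : LinearMap.range D.coboundaryMap ≤ LinearMap.ker θ := by
      rintro _ ⟨c, rfl⟩
      have : θ ∘ₗ D.coboundaryMap = 0 := by
        refine LinearMap.pi_ext' fun v => LinearMap.ext_ring ?_
        have := hz v
        rw [parity_eq_sum_coboundary hst] at this
        simpa [hθ, Fintype.linearCombination_apply, coboundaryMap, mul_comm] using this
      exact LinearMap.congr_fun this c
    set ψ : D.Cohomology →ₗ[ZMod 2] ZMod 2 := Submodule.liftQ _ θ hker with hψ
    refine ⟨fun x => ψ x, fun e => ?_⟩
    beta_reduce
    rw [← map_add, ← hLR, edgeClass, hψ]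
    change z e = θ (Pi.single e 1)
    simp [hθ, Fintype.linearCombination_apply, Pi.single_apply]
  · rintro ⟨s, hs⟩ v
    obtain ⟨ψ, hψ⟩ := exists_functional (D := D)
      (fun x => if h : x ∈ D.faceSet then s ⟨x, h⟩ + s ⟨0, zero_mem_faceSet⟩ else 0)
      (by simp [zero_mem_faceSet, CharTwo.add_self_eq_zero])
    have hψe : ∀ e, ψ (D.edgeClass e) = z e := by
      intro e
      rw [hLR, map_add, hψ _ (hL e), hψ _ (hR e), dif_pos (hL e), dif_pos (hR e), hs]
      linear_combination CharTwo.add_self_eq_zero (s ⟨0, zero_mem_faceSet⟩)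
    rw [parity_eq_sum_coboundary hst]
    have h1 : ψ (Submodule.Quotient.mk (D.coboundary (Pi.single v 1))) = 0 := by
      have h0 := mk_add_coboundary (D := D) 0 (Pi.single v 1)
      rw [zero_add, Submodule.Quotient.mk_zero] at h0
      rw [h0, map_zero]
    have h2 := LinearMap.pi_apply_eq_sum_univ (ψ ∘ₗ (LinearMap.range D.coboundaryMap).mkQ)
      (D.coboundary (Pi.single v 1))
    rw [LinearMap.comp_apply, Submodule.mkQ_apply, h1] at h2
    rw [h2]
    refine Finset.sum_congr rfl fun e _ => ?_
    rw [← hψe, edgeClass, smul_eq_mul, mul_comm, LinearMap.comp_apply, Submodule.mkQ_apply]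
    congr 3
    funext e'
    simp [Pi.single_apply, eq_comm]

end Drawing
end PlaneTopology

namespace GraphEmbeddingIn

open Set

variable {W : Type u} {G : SimpleGraph W}

theorem arc_ne_arc (D : GraphEmbeddingIn (ℝ × ℝ) G) {u v u' v' : W} (h : G.Adj u v)
    (h' : G.Adj u' v') (hne : s(u, v) ≠ s(u', v')) {t t' : ℝ} (ht : t ∈ Ioo (0 : ℝ) 1)
    (ht' : t' ∈ Icc (0 : ℝ) 1) : D.edgeArc u v h t ≠ D.edgeArc u' v' h' t' := fun heq => by
  have hmem : D.edgeArc u v h t ∈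
      D.edgeArc u v h '' Ioo 0 1 ∩ D.edgeArc u' v' h' '' Icc 0 1 :=
    ⟨⟨t, ht, rfl⟩, t', ht', heq.symm⟩
  rw [D.arc_disjoint u v h u' v' h' hne] at hmem
  exact hmem

/-- A drawing in the complex plane of the multigraph consisting of the edges of `G`. -/
theorem exists_drawing (D : GraphEmbeddingIn (ℝ × ℝ) G) :
    ∃ D' : PlaneTopology.Drawing W G.edgeSet, ∀ e, s(D'.src e, D'.tgt e) = (e : Sym2 W) := by
  have hrep : ∀ e : G.edgeSet, ∃ a b : W, s(a, b) = (e : Sym2 W) ∧ G.Adj a b := by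
    rintro ⟨e, he⟩
    induction e using Sym2.ind with
    | _ a b => exact ⟨a, b, rfl, he⟩
  choose src tgt hst hadj using hrep
  let ι := Complex.equivRealProdCLM.symm
  have hι : Function.Injective ι := ι.injective
  refine ⟨{
    pos := fun v => ι (D.vertexPos v)
    pos_injective := hι.comp D.vertexInj
    src := src
    tgt := tgt
    arc := fun e t => ι (D.edgeArc _ _ (hadj e) t)
    arc_cont := fun e => ι.continuous.comp_continuousOn (D.arc_cont _ _ _)
    arc_injOn := fun e => hι.comp_injOn (D.arc_injOn _ _ _)
    arc_zero := fun e => congrArg ι (D.arc_start _ _ _)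
    arc_one := fun e => congrArg ι (D.arc_end _ _ _)
    arc_ne_pos := fun e w t ht h => D.arc_avoid _ _ (hadj e) w ⟨t, ht, hι h⟩
    arc_ne_arc := fun e e' hne t ht t' ht' h =>
      D.arc_ne_arc (hadj e) (hadj e') (by rwa [hst, hst, ne_eq, Subtype.coe_inj]) ht ht' (hι h) },
    hst⟩

theorem hasDual [Fintype W] (D : GraphEmbeddingIn (ℝ × ℝ) G) : GraphDual.HasDual G := by
  classical
  obtain ⟨D', hD'⟩ := D.exists_drawing
  obtain ⟨L, R, h⟩ := D'.exists_isDual fun e hne => by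
    have hadj : G.Adj (D'.src e) (D'.tgt e) := by
      rw [← SimpleGraph.mem_edgeSet, hD']
      exact e.2
    exact hadj.ne hne
  rw [funext hD'] at h
  have : Finite D'.Cohomology :=
    Finite.of_surjective _ (Submodule.mkQ_surjective _)
  refine ⟨D'.faceSet, inferInstance, L, R, ?_⟩
  convert h

end GraphEmbeddingIn

theorem SimpleGraph.CliqueFree.triangleFree {W : Type u} {G : SimpleGraph W} (h : G.CliqueFree 3) :
    GraphDual.TriangleFree G := by
  classical
  exact fun x y z hxy hyz hxz => h {x, y, z} (SimpleGraph.is3Clique_triple_iff.2 ⟨hxy, hxz, hyz⟩)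

/-- Any assignment of colors to two non-adjacent vertices of a planar triangle-free graph
extends to a proper 3-coloring. -/
theorem two_vertex_precoloring_extends [Fintype V] (G : SimpleGraph V)
    (hplanar : G.IsPlanar) (htf : G.CliqueFree 3)
    (u v : V) (huv : u ≠ v) (hadj : ¬ G.Adj u v) (cu cv : Fin 3) :
    ∃ φ : G.Coloring (Fin 3), φ u = cu ∧ φ v = cv := by
  obtain ⟨D⟩ := hplanar
  obtain ⟨φ, hφ, hu, hv⟩ := D.hasDual.exists_coloring_extending htf.triangleFree huv hadj cu cv
  exact ⟨SimpleGraph.Coloring.mk φ fun {x y} h => hφ x y h, hu, hv⟩
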